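/- arXiv:math/0311269 — 3 statements merged into one kernel-verified Lean document; each statement's English description precedes it below -/
import Mathlib

section
/- Let A be a compact metric space, let f : ℝ^N × A → ℝ^N be continuous with ‖f(x,a) − f(y,a)‖ ≤ L‖x − y‖ for some L > 0 and all x, y ∈ ℝ^N, a ∈ A, let {α_n} be a sequence of relaxed controls in 𝒜, and let c > 0. Then there exist a subsequence of {α_n} (not relabeled) and α ∈ 𝒜 such that: (1) α_n → α weak-* on [0,c], meaning that for every Lebesgue-integrable B : [0,c] → C(A) and every t ∈ [0,c], ∫₀^t ∫_A (B(s))(a) d(α_n(s))(a) ds → ∫₀^t ∫_A (B(s))(a) d(α(s))(a) ds; and (2) whenever x_n → x in ℝ^N, the trajectories y_{x_n}(·,α_n) converge to y_x(·,α) uniformly on [0,c]. -/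
open MeasureTheory Set Filter Topology Metric
open scoped RealInnerProductSpace ENNReal

noncomputable section

/-- The set of relaxed controls: measurable families `t ↦ β t` of Radon probability
measures on the control space `A` (measurability in the weak-* sense). -/
def IsRelaxedControl {A : Type*} [MetricSpace A] [MeasurableSpace A]
    (β : ℝ → Measure A) : Prop :=
  (∀ t, IsProbabilityMeasure (β t)) ∧
    ∀ g : C(A, ℝ), Measurable fun t => ∫ a, g a ∂(β t)

/-- `y` is the trajectory of `ẏ = f^r(y, β)` with `y 0 = x` (integral form). -/
def IsTrajectory {N : ℕ} {A : Type*} [MeasurableSpace A]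
    (f : EuclideanSpace ℝ (Fin N) → A → EuclideanSpace ℝ (Fin N))
    (β : ℝ → Measure A) (x : EuclideanSpace ℝ (Fin N))
    (y : ℝ → EuclideanSpace ℝ (Fin N)) : Prop :=
  y 0 = x ∧ Continuous y ∧
    ∀ t, 0 ≤ t → y t = x + ∫ s in (0:ℝ)..t, ∫ a, f (y s) a ∂(β s)

/-- The set of times `t ≥ 0` at which the trajectory `y` lies in the target `T`;
its infimum is the exit time `t_x(β)`, and `t_x(β) < ∞` iff this set is nonempty. -/
def exitTimes {N : ℕ} (T : Set (EuclideanSpace ℝ (Fin N)))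
    (y : ℝ → EuclideanSpace ℝ (Fin N)) : Set ℝ :=
  {t : ℝ | 0 ≤ t ∧ y t ∈ T}

/-- The running cost `∫₀^t ℓ^r(y(s), β(s)) ds`, as an extended nonnegative real. -/
def runCost {N : ℕ} {A : Type*} [MeasurableSpace A]
    (ℓ : EuclideanSpace ℝ (Fin N) → A → ℝ) (β : ℝ → Measure A)
    (y : ℝ → EuclideanSpace ℝ (Fin N)) (t : ℝ) : ℝ≥0∞ :=
  ∫⁻ s in Ioc (0:ℝ) t, ENNReal.ofReal (∫ a, ℓ (y s) a ∂(β s))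

/-- The value function `v(x)` of the exit time problem, as an extended real
(`+∞` when no relaxed control brings `x` to the target in finite time). -/
def valueFn {N : ℕ} {A : Type*} [MetricSpace A] [MeasurableSpace A]
    (T : Set (EuclideanSpace ℝ (Fin N))) (ℓ : EuclideanSpace ℝ (Fin N) → A → ℝ)
    (Y : EuclideanSpace ℝ (Fin N) → (ℝ → Measure A) → ℝ → EuclideanSpace ℝ (Fin N))
    (x : EuclideanSpace ℝ (Fin N)) : EReal :=
  sInf { c : EReal | ∃ β : ℝ → Measure A, IsRelaxedControl β ∧
      (exitTimes T (Y x β)).Nonempty ∧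
      c = ((runCost ℓ β (Y x β) (sInf (exitTimes T (Y x β)))) : EReal) }

/-- Viscosity solution of `F(x, Dw(x)) = 0` on the open set `G`, via `C¹` test functions. -/
def IsViscositySol {N : ℕ}
    (F : EuclideanSpace ℝ (Fin N) → EuclideanSpace ℝ (Fin N) → ℝ)
    (G : Set (EuclideanSpace ℝ (Fin N))) (w : EuclideanSpace ℝ (Fin N) → ℝ) : Prop :=
  (∀ γ : EuclideanSpace ℝ (Fin N) → ℝ, ContDiffOn ℝ 1 γ G → ∀ x₀ ∈ G,
      IsLocalMinOn (fun x => w x - γ x) G x₀ → 0 ≤ F x₀ (gradient γ x₀)) ∧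
  (∀ γ : EuclideanSpace ℝ (Fin N) → ℝ, ContDiffOn ℝ 1 γ G → ∀ x₁ ∈ G,
      IsLocalMaxOn (fun x => w x - γ x) G x₁ → F x₁ (gradient γ x₁) ≤ 0)

/-- The Hamiltonian `sup_{m ∈ A^r} { −f^r(x,m)·p − ℓ^r(x,m) }` of the HJBE. -/
def HJB {N : ℕ} {A : Type*} [MetricSpace A] [MeasurableSpace A]
    (f : EuclideanSpace ℝ (Fin N) → A → EuclideanSpace ℝ (Fin N))
    (ℓ : EuclideanSpace ℝ (Fin N) → A → ℝ)
    (x p : EuclideanSpace ℝ (Fin N)) : ℝ :=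
  ⨆ m : ProbabilityMeasure A,
    (-(inner (𝕜 := ℝ) (∫ a, f x a ∂(m : Measure A)) p : ℝ) - ∫ a, ℓ x a ∂(m : Measure A))


lemma rc_measurable {A : Type*} [MetricSpace A] [CompactSpace A]
    [MeasurableSpace A] [BorelSpace A] {β : ℝ → Measure A} (h : IsRelaxedControl β) :
    Measurable β := by
  have := h.1
  refine Measurable.measure_of_isPiSystem_of_isProbabilityMeasure
    (S := {s : Set A | IsClosed s}) ?_ isPiSystem_isClosed ?_
  · rw [← borel_eq_generateFrom_isClosed]; exact BorelSpace.measurable_eq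
  · intro F hF
    have hF' : IsClosed F := hF
    refine measurable_of_tendsto_metrizable (f := fun n t => ∫⁻ a, (hF'.apprSeq n a : ℝ≥0∞) ∂(β t))
      ?_ ?_
    · intro n
      have h2 := (h.2 ⟨fun a => ((hF'.apprSeq n a : NNReal) : ℝ), by fun_prop⟩).ennreal_ofReal
      convert h2 using 2 with t
      simp only [ContinuousMap.coe_mk]
      rw [ofReal_integral_eq_lintegral_ofReal]
      · simp
      · have : Continuous (fun a => ((hF'.apprSeq n a : NNReal) : ℝ)) := by fun_prop
        exact this.integrable_of_hasCompactSupport (HasCompactSupport.of_compactSpace _)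
      · exact ae_of_all _ fun a => NNReal.coe_nonneg _
    · rw [tendsto_pi_nhds]
      intro t
      exact HasOuterApproxClosed.tendsto_lintegral_apprSeq hF' (β t)

open ProbabilityTheory in
lemma weak_compact {A : Type*} [MetricSpace A] [CompactSpace A] [Nonempty A]
    [MeasurableSpace A] [BorelSpace A] (ν : Measure ℝ) [IsProbabilityMeasure ν]
    (κ : ℕ → Kernel ℝ A) [∀ n, IsMarkovKernel (κ n)] :
    ∃ φ : ℕ → ℕ, StrictMono φ ∧ ∃ α : Kernel ℝ A, IsMarkovKernel α ∧
      ∀ g : BoundedContinuousFunction (ℝ × A) ℝ,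
        Tendsto (fun n => ∫ s, ∫ a, g (s, a) ∂(κ (φ n) s) ∂ν) atTop
          (𝓝 (∫ s, ∫ a, g (s, a) ∂(α s) ∂ν)) := by
  let μ : ℕ → ProbabilityMeasure (ℝ × A) := fun n => ⟨ν ⊗ₘ κ n, inferInstance⟩
  have htight : IsTightMeasureSet
      {((m : ProbabilityMeasure (ℝ × A)) : Measure (ℝ × A)) | m ∈ range μ} := by
    refine IsTightMeasureSet.prodMk ?_ IsTightMeasureSet.of_compactSpace
    refine (isTightMeasureSet_singleton (μ := ν)).subset ?_
    rintro _ ⟨_, ⟨_, ⟨n, rfl⟩, rfl⟩, rfl⟩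
    simp [μ]
  have hcomp := isCompact_closure_of_isTightMeasureSet htight
  obtain ⟨m, -, φ, hφ, hlim⟩ := hcomp.isSeqCompact
    (x := μ) (fun n => subset_closure (mem_range_self n))
  have hfst : (m : Measure (ℝ × A)).fst = ν := by
    have h1 : Tendsto (fun n => (μ (φ n)).map (f := Prod.fst) (by fun_prop)) atTop
        (𝓝 (m.map (f := Prod.fst) (by fun_prop))) :=
      ProbabilityMeasure.tendsto_map_of_tendsto_of_continuous _ _ hlim continuous_fst
    have h2 : ∀ n, (μ (φ n)).map (f := Prod.fst) (by fun_prop) = ⟨ν, inferInstance⟩ := by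
      intro n
      apply Subtype.ext
      change ((ν ⊗ₘ κ (φ n)).map Prod.fst) = ν
      exact Measure.fst_compProd ..
    simp only [h2] at h1
    have h3 := tendsto_nhds_unique tendsto_const_nhds h1
    have h4 := congrArg (fun q : ProbabilityMeasure ℝ => (q : Measure ℝ)) h3
    exact h4.symm
  refine ⟨φ, hφ, (m : Measure (ℝ × A)).condKernel, inferInstance, fun g => ?_⟩
  have h5 := (ProbabilityMeasure.tendsto_iff_forall_integral_tendsto.1 hlim) g
  have hint : ∀ (P : Measure (ℝ × A)) [IsProbabilityMeasure P], Integrable g P :=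
    fun P _ => g.integrable P
  have h6 : ∫ z, g z ∂(m : Measure (ℝ × A)) =
      ∫ s, ∫ a, g (s, a) ∂((m : Measure (ℝ × A)).condKernel s) ∂ν := by
    conv_lhs => rw [← (m : Measure (ℝ × A)).disintegrate (m : Measure (ℝ × A)).condKernel]
    rw [hfst, Measure.integral_compProd (hint _)]
  rw [← h6]
  refine h5.congr fun n => ?_
  exact Measure.integral_compProd (hint (ν ⊗ₘ κ (φ n)))

open ProbabilityTheory in
lemma integrable_aux {A : Type*} [MetricSpace A] [CompactSpace A]
    [MeasurableSpace A] [BorelSpace A] {ν : Measure ℝ}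
    (κ : Kernel ℝ A) [IsMarkovKernel κ] {B : ℝ → C(A, ℝ)} (hB : Integrable B ν) :
    Integrable (fun s => ∫ a, B s a ∂(κ s)) ν := by
  have hm : AEStronglyMeasurable (fun s => ∫ a, B s a ∂(κ s)) ν := by
    obtain ⟨B', hB', hBB⟩ := hB.1
    refine ⟨fun s => ∫ a, B' s a ∂(κ s), ?_, ?_⟩
    · refine StronglyMeasurable.integral_kernel_prod_right (f := fun s a => B' s a) ?_
      have h1 : StronglyMeasurable (fun z : ℝ × A => (B' z.1, z.2)) :=
        (hB'.comp_measurable measurable_fst).prodMk measurable_snd.stronglyMeasurable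
      exact (ContinuousEval.continuous_eval (F := C(A, ℝ))).comp_stronglyMeasurable h1
    · filter_upwards [hBB] with s hs
      rw [hs]
  refine hB.norm.mono' hm (ae_of_all _ fun s => ?_)
  refine (norm_integral_le_of_norm_le_const (C := ‖B s‖)
    (ae_of_all _ fun a => (B s).norm_coe_le_norm a)).trans ?_
  simp

open ProbabilityTheory in
lemma weak_L1 {A : Type*} [MetricSpace A] [CompactSpace A]
    [MeasurableSpace A] [BorelSpace A] (ν : Measure ℝ) [IsProbabilityMeasure ν]
    (κ : ℕ → Kernel ℝ A) [∀ n, IsMarkovKernel (κ n)] (α : Kernel ℝ A) [IsMarkovKernel α]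
    (h : ∀ g : BoundedContinuousFunction (ℝ × A) ℝ,
        Tendsto (fun n => ∫ s, ∫ a, g (s, a) ∂(κ n s) ∂ν) atTop
          (𝓝 (∫ s, ∫ a, g (s, a) ∂(α s) ∂ν)))
    (B : ℝ → C(A, ℝ)) (hB : Integrable B ν) :
    Tendsto (fun n => ∫ s, ∫ a, B s a ∂(κ n s) ∂ν) atTop (𝓝 (∫ s, ∫ a, B s a ∂(α s) ∂ν)) := by
  have key : ∀ (η : Kernel ℝ A) [IsMarkovKernel η] (g : ℝ → C(A, ℝ)), Integrable g ν →
      |∫ s, ∫ a, B s a ∂(η s) ∂ν - ∫ s, ∫ a, g s a ∂(η s) ∂ν| ≤ ∫ s, ‖B s - g s‖ ∂ν := by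
    intro η _ g hg
    rw [← integral_sub (integrable_aux η hB) (integrable_aux η hg), ← Real.norm_eq_abs]
    refine norm_integral_le_of_norm_le (hB.sub hg).norm (ae_of_all _ fun s => ?_)
    have hi : ∀ u : C(A, ℝ), Integrable u (η s) := fun u =>
      u.continuous.integrable_of_hasCompactSupport (HasCompactSupport.of_compactSpace _)
    rw [← integral_sub (hi _) (hi _)]
    refine (norm_integral_le_of_norm_le_const (C := ‖B s - g s‖)
      (ae_of_all _ fun a => (B s - g s).norm_coe_le_norm a)).trans ?_
    simp
  rw [Metric.tendsto_atTop]
  intro ε hε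
  obtain ⟨g, hg, hgi⟩ := hB.exists_boundedContinuous_integral_sub_le (ε := ε / 4) (by positivity)
  let G : BoundedContinuousFunction (ℝ × A) ℝ :=
    BoundedContinuousFunction.ofNormedAddCommGroup (fun z : ℝ × A => g z.1 z.2)
      (by
        have h1 : Continuous (fun z : ℝ × A => (g z.1, z.2)) := by fun_prop
        exact (ContinuousEval.continuous_eval (F := C(A, ℝ))).comp h1) ‖g‖
      (fun z => ((g z.1).norm_coe_le_norm z.2).trans (g.norm_coe_le_norm z.1))
  obtain ⟨n₀, hn₀⟩ := Metric.tendsto_atTop.1 (h G) (ε / 4) (by positivity)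
  refine ⟨n₀, fun n hn => ?_⟩
  have h1 := hn₀ n hn
  have h2 := key (κ n) g hgi
  have h3 := key α g hgi
  simp only [G, BoundedContinuousFunction.coe_ofNormedAddCommGroup, Real.dist_eq] at h1
  rw [Real.dist_eq]
  rw [abs_lt] at *
  rw [abs_le] at h2 h3
  constructor <;> linarith [h1.1, h1.2, h2.1, h2.2, h3.1, h3.2]

lemma gronwall_integral {u : ℝ → ℝ} (hu : Continuous u) {ε L c : ℝ} (hε : 0 ≤ ε) (hL : 0 < L)
    (h : ∀ t ∈ Icc (0:ℝ) c, u t ≤ ε + L * ∫ s in (0:ℝ)..t, u s) :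
    ∀ t ∈ Icc (0:ℝ) c, u t ≤ ε * Real.exp (L * c) := by
  have hd : ∀ t, HasDerivAt (fun t => ∫ s in (0:ℝ)..t, u s) (u t) t := fun t =>
    intervalIntegral.integral_hasDerivAt_right (hu.intervalIntegrable _ _)
      hu.aestronglyMeasurable.stronglyMeasurableAtFilter hu.continuousAt
  intro t ht
  have hw := le_gronwallBound_of_liminf_deriv_right_le (f := fun t => ∫ s in (0:ℝ)..t, u s)
    (f' := u) (δ := 0) (K := L) (ε := ε) (a := 0) (b := c)
    (fun x _ => (hd x).continuousAt.continuousWithinAt)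
    (fun x _ r hr => (hd x).hasDerivWithinAt.liminf_right_slope_le hr) (by simp)
    (fun x hx => by have := h x ⟨hx.1, hx.2.le⟩; linarith) t ht
  rw [gronwallBound_of_K_ne_0 hL.ne'] at hw
  have h1 := h t ht
  have h2 : L * (∫ s in (0:ℝ)..t, u s) ≤ ε * (Real.exp (L * t) - 1) := by
    have h3 := mul_le_mul_of_nonneg_left hw hL.le
    refine h3.trans (le_of_eq ?_)
    field_simp
    simp
  have h4 : Real.exp (L * t) ≤ Real.exp (L * c) := by
    apply Real.exp_le_exp.2; nlinarith [ht.2]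
  nlinarith

lemma unif_of_lip {E : Type*} [NormedAddCommGroup E] {e : ℕ → ℝ → E} {c M : ℝ} (hM : 0 ≤ M)
    (hlip : ∀ n, ∀ s ∈ Icc (0:ℝ) c, ∀ t ∈ Icc (0:ℝ) c, ‖e n s - e n t‖ ≤ M * |s - t|)
    (hpt : ∀ t ∈ Icc (0:ℝ) c, Tendsto (fun n => e n t) atTop (𝓝 0)) :
    ∀ ε > 0, ∀ᶠ n in atTop, ∀ t ∈ Icc (0:ℝ) c, ‖e n t‖ ≤ ε := by
  have : TendstoUniformlyOn e (fun _ => 0) atTop (Icc (0:ℝ) c) := by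
    rw [← tendstoLocallyUniformlyOn_iff_tendstoUniformlyOn_of_compact isCompact_Icc,
      Metric.tendstoLocallyUniformlyOn_iff]
    intro ε hε t ht
    refine ⟨Icc 0 c ∩ Metric.ball t (ε / (2 * (M + 1))), inter_mem self_mem_nhdsWithin
      (mem_nhdsWithin_of_mem_nhds (Metric.ball_mem_nhds _ (by positivity))), ?_⟩
    filter_upwards [(Metric.tendsto_nhds.1 (hpt t ht)) (ε / 2) (by positivity)] with n hn s hs
    have h1 := hlip n s hs.1 t ht
    have h2 : |s - t| < ε / (2 * (M + 1)) := by simpa [Real.dist_eq] using hs.2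
    have h3 : M * |s - t| ≤ ε / 2 := by
      calc M * |s - t| ≤ (M + 1) * (ε / (2 * (M + 1))) := by
            gcongr; linarith
        _ = ε / 2 := by field_simp
    rw [dist_zero_right] at hn
    rw [dist_zero_left]
    calc ‖e n s‖ = ‖(e n s - e n t) + e n t‖ := by simp
      _ ≤ _ := norm_add_le _ _
      _ < ε := by linarith
  intro ε hε
  filter_upwards [Metric.tendstoUniformlyOn_iff.1 this ε hε] with n hn t ht
  have := hn t ht
  rw [dist_zero_left] at this
  exact this.le

open ProbabilityTheory in
lemma fr_meas {N : ℕ} {A : Type*} [MetricSpace A] [CompactSpace A]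
    [MeasurableSpace A] [BorelSpace A]
    {f : EuclideanSpace ℝ (Fin N) → A → EuclideanSpace ℝ (Fin N)}
    (hf : Continuous fun q : EuclideanSpace ℝ (Fin N) × A => f q.1 q.2)
    (κ : Kernel ℝ A) [IsMarkovKernel κ] {y : ℝ → EuclideanSpace ℝ (Fin N)} (hy : Continuous y) :
    StronglyMeasurable (fun s => ∫ a, f (y s) a ∂(κ s)) := by
  refine StronglyMeasurable.integral_kernel_prod_right (f := fun s a => f (y s) a) ?_
  have : Continuous (fun z : ℝ × A => f (y z.1) z.2) :=
    hf.comp (f := fun z : ℝ × A => (y z.1, z.2)) (by fun_prop)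
  exact this.stronglyMeasurable

lemma fr_bound {N : ℕ} {A : Type*} [MetricSpace A] [CompactSpace A]
    {f : EuclideanSpace ℝ (Fin N) → A → EuclideanSpace ℝ (Fin N)}
    (hf : Continuous fun q : EuclideanSpace ℝ (Fin N) × A => f q.1 q.2)
    {y : ℝ → EuclideanSpace ℝ (Fin N)} (hy : Continuous y) (a b : ℝ) :
    ∃ M, 0 ≤ M ∧ ∀ s ∈ Icc a b, ∀ u, ‖f (y s) u‖ ≤ M := by
  have h : Continuous (fun z : ℝ × A => f (y z.1) z.2) :=
    hf.comp (f := fun z : ℝ × A => (y z.1, z.2)) (by fun_prop)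
  obtain ⟨M, hM⟩ := ((isCompact_Icc (a := a) (b := b)).prod
    (isCompact_univ (X := A))).exists_bound_of_continuousOn h.continuousOn
  exact ⟨max M 0, le_max_right _ _, fun s hs u => (hM (s, u) ⟨hs, mem_univ _⟩).trans
    (le_max_left _ _)⟩

open ProbabilityTheory in
lemma fr_norm {N : ℕ} {A : Type*} [MeasurableSpace A] (m : Measure A) [IsProbabilityMeasure m]
    {g : A → EuclideanSpace ℝ (Fin N)} {M : ℝ} (h : ∀ u, ‖g u‖ ≤ M) : ‖∫ a, g a ∂m‖ ≤ M := by
  refine (norm_integral_le_of_norm_le_const (C := M) (ae_of_all _ h)).trans ?_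
  simp

open ProbabilityTheory in
lemma fr_int {N : ℕ} {A : Type*} [MetricSpace A] [CompactSpace A]
    [MeasurableSpace A] [BorelSpace A]
    {f : EuclideanSpace ℝ (Fin N) → A → EuclideanSpace ℝ (Fin N)}
    (hf : Continuous fun q : EuclideanSpace ℝ (Fin N) × A => f q.1 q.2)
    (κ : Kernel ℝ A) [IsMarkovKernel κ] {y : ℝ → EuclideanSpace ℝ (Fin N)} (hy : Continuous y)
    (a b : ℝ) :
    IntervalIntegrable (fun s => ∫ a, f (y s) a ∂(κ s)) volume a b := by
  obtain ⟨M, -, hM⟩ := fr_bound hf hy (min a b) (max a b)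
  rw [intervalIntegrable_iff]
  refine Measure.integrableOn_of_bounded (M := M) (by simp)
    (fr_meas hf κ hy).aestronglyMeasurable ?_
  refine (ae_restrict_iff' measurableSet_uIoc).2 (ae_of_all _ fun s hs => ?_)
  exact fr_norm (κ s) (hM s (Ioc_subset_Icc_self hs))

open ProbabilityTheory in
lemma fr_coord {N : ℕ} {A : Type*} [MetricSpace A] [CompactSpace A]
    [MeasurableSpace A] [BorelSpace A]
    {f : EuclideanSpace ℝ (Fin N) → A → EuclideanSpace ℝ (Fin N)}
    (hf : Continuous fun q : EuclideanSpace ℝ (Fin N) × A => f q.1 q.2)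
    (κ : Kernel ℝ A) [IsMarkovKernel κ] {y : ℝ → EuclideanSpace ℝ (Fin N)} (hy : Continuous y)
    (t : ℝ) (i : Fin N) :
    (∫ s in (0:ℝ)..t, ∫ a, f (y s) a ∂(κ s)) i = ∫ s in (0:ℝ)..t, ∫ a, f (y s) a i ∂(κ s) := by
  have h1 := (EuclideanSpace.proj (𝕜 := ℝ) i :
    EuclideanSpace ℝ (Fin N) →L[ℝ] ℝ).intervalIntegral_comp_comm (fr_int hf κ hy 0 t)
  have h2 : ∀ s, (∫ a, f (y s) a ∂(κ s)) i = ∫ a, f (y s) a i ∂(κ s) := fun s => by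
    have hc : Continuous (f (y s)) := hf.comp (f := fun a : A => (y s, a)) (by fun_prop)
    have hi : Integrable (f (y s)) (κ s) :=
      hc.integrable_of_hasCompactSupport (HasCompactSupport.of_compactSpace _)
    exact ((EuclideanSpace.proj (𝕜 := ℝ) i : EuclideanSpace ℝ (Fin N) →L[ℝ] ℝ).integral_comp_comm hi).symm
  simp only [← h2]
  exact h1.symm

open ProbabilityTheory in
lemma fr_conv {N : ℕ} {A : Type*} [MetricSpace A] [CompactSpace A]
    [MeasurableSpace A] [BorelSpace A]
    {f : EuclideanSpace ℝ (Fin N) → A → EuclideanSpace ℝ (Fin N)}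
    (hf : Continuous fun q : EuclideanSpace ℝ (Fin N) × A => f q.1 q.2)
    (κ : ℕ → Kernel ℝ A) [∀ n, IsMarkovKernel (κ n)] (α : Kernel ℝ A) [IsMarkovKernel α] {c : ℝ}
    (hw : ∀ B : ℝ → C(A, ℝ), IntegrableOn B (Icc (0:ℝ) c) → ∀ t ∈ Icc (0:ℝ) c,
        Tendsto (fun n => ∫ s in (0:ℝ)..t, ∫ a, (B s) a ∂(κ n s)) atTop
          (𝓝 (∫ s in (0:ℝ)..t, ∫ a, (B s) a ∂(α s))))
    {y : ℝ → EuclideanSpace ℝ (Fin N)} (hy : Continuous y) (t : ℝ) (ht : t ∈ Icc (0:ℝ) c) :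
    Tendsto (fun n => ∫ s in (0:ℝ)..t, ∫ a, f (y s) a ∂(κ n s)) atTop
      (𝓝 (∫ s in (0:ℝ)..t, ∫ a, f (y s) a ∂(α s))) := by
  rw [(EuclideanSpace.equiv (Fin N) ℝ).toHomeomorph.isInducing.tendsto_nhds_iff, tendsto_pi_nhds]
  intro i
  change Tendsto (fun n => (∫ s in (0:ℝ)..t, ∫ a, f (y s) a ∂(κ n s)) i) atTop
      (𝓝 ((∫ s in (0:ℝ)..t, ∫ a, f (y s) a ∂(α s)) i))
  simp only [fr_coord hf _ hy]
  have h : Continuous (fun z : ℝ × A => f (y z.1) z.2 i) := by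
    have h0 : Continuous (fun z : ℝ × A => f (y z.1) z.2) :=
      hf.comp (f := fun z : ℝ × A => (y z.1, z.2)) (by fun_prop)
    fun_prop
  let B : ℝ → C(A, ℝ) := fun s => ⟨fun a => f (y s) a i,
    h.comp (f := fun a : A => (s, a)) (by fun_prop)⟩
  have hB : Continuous B := ContinuousMap.continuous_of_continuous_uncurry _ h
  exact hw B hB.integrableOn_Icc t ht

open ProbabilityTheory in
lemma traj_conv {N : ℕ} {A : Type*} [MetricSpace A] [CompactSpace A]
    [MeasurableSpace A] [BorelSpace A]
    {f : EuclideanSpace ℝ (Fin N) → A → EuclideanSpace ℝ (Fin N)}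
    (hf : Continuous fun q : EuclideanSpace ℝ (Fin N) × A => f q.1 q.2)
    {L : ℝ} (hL : 0 < L)
    (hfLip : ∀ x y a, ‖f x a - f y a‖ ≤ L * ‖x - y‖)
    (κ : ℕ → Kernel ℝ A) [∀ n, IsMarkovKernel (κ n)] (α : Kernel ℝ A) [IsMarkovKernel α] {c : ℝ}
    (hw : ∀ B : ℝ → C(A, ℝ), IntegrableOn B (Icc (0:ℝ) c) → ∀ t ∈ Icc (0:ℝ) c,
        Tendsto (fun n => ∫ s in (0:ℝ)..t, ∫ a, (B s) a ∂(κ n s)) atTop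
          (𝓝 (∫ s in (0:ℝ)..t, ∫ a, (B s) a ∂(α s))))
    (xs : ℕ → EuclideanSpace ℝ (Fin N)) (x : EuclideanSpace ℝ (Fin N))
    (hx : Tendsto xs atTop (𝓝 x))
    (ys : ℕ → ℝ → EuclideanSpace ℝ (Fin N)) (y : ℝ → EuclideanSpace ℝ (Fin N))
    (hys : ∀ n, IsTrajectory f (κ n) (xs n) (ys n)) (hy : IsTrajectory f α x y) :
    TendstoUniformlyOn ys y atTop (Icc (0:ℝ) c) := by
  obtain ⟨-, hyc, hyi⟩ := hy
  obtain ⟨M, hM0, hM⟩ := fr_bound hf hyc 0 c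
  let e : ℕ → ℝ → EuclideanSpace ℝ (Fin N) := fun n t =>
    (∫ s in (0:ℝ)..t, ∫ a, f (y s) a ∂(κ n s)) - ∫ s in (0:ℝ)..t, ∫ a, f (y s) a ∂(α s)
  have hlip1 : ∀ (η : Kernel ℝ A) [IsMarkovKernel η], ∀ s ∈ Icc (0:ℝ) c, ∀ t ∈ Icc (0:ℝ) c,
      ‖(∫ r in (0:ℝ)..s, ∫ a, f (y r) a ∂(η r)) - ∫ r in (0:ℝ)..t, ∫ a, f (y r) a ∂(η r)‖
        ≤ M * |s - t| := by
    intro η _ s hs t ht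
    rw [intervalIntegral.integral_interval_sub_left (fr_int hf η hyc 0 s) (fr_int hf η hyc 0 t)]
    refine intervalIntegral.norm_integral_le_of_norm_le_const fun r hr => fr_norm (η r) (hM r ?_)
    exact (uIcc_subset_Icc ht hs) (uIoc_subset_uIcc hr)
  have he := unif_of_lip (e := e) (c := c) (M := 2 * M) (by positivity)
    (fun n s hs t ht => by
      have h1 := hlip1 (κ n) s hs t ht
      have h2 := hlip1 α s hs t ht
      calc ‖e n s - e n t‖ = ‖((∫ r in (0:ℝ)..s, ∫ a, f (y r) a ∂(κ n r)) -
              ∫ r in (0:ℝ)..t, ∫ a, f (y r) a ∂(κ n r)) -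
            ((∫ r in (0:ℝ)..s, ∫ a, f (y r) a ∂(α r)) -
              ∫ r in (0:ℝ)..t, ∫ a, f (y r) a ∂(α r))‖ := by
            congr 1; simp only [e]; abel
        _ ≤ _ := norm_sub_le _ _
        _ ≤ 2 * M * |s - t| := by linarith)
    (fun t ht => by
      have := (fr_conv hf κ α hw hyc t ht).sub_const (∫ s in (0:ℝ)..t, ∫ a, f (y s) a ∂(α s))
      rwa [sub_self] at this)
  rw [Metric.tendstoUniformlyOn_iff]
  intro ε hε
  set δ : ℝ := ε / (4 * Real.exp (L * c)) with hδ
  have hδ0 : 0 < δ := by positivity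
  filter_upwards [he δ hδ0, (Metric.tendsto_nhds.1 hx) δ hδ0] with n hn hxn t ht
  obtain ⟨-, hnc, hni⟩ := hys n
  have hgr := gronwall_integral (u := fun t => ‖ys n t - y t‖) (by fun_prop) (ε := 2 * δ)
    (L := L) (c := c) (by positivity) hL (fun t ht => by
      have heq : ys n t - y t = (xs n - x) + e n t +
          ∫ s in (0:ℝ)..t, ((∫ a, f (ys n s) a ∂(κ n s)) - ∫ a, f (y s) a ∂(κ n s)) := by
        rw [intervalIntegral.integral_sub (fr_int hf (κ n) hnc 0 t) (fr_int hf (κ n) hyc 0 t),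
          hni t ht.1, hyi t ht.1]
        simp only [e]
        abel
      have h3 : ‖∫ s in (0:ℝ)..t, ((∫ a, f (ys n s) a ∂(κ n s)) - ∫ a, f (y s) a ∂(κ n s))‖
          ≤ L * ∫ s in (0:ℝ)..t, ‖ys n s - y s‖ := by
        rw [← intervalIntegral.integral_const_mul]
        refine intervalIntegral.norm_integral_le_of_norm_le ht.1 (ae_of_all _ fun s _ => ?_)
          (Continuous.intervalIntegrable (by fun_prop) _ _)
        have hi : ∀ z, Integrable (f z) (κ n s) := fun z => by
          have hc : Continuous (f z) := hf.comp (f := fun a : A => (z, a)) (by fun_prop)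
          exact hc.integrable_of_hasCompactSupport (HasCompactSupport.of_compactSpace _)
        rw [← integral_sub (hi _) (hi _)]
        exact fr_norm (κ n s) (fun a => hfLip _ _ a)
      have h4 := hn t ht
      rw [dist_eq_norm] at hxn
      change ‖ys n t - y t‖ ≤ _
      rw [heq]
      refine (norm_add_le _ _).trans (add_le_add ((norm_add_le _ _).trans ?_) h3)
      linarith) t ht
  rw [dist_comm, dist_eq_norm]
  refine hgr.trans_lt ?_
  have : 2 * δ * Real.exp (L * c) = ε / 2 := by
    rw [hδ]; field_simp; norm_num
  linarith

open ProbabilityTheory in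
lemma nu_integral {A : Type*} [MetricSpace A] [CompactSpace A]
    [MeasurableSpace A] (κ : Kernel ℝ A) (B : ℝ → C(A, ℝ)) {c t : ℝ}
    (ht : t ∈ Icc (0:ℝ) c) :
    ∫ s, ∫ a, (Ioc 0 t).indicator B s a ∂(κ s)
        ∂((ENNReal.ofReal c)⁻¹ • volume.restrict (Ioc (0:ℝ) c)) =
      (ENNReal.ofReal c)⁻¹.toReal * ∫ s in (0:ℝ)..t, ∫ a, B s a ∂(κ s) := by
  have h : (fun s => ∫ a, (Ioc 0 t).indicator B s a ∂(κ s)) =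
      (Ioc 0 t).indicator (fun s => ∫ a, B s a ∂(κ s)) := by
    funext s
    by_cases hs : s ∈ Ioc 0 t
    · simp [hs]
    · simp [hs]
  rw [h, integral_smul_measure, integral_indicator measurableSet_Ioc,
    Measure.restrict_restrict measurableSet_Ioc, inter_eq_left.2 (Ioc_subset_Ioc_right ht.2),
    intervalIntegral.integral_of_le ht.1, smul_eq_mul]

lemma ind_aux {E : Type*} [NormedAddCommGroup E] {B : ℝ → E} {c : ℝ}
    (hB : IntegrableOn B (Icc (0:ℝ) c)) (t : ℝ) {k : ℝ≥0∞} (hk : k ≠ ⊤) :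
    Integrable ((Ioc 0 t).indicator B) (k • volume.restrict (Ioc (0:ℝ) c)) := by
  have h1 : Integrable B (volume.restrict (Ioc (0:ℝ) c)) := hB.mono_set Ioc_subset_Icc_self
  exact (h1.indicator measurableSet_Ioc).smul_measure hk

/-- sequential compactness of relaxed controls.  Every sequence of relaxed
controls has a subsequence converging weak-* on `[0,c]` to some relaxed control `α`,
and the corresponding trajectories from converging initial states converge uniformly
on `[0,c]` to the trajectory of `α`. -/
theorem relaxed_control_compactness {N : ℕ} {A : Type*} [MetricSpace A] [CompactSpace A]
    [Nonempty A] [MeasurableSpace A] [BorelSpace A]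
    (f : EuclideanSpace ℝ (Fin N) → A → EuclideanSpace ℝ (Fin N))
    (hf : Continuous fun q : EuclideanSpace ℝ (Fin N) × A => f q.1 q.2)
    (L : ℝ) (hL : 0 < L)
    (hfLip : ∀ x y a, ‖f x a - f y a‖ ≤ L * ‖x - y‖)
    (Y : EuclideanSpace ℝ (Fin N) → (ℝ → Measure A) → ℝ → EuclideanSpace ℝ (Fin N))
    (hY : ∀ x β, IsRelaxedControl β → IsTrajectory f β x (Y x β))
    (αseq : ℕ → ℝ → Measure A) (hαseq : ∀ n, IsRelaxedControl (αseq n))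
    (c : ℝ) (hc : 0 < c) :
    ∃ φ : ℕ → ℕ, StrictMono φ ∧ ∃ α : ℝ → Measure A, IsRelaxedControl α ∧
      -- (1) weak-* convergence on `[0,c]`
      (∀ B : ℝ → C(A, ℝ), IntegrableOn B (Icc (0:ℝ) c) → ∀ t ∈ Icc (0:ℝ) c,
        Tendsto (fun n => ∫ s in (0:ℝ)..t, ∫ a, (B s) a ∂(αseq (φ n) s)) atTop
          (𝓝 (∫ s in (0:ℝ)..t, ∫ a, (B s) a ∂(α s)))) ∧
      -- (2) uniform convergence of trajectories on `[0,c]`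
      (∀ (xs : ℕ → EuclideanSpace ℝ (Fin N)) (x : EuclideanSpace ℝ (Fin N)),
        Tendsto xs atTop (𝓝 x) →
        TendstoUniformlyOn (fun n t => Y (xs n) (αseq (φ n)) t) (Y x α) atTop
          (Icc (0:ℝ) c)) := by
  let κ : ℕ → ProbabilityTheory.Kernel ℝ A := fun n => ⟨αseq n, rc_measurable (hαseq n)⟩
  have hκ : ∀ n, ProbabilityTheory.IsMarkovKernel (κ n) := fun n => ⟨(hαseq n).1⟩
  have hc0 : ENNReal.ofReal c ≠ 0 := by simpa using hc
  have hν : IsProbabilityMeasure ((ENNReal.ofReal c)⁻¹ • volume.restrict (Ioc (0:ℝ) c)) := by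
    constructor
    simp only [Measure.smul_apply, Measure.restrict_apply_univ, Real.volume_Ioc, sub_zero,
      smul_eq_mul]
    exact ENNReal.inv_mul_cancel hc0 ENNReal.ofReal_ne_top
  obtain ⟨φ, hφ, α, hα, hconv⟩ :=
    weak_compact ((ENNReal.ofReal c)⁻¹ • volume.restrict (Ioc (0:ℝ) c)) κ
  have hαr : IsRelaxedControl (fun t => α t) := by
    refine ⟨fun t => inferInstance, fun g => ?_⟩
    have : StronglyMeasurable (fun t => ∫ a, g a ∂(α t)) := by
      refine StronglyMeasurable.integral_kernel_prod_right (f := fun _ a => g a) ?_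
      have : Continuous (fun z : ℝ × A => g z.2) := by fun_prop
      exact this.stronglyMeasurable
    exact this.measurable
  have hw : ∀ B : ℝ → C(A, ℝ), IntegrableOn B (Icc (0:ℝ) c) → ∀ t ∈ Icc (0:ℝ) c,
        Tendsto (fun n => ∫ s in (0:ℝ)..t, ∫ a, (B s) a ∂(κ (φ n) s)) atTop
          (𝓝 (∫ s in (0:ℝ)..t, ∫ a, (B s) a ∂(α s))) := by
    intro B hB t ht
    have hBi : Integrable ((Ioc 0 t).indicator B)
        ((ENNReal.ofReal c)⁻¹ • volume.restrict (Ioc (0:ℝ) c)) := by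
      exact ind_aux hB t (ENNReal.inv_ne_top.2 hc0)
    have h2 := weak_L1 _ (fun n => κ (φ n)) α hconv _ hBi
    simp only [nu_integral _ B ht] at h2
    have hne : (ENNReal.ofReal c)⁻¹.toReal ≠ 0 := by
      rw [ENNReal.toReal_inv, ENNReal.toReal_ofReal hc.le]
      positivity
    have h3 := h2.const_mul ((ENNReal.ofReal c)⁻¹.toReal)⁻¹
    simpa only [inv_mul_cancel_left₀ hne] using h3
  refine ⟨φ, hφ, fun t => α t, hαr, hw, fun xs x hx => ?_⟩
  exact traj_conv hf hL hfLip (fun n => κ (φ n)) α hw xs x hx _ _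
    (fun n => hY (xs n) _ (hαseq (φ n))) (hY x _ hαr)
end
end

section
/- Let p ∈ [0,2] be a constant and T ⊆ ℝ² be closed and nonempty. Consider the exit-time problem with control set A = the closed unit ball of ℝ², dynamics f(x,a) = a, and Lagrangian ℓ(x,a) = [1 + √(‖x‖)]^{−p}, with value function v_{e,p}. If w : ℝ² → ℝ is continuous, bounded from below, vanishes on T, and is a viscosity solution of the eikonal equation ‖Dw(x)‖ = [1 + √(‖x‖)]^{−p} on ℝ² ∖ T, then w ≡ v_{e,p}. -/
open MeasureTheory Set Filter Topology Metric
open scoped RealInnerProductSpace ENNReal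

noncomputable section

instance : Nonempty (Metric.closedBall (0:EuclideanSpace ℝ (Fin 2)) 1) :=
  ⟨⟨0, Metric.mem_closedBall_self zero_le_one⟩⟩

instance : CompactSpace (Metric.closedBall (0:EuclideanSpace ℝ (Fin 2)) 1) :=
  isCompact_iff_compactSpace.mp (isCompact_closedBall _ _)


abbrev E2 := EuclideanSpace ℝ (Fin 2)
abbrev A2 := Metric.closedBall (0:EuclideanSpace ℝ (Fin 2)) 1

def ell (p : ℝ) (x : E2) : ℝ := (1 + Real.sqrt ‖x‖) ^ (-p)

lemma ell_pos (p : ℝ) (x : E2) : 0 < ell p x := by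
  unfold ell; positivity

lemma ell_le_one {p : ℝ} (hp : 0 ≤ p) (x : E2) : ell p x ≤ 1 := by
  unfold ell
  apply Real.rpow_le_one_of_one_le_of_nonpos
  · have := Real.sqrt_nonneg ‖x‖; linarith
  · linarith

lemma ell_cont (p : ℝ) : Continuous (ell p) := by
  unfold ell
  apply Continuous.rpow_const
  · fun_prop
  · intro x; left; positivity

lemma ell_ratio {p : ℝ} (hp : p ∈ Icc (0:ℝ) 2) (x y : E2) {d : ℝ} (hd : ‖x - y‖ ≤ d) :
    ell p x ≤ (1 + Real.sqrt d) ^ 2 * ell p y := by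
  have h1 : Real.sqrt ‖y‖ ≤ Real.sqrt ‖x‖ + Real.sqrt d := by
    have : ‖y‖ ≤ ‖x‖ + d := by
      have := norm_sub_norm_le y x
      rw [norm_sub_rev] at this; linarith
    calc Real.sqrt ‖y‖ ≤ Real.sqrt (‖x‖ + d) := Real.sqrt_le_sqrt this
      _ ≤ _ := by
        have h0 : 0 ≤ d := (norm_nonneg _).trans hd
        apply Real.sqrt_le_iff.2
        refine ⟨by positivity, ?_⟩
        nlinarith [Real.sq_sqrt (norm_nonneg x), Real.sq_sqrt h0,
          mul_nonneg (Real.sqrt_nonneg ‖x‖) (Real.sqrt_nonneg d)]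
  have hx := Real.sqrt_nonneg ‖x‖
  have hy := Real.sqrt_nonneg ‖y‖
  have hd' := Real.sqrt_nonneg d
  have h2 : 1 + Real.sqrt ‖y‖ ≤ (1 + Real.sqrt d) * (1 + Real.sqrt ‖x‖) := by nlinarith
  have h3 : (1 + Real.sqrt ‖y‖) ^ p ≤ (1 + Real.sqrt d) ^ 2 * (1 + Real.sqrt ‖x‖) ^ p := by
    calc (1 + Real.sqrt ‖y‖) ^ p ≤ ((1 + Real.sqrt d) * (1 + Real.sqrt ‖x‖)) ^ p :=
          Real.rpow_le_rpow (by linarith) h2 hp.1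
      _ = (1 + Real.sqrt d) ^ p * (1 + Real.sqrt ‖x‖) ^ p :=
          Real.mul_rpow (by linarith) (by linarith)
      _ ≤ (1 + Real.sqrt d) ^ (2:ℝ) * (1 + Real.sqrt ‖x‖) ^ p := by
          apply mul_le_mul_of_nonneg_right _ (by positivity)
          exact Real.rpow_le_rpow_of_exponent_le (by linarith) hp.2
      _ = _ := by norm_num
  unfold ell
  rw [Real.rpow_neg (by linarith), Real.rpow_neg (by linarith)]
  have a1 : 0 < (1 + Real.sqrt ‖x‖) ^ p := by positivity
  have a2 : 0 < (1 + Real.sqrt ‖y‖) ^ p := by positivity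
  rw [← div_eq_mul_inv, le_div_iff₀ a2, inv_mul_le_iff₀ a1]
  linarith

lemma ell_lower {p : ℝ} (hp : p ∈ Icc (0:ℝ) 2) (x : E2) :
    1 / (2 * (1 + ‖x‖)) ≤ ell p x := by
  have hx := Real.sqrt_nonneg ‖x‖
  have hs : Real.sqrt ‖x‖ ^ 2 = ‖x‖ := Real.sq_sqrt (norm_nonneg _)
  have hn := norm_nonneg x
  unfold ell
  rw [Real.rpow_neg (by linarith), one_div]
  apply inv_anti₀ (by positivity)
  calc (1 + Real.sqrt ‖x‖) ^ p ≤ (1 + Real.sqrt ‖x‖) ^ (2:ℝ) :=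
        Real.rpow_le_rpow_of_exponent_le (by linarith) hp.2
    _ = (1 + Real.sqrt ‖x‖) ^ 2 := by norm_num
    _ ≤ _ := by nlinarith [sq_nonneg (1 - Real.sqrt ‖x‖)]

def DD (x : E2) : ℝ := Real.log (1 + ‖x‖) / 2

lemma DD_cont : Continuous DD := by
  unfold DD
  apply Continuous.div_const
  apply Continuous.log
  · fun_prop
  · intro x; positivity

lemma DD_sub {p : ℝ} (hp : p ∈ Icc (0:ℝ) 2) (x y : E2) :
    DD y - DD x ≤ ‖x - y‖ * ((1 + Real.sqrt ‖x - y‖) ^ 2 * ell p y) := by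
  have hx := norm_nonneg x
  have hy := norm_nonneg y
  have h1 : DD y - DD x ≤ ‖x - y‖ * ell p x := by
    have e : DD y - DD x = Real.log ((1 + ‖y‖) / (1 + ‖x‖)) / 2 := by
      unfold DD
      rw [Real.log_div (by positivity) (by positivity)]; ring
    have h2 := Real.log_le_sub_one_of_pos (show 0 < (1 + ‖y‖) / (1 + ‖x‖) by positivity)
    have h3 : (1 + ‖y‖) / (1 + ‖x‖) - 1 = (‖y‖ - ‖x‖) / (1 + ‖x‖) := by
      field_simp; ring
    have h4 : ‖y‖ - ‖x‖ ≤ ‖x - y‖ := by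
      rw [norm_sub_rev]; exact norm_sub_norm_le y x
    calc DD y - DD x ≤ (‖y‖ - ‖x‖) / (1 + ‖x‖) / 2 := by rw [e, ← h3]; linarith
      _ ≤ ‖x - y‖ / (1 + ‖x‖) / 2 := by gcongr
      _ = ‖x - y‖ * (1 / (2 * (1 + ‖x‖))) := by field_simp
      _ ≤ _ := by gcongr; exact ell_lower hp x
  refine h1.trans ?_
  gcongr
  exact ell_ratio hp x y le_rfl

lemma grad_quad (c : ℝ) (a x : E2) :
    gradient (fun x : E2 => c * ‖x - a‖ ^ 2) x = (2 * c) • (x - a) := by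
  apply HasGradientAt.gradient
  rw [hasGradientAt_iff_hasFDerivAt]
  have h := (((hasFDerivAt_id x).sub_const a).norm_sq).const_mul c
  have e : (InnerProductSpace.toDual ℝ E2) ((2 * c) • (x - a)) =
      c • 2 • (innerSL ℝ) (id x - a) ∘SL ContinuousLinearMap.id ℝ E2 := by
    apply ContinuousLinearMap.ext
    intro v
    simp only [InnerProductSpace.toDual_apply_apply, inner_smul_left, id,
      smul_apply, ContinuousLinearMap.comp_apply, innerSL_apply_apply,
      ContinuousLinearMap.id_apply, smul_eq_mul, nsmul_eq_mul]
    simp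
    ring
  rw [e]
  exact h

lemma contDiff_quad (c : ℝ) (a : E2) : ContDiff ℝ 1 (fun x : E2 => c * ‖x - a‖ ^ 2) :=
  contDiff_const.mul ((contDiff_id.sub contDiff_const).norm_sq ℝ)

/-- local upper slope bound for a subsolution -/
lemma local_bound {p : ℝ} {T : Set E2} (hTcl : IsClosed T) {w : E2 → ℝ} (hw : Continuous w)
    (hsub : ∀ γ : E2 → ℝ, ContDiffOn ℝ 1 γ Tᶜ → ∀ x₁ ∈ Tᶜ,
      IsLocalMaxOn (fun x => w x - γ x) Tᶜ x₁ → ‖gradient γ x₁‖ - ell p x₁ ≤ 0)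
    {x0 : E2} (hx0 : x0 ∈ Tᶜ) {L : ℝ} (hL : ell p x0 < L) :
    ∀ᶠ x in 𝓝 x0, w x0 - w x ≤ L * ‖x - x0‖ := by
  obtain ⟨L', hL1, hL2⟩ := exists_between hL
  have hL0 : 0 < L' := (ell_pos p x0).trans hL1
  have h1 : ∀ᶠ x in 𝓝 x0, x ∈ Tᶜ ∧ ell p x < L' :=
    Filter.Eventually.and (hTcl.isOpen_compl.mem_nhds hx0) ((ell_cont p).continuousAt.eventually_lt_const hL1)
  obtain ⟨R, hR, hball⟩ := Metric.nhds_basis_closedBall.eventually_iff.1 h1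
  obtain ⟨B, hB⟩ := (isCompact_closedBall x0 R).exists_bound_of_continuousOn hw.continuousOn
  set ρ := R / 2 with hρ
  have hρ0 : 0 < ρ := by positivity
  have hB0 : 0 ≤ B := (norm_nonneg _).trans (hB x0 (mem_closedBall_self hR.le))
  set k := 2 * B / ρ ^ 2 with hk
  have hk0 : 0 ≤ k := by positivity
  have key : ∀ x1 ∈ ball x0 ρ, ∀ x ∈ closedBall x1 ρ,
      w x - L' * ‖x - x1‖ - k * ‖x - x1‖ ^ 2 ≤ w x1 := by
    intro x1 hx1
    have hsubset : closedBall x1 ρ ⊆ closedBall x0 R := by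
      apply closedBall_subset_closedBall'
      rw [mem_ball] at hx1; linarith
    obtain ⟨xs, hxs, hmax⟩ := (isCompact_closedBall x1 ρ).exists_isMaxOn
      ⟨x1, mem_closedBall_self hρ0.le⟩
      (f := fun x => w x - L' * ‖x - x1‖ - k * ‖x - x1‖ ^ 2) (by fun_prop)
    have hmax' : ∀ x ∈ closedBall x1 ρ, w x - L' * ‖x - x1‖ - k * ‖x - x1‖ ^ 2 ≤
        w xs - L' * ‖xs - x1‖ - k * ‖xs - x1‖ ^ 2 := fun x hx => hmax hx
    have hx1m := hmax' x1 (mem_closedBall_self hρ0.le)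
    simp only [sub_self, norm_zero, mul_zero, sub_zero, ne_eq, OfNat.ofNat_ne_zero,
      not_false_eq_true, zero_pow] at hx1m
    by_cases hxe : xs = x1
    · intro x hx
      have := hmax' x hx
      simpa [hxe] using this
    exfalso
    have hs : 0 < ‖xs - x1‖ := norm_pos_iff.2 (sub_ne_zero.2 hxe)
    have hsρ : ‖xs - x1‖ ≤ ρ := by rwa [mem_closedBall, dist_eq_norm] at hxs
    have hlt : ‖xs - x1‖ < ρ := by
      refine lt_of_le_of_ne hsρ fun he => ?_
      have b1 := abs_le.1 (hB xs (hsubset hxs))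
      have b2 := abs_le.1 (hB x1 (hsubset (mem_closedBall_self hρ0.le)))
      rw [he] at hx1m
      have : k * ρ ^ 2 = 2 * B := by rw [hk]; field_simp
      have : 0 < L' * ρ := by positivity
      linarith [b1.2, b2.1]
    have hxsT := hball (hsubset hxs)
    set s := ‖xs - x1‖ with hsdef
    have hg := hsub (fun x => (L' / (2 * s) + k) * ‖x - x1‖ ^ 2)
      (contDiff_quad _ _).contDiffOn xs hxsT.1 (by
        have hnb : ball x1 ρ ∈ 𝓝 xs := isOpen_ball.mem_nhds (by rwa [mem_ball, dist_eq_norm])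
        apply mem_nhdsWithin_of_mem_nhds
        filter_upwards [hnb] with x hx
        have h2 := hmax' x (ball_subset_closedBall hx)
        have h3 : L' * ‖x - x1‖ ≤ L' / (2 * s) * ‖x - x1‖ ^ 2 + L' * s / 2 := by
          have : L' / (2 * s) * ‖x - x1‖ ^ 2 + L' * s / 2 - L' * ‖x - x1‖ =
              L' / (2 * s) * (‖x - x1‖ - s) ^ 2 := by field_simp; ring
          have h5 : 0 ≤ L' / (2 * s) * (‖x - x1‖ - s) ^ 2 := by positivity
          linarith
        have h4 : L' / (2 * s) * s ^ 2 = L' * s / 2 := by field_simp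
        show w x - (L' / (2 * s) + k) * ‖x - x1‖ ^ 2 ≤ w xs - (L' / (2 * s) + k) * s ^ 2
        linarith)
    rw [grad_quad, norm_smul, ← hsdef, Real.norm_of_nonneg (by positivity)] at hg
    have : 2 * (L' / (2 * s) + k) * s = L' + 2 * k * s := by field_simp
    have : 0 ≤ 2 * k * s := by positivity
    linarith [hxsT.2]
  have hsm : ∀ᶠ x in 𝓝 x0, k * ‖x - x0‖ < L - L' := by
    have : Continuous fun x : E2 => k * ‖x - x0‖ := by fun_prop
    apply this.continuousAt.eventually_lt_const
    simp; linarith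
  filter_upwards [hsm, ball_mem_nhds x0 hρ0] with x hx1 hx2
  have := key x hx2 x0 (by rw [mem_closedBall, dist_comm]; exact (mem_ball.1 hx2).le)
  rw [norm_sub_rev x0 x] at this
  nlinarith [norm_nonneg (x - x0)]

lemma mean_meas {β : ℝ → Measure A2} (hβ : IsRelaxedControl β) :
    Measurable fun s => ∫ a, (a : E2) ∂(β s) := by
  have hco : ∀ i : Fin 2, Measurable fun s => (∫ a, (a : E2) ∂(β s)) i := by
    intro i
    have h := hβ.2 ⟨fun a : A2 => (a : E2) i, by fun_prop⟩
    convert h using 2 with s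
    have := hβ.1 s
    have hint : Integrable (fun a : A2 => (a : E2)) (β s) :=
      Continuous.integrable_of_hasCompactSupport (by fun_prop)
        (HasCompactSupport.of_compactSpace _)
    exact ((EuclideanSpace.proj (𝕜 := ℝ) i).integral_comp_comm hint).symm
  exact (WithLp.measurable_toLp 2 (Fin 2 → ℝ)).comp (measurable_pi_iff.2 hco)

lemma mean_norm {β : ℝ → Measure A2} (hβ : IsRelaxedControl β) (s : ℝ) :
    ‖∫ a, (a : E2) ∂(β s)‖ ≤ 1 := by
  have := hβ.1 s
  have := norm_integral_le_of_norm_le_const (μ := β s) (f := fun a : A2 => (a : E2)) (C := 1)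
    (Eventually.of_forall fun a => mem_closedBall_zero_iff.1 a.2)
  simpa using this

lemma mean_int {β : ℝ → Measure A2} (hβ : IsRelaxedControl β) (s t : ℝ) :
    IntervalIntegrable (fun s => ∫ a, (a : E2) ∂(β s)) volume s t := by
  have h : IntervalIntegrable (fun _ : ℝ => (1:ℝ)) volume s t := intervalIntegrable_const
  exact h.mono_fun (mean_meas hβ).aestronglyMeasurable
    (Eventually.of_forall fun s => by simpa using mean_norm hβ s)

lemma traj_lip {β : ℝ → Measure A2} (hβ : IsRelaxedControl β) {z : E2} {y : ℝ → E2}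
    (hy : IsTrajectory (fun _ (a : A2) => (a : E2)) β z y) {s t : ℝ} (hs : 0 ≤ s) (hst : s ≤ t) :
    ‖y t - y s‖ ≤ t - s := by
  rw [hy.2.2 t (hs.trans hst), hy.2.2 s hs, add_sub_add_left_eq_sub,
    intervalIntegral.integral_interval_sub_left (mean_int hβ _ _) (mean_int hβ _ _)]
  have := intervalIntegral.norm_integral_le_of_norm_le_const (a := s) (b := t) (C := 1)
    (f := fun s => ∫ a, (a : E2) ∂(β s)) (fun x _ => mean_norm hβ x)
  rwa [one_mul, abs_of_nonneg (by linarith)] at this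

lemma runCost_eq {p : ℝ} {β : ℝ → Measure A2} (hβ : IsRelaxedControl β) {y : ℝ → E2}
    (hy : Continuous y) {t : ℝ} (ht : 0 ≤ t) :
    runCost (fun x (_ : A2) => (1 + Real.sqrt ‖x‖) ^ (-p)) β y t =
      ENNReal.ofReal (∫ s in (0:ℝ)..t, ell p (y s)) := by
  unfold runCost
  have : ∀ s, (∫ _a : A2, (1 + Real.sqrt ‖y s‖) ^ (-p) ∂(β s)) = ell p (y s) := by
    intro s
    have := hβ.1 s
    simp [ell]
  simp only [this]
  have hc : Continuous fun s => ell p (y s) := (ell_cont p).comp hy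
  rw [intervalIntegral.integral_of_le ht, ofReal_integral_eq_lintegral_ofReal]
  · exact (hc.intervalIntegrable 0 t).1
  · exact Eventually.of_forall fun s => (ell_pos p _).le

lemma exit_mem {T : Set E2} (hT : IsClosed T) {y : ℝ → E2} (hy : Continuous y)
    (hne : (exitTimes T y).Nonempty) : sInf (exitTimes T y) ∈ exitTimes T y := by
  apply IsClosed.csInf_mem _ hne ⟨0, fun t ht => ht.1⟩
  exact isClosed_Ici.inter (hT.preimage hy)

lemma w_le_cost {p : ℝ} {T : Set E2} (hTcl : IsClosed T) {w : E2 → ℝ} (hw : Continuous w)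
    (hsub : ∀ γ : E2 → ℝ, ContDiffOn ℝ 1 γ Tᶜ → ∀ x₁ ∈ Tᶜ,
      IsLocalMaxOn (fun x => w x - γ x) Tᶜ x₁ → ‖gradient γ x₁‖ - ell p x₁ ≤ 0)
    (hwT : ∀ x ∈ T, w x = 0)
    {β : ℝ → Measure A2} (hβ : IsRelaxedControl β) {z : E2} {y : ℝ → E2}
    (hy : IsTrajectory (fun _ (a : A2) => (a : E2)) β z y)
    (hne : (exitTimes T y).Nonempty) :
    w z ≤ ∫ s in (0:ℝ)..(sInf (exitTimes T y)), ell p (y s) := by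
  have hyc := hy.2.1
  have hmem := exit_mem hTcl hyc hne
  set τ := sInf (exitTimes T y) with hτ
  have hc : Continuous fun s => ell p (y s) := (ell_cont p).comp hyc
  have hd : ∀ t, HasDerivAt (fun t => (∫ s in (0:ℝ)..t, ell p (y s)) - w z) (ell p (y t)) t :=
    fun t => (intervalIntegral.integral_hasDerivAt_right (hc.intervalIntegrable _ _)
      (hc.stronglyMeasurableAtFilter _ _) hc.continuousAt).sub_const _
  have main := image_le_of_liminf_slope_right_le_deriv_boundary
    (f := fun s => - w (y s)) (a := 0) (b := τ) (hw.comp hyc).neg.continuousOn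
    (B := fun t => (∫ s in (0:ℝ)..t, ell p (y s)) - w z)
    (B' := fun t => ell p (y t)) (by simp [hy.1])
    (fun t _ => (hd t).continuousAt.continuousWithinAt)
    (fun t _ => (hd t).hasDerivWithinAt) (by
      intro t ht r hr
      have htT : y t ∈ Tᶜ := fun h =>
        absurd (csInf_le ⟨0, fun t ht => ht.1⟩ (show t ∈ exitTimes T y from ⟨ht.1, h⟩))
          (not_le.2 ht.2)
      obtain ⟨r', h1, h2⟩ := exists_between hr
      have hr0 : 0 < r' := (ell_pos p _).trans h1
      have hb := hyc.continuousAt.eventually (local_bound hTcl hw hsub htT h1)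
      apply Eventually.frequently
      filter_upwards [nhdsWithin_le_nhds hb, self_mem_nhdsWithin] with s hs hst
      have hst' : t < s := hst
      have hl := traj_lip hβ hy ht.1 hst'.le
      rw [slope_def_field, div_lt_iff₀ (by linarith)]
      nlinarith)
  have := main (right_mem_Icc.2 hmem.1)
  simp only [hwT _ hmem.2] at this
  linarith

abbrev TrajMap := E2 → (ℝ → Measure A2) → ℝ → E2

def reachCosts (p : ℝ) (T : Set E2) (Y : TrajMap) (x : E2) : Set ℝ :=
  {r | 0 ≤ r ∧ ∃ β, IsRelaxedControl β ∧ ∃ t, 0 ≤ t ∧ Y x β t ∈ T ∧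
    ∫ s in (0:ℝ)..t, ell p (Y x β s) ≤ r}

lemma valueFn_le {p : ℝ} {T : Set E2} (hT : IsClosed T) {Y : TrajMap}
    (hY : ∀ z β, IsRelaxedControl β → IsTrajectory (fun _ (a : A2) => (a : E2)) β z (Y z β))
    {x : E2} {r : ℝ} (hr : r ∈ reachCosts p T Y x) :
    valueFn T (fun x (_ : A2) => (1 + Real.sqrt ‖x‖) ^ (-p)) Y x ≤ (r : EReal) := by
  obtain ⟨hr0, β, hβ, t, ht, htT, hle⟩ := hr
  have hyc := (hY x β hβ).2.1
  have hmem : t ∈ exitTimes T (Y x β) := ⟨ht, htT⟩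
  have hex := exit_mem hT hyc ⟨t, hmem⟩
  have hc : Continuous fun s => ell p (Y x β s) := (ell_cont p).comp hyc
  have hv : valueFn T (fun x (_ : A2) => (1 + Real.sqrt ‖x‖) ^ (-p)) Y x ≤
      ((runCost (fun x (_ : A2) => (1 + Real.sqrt ‖x‖) ^ (-p)) β (Y x β)
        (sInf (exitTimes T (Y x β)))) : EReal) := by
    unfold valueFn
    exact sInf_le ⟨β, hβ, ⟨t, hmem⟩, rfl⟩
  refine hv.trans ?_
  rw [runCost_eq hβ hyc hex.1]
  have h0 : 0 ≤ ∫ s in (0:ℝ)..(sInf (exitTimes T (Y x β))), ell p (Y x β s) :=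
    intervalIntegral.integral_nonneg hex.1 fun s _ => (ell_pos p _).le
  rw [EReal.coe_ennreal_ofReal, max_eq_left h0]
  rw [EReal.coe_le_coe_iff]
  refine le_trans ?_ hle
  apply intervalIntegral.integral_mono_interval le_rfl hex.1
    (csInf_le ⟨0, fun t ht => ht.1⟩ hmem)
    (Eventually.of_forall fun s => (ell_pos p _).le) (hc.intervalIntegrable _ _)

lemma const_relaxed (u : A2) : IsRelaxedControl (fun _ : ℝ => Measure.dirac u) :=
  ⟨fun _ => inferInstance, fun _ => measurable_const⟩

lemma reach_zero {p : ℝ} {T : Set E2} {Y : TrajMap}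
    (hY : ∀ z β, IsRelaxedControl β → IsTrajectory (fun _ (a : A2) => (a : E2)) β z (Y z β))
    {x : E2} (hx : x ∈ T) : (0:ℝ) ∈ reachCosts p T Y x := by
  let u : A2 := ⟨0, Metric.mem_closedBall_self zero_le_one⟩
  refine ⟨le_rfl, fun _ => Measure.dirac u, const_relaxed u, 0, le_rfl, ?_, by simp⟩
  rw [(hY x _ (const_relaxed u)).1]; exact hx

lemma reach_step {p : ℝ} {T : Set E2} {Y : TrajMap}
    (hY : ∀ z β, IsRelaxedControl β → IsTrajectory (fun _ (a : A2) => (a : E2)) β z (Y z β))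
    {x y : E2} {c : ℝ} (hc : ∀ q, ‖q - y‖ ≤ ‖x - y‖ → ell p q ≤ c)
    {r : ℝ} (hr : r ∈ reachCosts p T Y y) : r + ‖x - y‖ * c ∈ reachCosts p T Y x := by
  obtain ⟨hr0, β, hβ, t, ht, htT, hle⟩ := hr
  have hc0 : 0 < c := (ell_pos p x).trans_le (hc x le_rfl)
  set d := ‖x - y‖ with hd
  have hd0 : 0 ≤ d := norm_nonneg _
  have hdu : d • (d⁻¹ • (y - x)) = y - x := by
    by_cases h : d = 0
    · have : x - y = 0 := norm_eq_zero.1 h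
      have h2 : y - x = 0 := by rw [← neg_sub, this, neg_zero]
      simp [h2]
    · rw [smul_smul, mul_inv_cancel₀ h, one_smul]
  let u : A2 := ⟨d⁻¹ • (y - x), by
    rw [mem_closedBall_zero_iff, norm_smul, norm_inv, Real.norm_of_nonneg hd0, norm_sub_rev y x,
      ← hd]
    exact inv_mul_le_one⟩
  let β' : ℝ → Measure A2 := fun s => if s ≤ d then Measure.dirac u else β (s - d)
  have hβ' : IsRelaxedControl β' := by
    constructor
    · intro s
      by_cases h : s ≤ d
      · simp only [β', h, if_true]; infer_instance
      · simp only [β', h, if_false]; exact hβ.1 _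
    · intro g
      have e : (fun s => ∫ a, g a ∂(β' s)) =
          fun s => if s ≤ d then g u else ∫ a, g a ∂(β (s - d)) := by
        funext s
        by_cases h : s ≤ d
        · simp only [β', h, if_true]; simp
        · simp only [β', h, if_false]
      rw [e]
      exact Measurable.ite measurableSet_Iic measurable_const
        ((hβ.2 g).comp (measurable_id.sub_const d))
  have hy' := hY x β' hβ'
  have hy := hY y β hβ
  have t1 : ∀ s, 0 ≤ s → s ≤ d → Y x β' s = x + s • (d⁻¹ • (y - x)) := by
    intro s hs hsd
    rw [hy'.2.2 s hs]
    congr 1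
    have : ∫ q in (0:ℝ)..s, ∫ a, (a : E2) ∂(β' q) = ∫ q in (0:ℝ)..s, (d⁻¹ • (y - x)) := by
      apply intervalIntegral.integral_congr
      intro q hq
      rw [uIcc_of_le hs] at hq
      have hqd : q ≤ d := hq.2.trans hsd
      simp only [β', hqd, if_true]
      simp [u]
    rw [this, intervalIntegral.integral_const, sub_zero]
  have t2 : ∀ s, 0 ≤ s → Y x β' (s + d) = Y y β s := by
    intro s hs
    rw [hy'.2.2 _ (by linarith), hy.2.2 s hs,
      ← intervalIntegral.integral_add_adjacent_intervals (mean_int hβ' 0 d) (mean_int hβ' d _)]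
    have h1 := hy'.2.2 d hd0
    rw [t1 d hd0 le_rfl, hdu] at h1
    rw [← add_assoc, ← h1]
    have h2 : ∫ q in d..(s + d), ∫ a, (a : E2) ∂(β' q) =
        ∫ q in (0:ℝ)..s, ∫ a, (a : E2) ∂(β q) := by
      have h3 := intervalIntegral.integral_comp_sub_right (a := d) (b := s + d)
        (fun q => ∫ a, (a : E2) ∂(β q)) d
      simp only [sub_self, add_sub_cancel_right] at h3
      rw [← h3]
      apply intervalIntegral.integral_congr_ae
      refine Eventually.of_forall fun q hq => ?_
      rw [uIoc_of_le (by linarith)] at hq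
      have : ¬ q ≤ d := not_le.2 hq.1
      simp only [β', this, if_false]
    rw [h2]; simp
  have hcc : Continuous fun s => ell p (Y x β' s) := (ell_cont p).comp hy'.2.1
  refine ⟨by positivity, β', hβ', t + d, by linarith, by rw [t2 t ht]; exact htT, ?_⟩
  rw [← intervalIntegral.integral_add_adjacent_intervals (hcc.intervalIntegrable 0 d)
    (hcc.intervalIntegrable d _)]
  have c1 : ∫ s in (0:ℝ)..d, ell p (Y x β' s) ≤ d * c := by
    have := intervalIntegral.integral_mono_on (μ := volume) hd0 (hcc.intervalIntegrable 0 d)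
      (intervalIntegrable_const (c := c)) (fun s hs => ?_)
    · simpa using this
    · apply hc
      rw [t1 s hs.1 hs.2]
      have e : x + s • d⁻¹ • (y - x) - y = (d - s) • (-(d⁻¹ • (y - x))) := by
        rw [smul_neg, sub_smul, hdu]; abel
      rw [e, norm_smul, norm_neg, Real.norm_of_nonneg (by linarith [hs.2])]
      have := mem_closedBall_zero_iff.1 u.2
      change ‖d⁻¹ • (y - x)‖ ≤ 1 at this
      nlinarith [hs.1, hs.2, norm_nonneg (d⁻¹ • (y - x))]
  have c2 : ∫ s in d..(t + d), ell p (Y x β' s) = ∫ s in (0:ℝ)..t, ell p (Y y β s) := by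
    have h3 := intervalIntegral.integral_comp_add_right (a := 0) (b := t)
      (fun q => ell p (Y x β' q)) d
    rw [zero_add] at h3
    rw [← h3]
    apply intervalIntegral.integral_congr
    intro s hs
    rw [uIcc_of_le ht] at hs
    simp only [t2 s hs.1]
  rw [c2]
  linarith

def VV (p : ℝ) (T : Set E2) (Y : TrajMap) (x : E2) : ℝ := sInf (reachCosts p T Y x)

lemma reach_nonempty {p : ℝ} (hp : 0 ≤ p) {T : Set E2} (hTne : T.Nonempty) {Y : TrajMap}
    (hY : ∀ z β, IsRelaxedControl β → IsTrajectory (fun _ (a : A2) => (a : E2)) β z (Y z β))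
    (x : E2) : (reachCosts p T Y x).Nonempty := by
  obtain ⟨y, hy⟩ := hTne
  exact ⟨_, reach_step hY (c := 1) (fun q _ => ell_le_one hp q) (reach_zero hY hy)⟩

lemma VV_step {p : ℝ} (hp : 0 ≤ p) {T : Set E2} (hTne : T.Nonempty) {Y : TrajMap}
    (hY : ∀ z β, IsRelaxedControl β → IsTrajectory (fun _ (a : A2) => (a : E2)) β z (Y z β))
    {x y : E2} {c : ℝ} (hc : ∀ q, ‖q - y‖ ≤ ‖x - y‖ → ell p q ≤ c) :
    VV p T Y x ≤ VV p T Y y + ‖x - y‖ * c := by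
  rw [← sub_le_iff_le_add]
  apply le_csInf (reach_nonempty hp hTne hY y)
  intro r hr
  rw [sub_le_iff_le_add]
  exact csInf_le ⟨0, fun r hr => hr.1⟩ (reach_step hY hc hr)

lemma VV_zero {p : ℝ} {T : Set E2} {Y : TrajMap}
    (hY : ∀ z β, IsRelaxedControl β → IsTrajectory (fun _ (a : A2) => (a : E2)) β z (Y z β))
    {x : E2} (hx : x ∈ T) : VV p T Y x ≤ 0 :=
  csInf_le ⟨0, fun r hr => hr.1⟩ (reach_zero hY hx)

lemma VV_cont {p : ℝ} (hp : 0 ≤ p) {T : Set E2} (hTne : T.Nonempty) {Y : TrajMap}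
    (hY : ∀ z β, IsRelaxedControl β → IsTrajectory (fun _ (a : A2) => (a : E2)) β z (Y z β)) :
    Continuous (VV p T Y) := by
  have : LipschitzWith 1 (VV p T Y) := by
    apply LipschitzWith.of_le_add
    intro x y
    have := VV_step hp hTne hY (x := x) (y := y) (c := 1) (fun q _ => ell_le_one hp q)
    rwa [mul_one, ← dist_eq_norm] at this
  exact this.continuous

set_option maxHeartbeats 2000000 in
lemma comparison {p : ℝ} (hp : p ∈ Icc (0:ℝ) 2) {T : Set E2}
    {w V : E2 → ℝ} (hw : Continuous w) (hV : Continuous V)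
    (hsup : ∀ γ : E2 → ℝ, ContDiffOn ℝ 1 γ Tᶜ → ∀ x₀ ∈ Tᶜ,
      IsLocalMinOn (fun x => w x - γ x) Tᶜ x₀ → 0 ≤ ‖gradient γ x₀‖ - ell p x₀)
    (hbb : BddBelow (range w)) (hwT : ∀ x ∈ T, w x = 0) (hVT : ∀ x ∈ T, V x ≤ 0)
    (hVs : ∀ x y, V x - V y ≤ ‖x - y‖ * ((1 + Real.sqrt ‖x - y‖) ^ 2 * ell p y)) (xb : E2) :
    V xb ≤ w xb := by
  by_contra! hlt
  obtain ⟨M', hM'⟩ := hbb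
  obtain ⟨M, hM0, hM⟩ : ∃ M : ℝ, 0 ≤ M ∧ ∀ x, -M ≤ w x :=
    ⟨max (-M') 0, le_max_right _ _, fun x => by
      have := hM' (mem_range_self x)
      have := le_max_left (-M') 0
      linarith⟩
  -- truncation
  obtain ⟨K, hK0, hK⟩ : ∃ K : ℝ, 0 ≤ K ∧ V xb ≤ K - DD xb :=
    ⟨max (V xb + DD xb) 0, le_max_right _ _, by
      have := le_max_left (V xb + DD xb) 0
      linarith⟩
  set u : E2 → ℝ := fun x => min (V x) (K - DD x) with hu
  have huc : Continuous u := hV.min (continuous_const.sub DD_cont)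
  have huT : ∀ x ∈ T, u x ≤ 0 := fun x hx => (min_le_left _ _).trans (hVT x hx)
  have hus : ∀ x y, u x - u y ≤ ‖x - y‖ * ((1 + Real.sqrt ‖x - y‖) ^ 2 * ell p y) := by
    intro x y
    rw [sub_le_iff_le_add]
    rcases min_choice (V y) (K - DD y) with h | h
    · have := hVs x y
      have h2 : u x ≤ V x := min_le_left _ _
      simp only [hu] at *
      linarith
    · have := DD_sub hp x y
      have h2 : u x ≤ K - DD x := min_le_right _ _
      simp only [hu] at *
      linarith
  have hub : u xb = V xb := min_eq_left hK
  have hDD0 : ∀ x, 0 ≤ DD x := fun x =>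
    div_nonneg (Real.log_nonneg (by linarith [norm_nonneg x])) (by norm_num)
  have huK : ∀ x, u x ≤ K := fun x => (min_le_right _ _).trans (by linarith [hDD0 x])
  -- choice of θ
  obtain ⟨θ, hθ1, hθ2, hθm⟩ : ∃ θ : ℝ, 1 / 2 < θ ∧ θ < 1 ∧ w xb < θ * u xb := by
    have hcont : ContinuousAt (fun θ : ℝ => θ * u xb) 1 := by fun_prop
    have e1 : ∀ᶠ θ in 𝓝[<] (1:ℝ), w xb < θ * u xb :=
      nhdsWithin_le_nhds (hcont.eventually_const_lt (by simpa [hub] using hlt))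
    have e2 : ∀ᶠ θ in 𝓝[<] (1:ℝ), 1 / 2 < θ :=
      nhdsWithin_le_nhds (eventually_gt_nhds (by norm_num))
    obtain ⟨θ, h1, h2, h3⟩ := (e1.and (e2.and self_mem_nhdsWithin)).exists
    exact ⟨θ, h2, h3, h1⟩
  set m := θ * u xb - w xb with hm
  have hm0 : 0 < m := by linarith
  -- choice of δ
  obtain ⟨δ, hδ0, hδ1, hδm, hδθ⟩ : ∃ δ : ℝ, 0 < δ ∧ δ < 1 ∧ 4 * δ < m ∧
      θ * (1 + Real.sqrt δ) ^ 4 < (1 + θ) / 2 := by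
    have hcont : ContinuousAt (fun δ : ℝ => θ * (1 + Real.sqrt δ) ^ 4) 0 := by
      apply Continuous.continuousAt; fun_prop
    have e1 : ∀ᶠ δ in 𝓝[>] (0:ℝ), θ * (1 + Real.sqrt δ) ^ 4 < (1 + θ) / 2 :=
      nhdsWithin_le_nhds (hcont.eventually_lt_const (by simp; linarith))
    have e2 : ∀ᶠ δ in 𝓝[>] (0:ℝ), δ < 1 :=
      nhdsWithin_le_nhds (eventually_lt_nhds (by norm_num))
    have e3 : ∀ᶠ δ in 𝓝[>] (0:ℝ), δ < m / 4 :=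
      nhdsWithin_le_nhds (eventually_lt_nhds (by linarith))
    obtain ⟨δ, h1, h2, h3, h4⟩ := (e1.and (e2.and (e3.and self_mem_nhdsWithin))).exists
    exact ⟨δ, h4, h2, by linarith, h1⟩
  -- penalty constant k = 1/(2ε)
  obtain ⟨k, hk0, hk⟩ : ∃ k : ℝ, 0 < k ∧ K + M ≤ k * δ ^ 2 :=
    ⟨(K + M + 1) / δ ^ 2, by positivity, by
      rw [div_mul_cancel₀ _ (by positivity)]; linarith⟩
  set Φ : E2 × E2 → ℝ := fun q => θ * u q.1 - w q.2 - k * ‖q.1 - q.2‖ ^ 2 with hΦ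
  have hΦc : Continuous Φ := by fun_prop
  have hΦb : Φ (xb, xb) = m := by simp [hΦ, hm]
  -- points with Φ ≥ m are bounded
  have hclose : ∀ x y, m ≤ Φ (x, y) → ‖x - y‖ ≤ δ := by
    intro x y h
    simp only [hΦ] at h
    have h1 : θ * u x ≤ K := by nlinarith [huK x]
    have h2 : k * ‖x - y‖ ^ 2 ≤ k * δ ^ 2 := by linarith [hM y]
    exact abs_le_of_sq_le_sq' (le_of_mul_le_mul_left h2 hk0) hδ0.le |>.2
  have hbx : ∀ x y, m ≤ Φ (x, y) → ‖x‖ ≤ Real.exp (2 * (K + 2 * M)) := by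
    intro x y h
    simp only [hΦ] at h
    have h3 : 0 ≤ k * ‖x - y‖ ^ 2 := by positivity
    have h1 : -M < θ * u x := by linarith [hM y]
    have h2 : u x ≤ K - DD x := min_le_right _ _
    have h4 : DD x ≤ K + 2 * M := by nlinarith
    unfold DD at h4
    have h5 : Real.log (1 + ‖x‖) ≤ 2 * (K + 2 * M) := by linarith
    have := (Real.log_le_iff_le_exp (by positivity)).1 h5
    linarith
  set R := max (Real.exp (2 * (K + 2 * M)) + 1) ‖xb‖ with hR
  obtain ⟨⟨x, y⟩, -, hmaxK⟩ := (isCompact_closedBall (0 : E2 × E2) R).exists_isMaxOn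
    ⟨(xb, xb), by simp [hR]⟩ hΦc.continuousOn
  have hmaxm : m ≤ Φ (x, y) := by
    rw [← hΦb]; exact hmaxK (show (xb, xb) ∈ closedBall (0 : E2 × E2) R by simp [hR])
  have hmax : ∀ a b, Φ (a, b) ≤ Φ (x, y) := by
    intro a b
    by_cases h : m ≤ Φ (a, b)
    · apply hmaxK
      have ha := hbx a b h
      have hab := hclose a b h
      have hb : ‖b‖ ≤ ‖a‖ + δ := by
        have := norm_sub_norm_le b a
        rw [norm_sub_rev] at this; linarith
      have hRl := le_max_left (Real.exp (2 * (K + 2 * M)) + 1) ‖xb‖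
      rw [mem_closedBall_zero_iff, Prod.norm_def]
      exact max_le (by simp only; linarith) (by simp only; linarith)
    · linarith
  have hd := hclose x y hmaxm
  set d := ‖x - y‖ with hddef
  have hd0 : 0 ≤ d := norm_nonneg _
  have hsq : Real.sqrt d ≤ Real.sqrt δ := Real.sqrt_le_sqrt hd
  have hsq0 := Real.sqrt_nonneg d
  -- y ∉ T
  have hyT : y ∈ Tᶜ := by
    intro hyT
    have h1 := hus x y
    have h2 := huT y hyT
    simp only [hΦ, hwT y hyT] at hmaxm
    have h3 : 0 ≤ k * ‖x - y‖ ^ 2 := by positivity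
    have h4 : Real.sqrt d ≤ 1 := by rw [Real.sqrt_le_one]; linarith
    have h5 : (1 + Real.sqrt d) ^ 2 * ell p y ≤ 4 * 1 := by
      apply mul_le_mul _ (ell_le_one hp.1 y) (ell_pos p y).le (by norm_num)
      nlinarith
    have h6 : u x ≤ 4 * δ := by
      rw [← hddef] at h1
      nlinarith
    nlinarith
  -- supersolution
  have hs := hsup (fun z => (-k) * ‖z - x‖ ^ 2) (contDiff_quad _ _).contDiffOn y hyT (by
    apply mem_nhdsWithin_of_mem_nhds
    refine Eventually.of_forall fun z => ?_
    have := hmax x z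
    simp only [hΦ] at this
    show w y - (-k) * ‖y - x‖ ^ 2 ≤ w z - (-k) * ‖z - x‖ ^ 2
    rw [norm_sub_rev y x, norm_sub_rev z x]
    linarith)
  rw [grad_quad, norm_smul, norm_sub_rev y x, ← hddef, Real.norm_eq_abs, mul_neg, abs_neg,
    abs_of_pos (by positivity)] at hs
  have hell := ell_pos p y
  have hdpos : 0 < d := by
    rcases hd0.eq_or_lt with h | h
    · rw [← h] at hs; linarith
    · exact h
  -- move x towards y
  set t := 1 - θ with ht
  have ht0 : 0 < t := by linarith
  set xt := x + t • (y - x) with hxt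
  have n1 : ‖x - xt‖ = t * d := by
    have : x - xt = t • (x - y) := by rw [hxt, ← neg_sub x y, smul_neg]; abel
    rw [this, norm_smul, Real.norm_of_nonneg ht0.le]
  have n2 : ‖xt - y‖ = (1 - t) * d := by
    have : xt - y = (1 - t) • (x - y) := by rw [hxt]; module
    rw [this, norm_smul, Real.norm_of_nonneg (by linarith)]
  have hmt := hmax xt y
  simp only [hΦ] at hmt
  rw [n2, ← hddef] at hmt
  have hut := hus x xt
  rw [n1] at hut
  have htd : t * d ≤ d := by nlinarith
  have hsq2 : Real.sqrt (t * d) ≤ Real.sqrt δ := Real.sqrt_le_sqrt (htd.trans hd)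
  have hr : ell p xt ≤ (1 + Real.sqrt δ) ^ 2 * ell p y :=
    ell_ratio hp xt y (by rw [n2]; nlinarith)
  have hut2 : u x - u xt ≤ t * d * ((1 + Real.sqrt δ) ^ 4 * ell p y) := by
    refine hut.trans ?_
    apply mul_le_mul_of_nonneg_left _ (by positivity)
    calc (1 + Real.sqrt (t * d)) ^ 2 * ell p xt
        ≤ (1 + Real.sqrt δ) ^ 2 * ((1 + Real.sqrt δ) ^ 2 * ell p y) := by
          apply mul_le_mul _ hr (ell_pos p _).le (by positivity)
          gcongr
      _ = _ := by ring
  have f1 : k * d ^ 2 - k * ((1 - t) * d) ^ 2 ≤ θ * (t * d * ((1 + Real.sqrt δ) ^ 4 * ell p y)) := by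
    have := mul_le_mul_of_nonneg_left hut2 (show 0 ≤ θ by linarith)
    linarith
  have f2 : (t * d) * ((1 - t / 2) * (2 * k * d)) ≤
      (t * d) * (θ * (1 + Real.sqrt δ) ^ 4 * ell p y) := by
    linarith
  have f3 := le_of_mul_le_mul_left f2 (by positivity)
  have f4 : (1 - t / 2) * ell p y ≤ (1 - t / 2) * (2 * k * d) :=
    mul_le_mul_of_nonneg_left (by linarith) (by linarith)
  have f5 : θ * (1 + Real.sqrt δ) ^ 4 * ell p y < (1 + θ) / 2 * ell p y :=
    mul_lt_mul_of_pos_right hδθ hell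
  have f6 : (1 - t / 2) = (1 + θ) / 2 := by rw [ht]; ring
  rw [f6] at f4 f3
  linarith

/-- the degenerate eikonal equation.  For `p ∈ [0,2]` and any closed
nonempty target `T ⊆ ℝ²`, with dynamics `f(x,a) = a` over the closed unit ball and
Lagrangian `ℓ(x,a) = [1+√‖x‖]^{−p}`, any continuous bounded-from-below viscosity
solution of `‖Dw(x)‖ = [1+√‖x‖]^{−p}` on `ℝ² ∖ T` vanishing on `T` equals the value
function `v_{e,p}`. -/
theorem eikonal_uniqueness (p : ℝ) (hp : p ∈ Icc (0:ℝ) 2)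
    (T : Set (EuclideanSpace ℝ (Fin 2))) (hTcl : IsClosed T) (hTne : T.Nonempty)
    -- the trajectory map for the dynamics `f(x,a) = a`
    (Y : EuclideanSpace ℝ (Fin 2) →
      (ℝ → Measure (Metric.closedBall (0:EuclideanSpace ℝ (Fin 2)) 1)) → ℝ →
      EuclideanSpace ℝ (Fin 2))
    (hY : ∀ z β, IsRelaxedControl β →
      IsTrajectory (fun _ (a : Metric.closedBall (0:EuclideanSpace ℝ (Fin 2)) 1) =>
        (a : EuclideanSpace ℝ (Fin 2))) β z (Y z β))
    (w : EuclideanSpace ℝ (Fin 2) → ℝ) (hw : Continuous w)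
    (hsol : IsViscositySol
      (fun x q => ‖q‖ - (1 + Real.sqrt ‖x‖) ^ (-p)) Tᶜ w)
    (hbb : BddBelow (range w))
    (hwT : ∀ x ∈ T, w x = 0) :
    ∀ z, (w z : EReal) =
      valueFn T
        (fun x (_ : Metric.closedBall (0:EuclideanSpace ℝ (Fin 2)) 1) =>
          (1 + Real.sqrt ‖x‖) ^ (-p)) Y z := by
  intro z
  have hsup : ∀ γ : E2 → ℝ, ContDiffOn ℝ 1 γ Tᶜ → ∀ x₀ ∈ Tᶜ,
      IsLocalMinOn (fun x => w x - γ x) Tᶜ x₀ → 0 ≤ ‖gradient γ x₀‖ - ell p x₀ := hsol.1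
  have hsub : ∀ γ : E2 → ℝ, ContDiffOn ℝ 1 γ Tᶜ → ∀ x₁ ∈ Tᶜ,
      IsLocalMaxOn (fun x => w x - γ x) Tᶜ x₁ → ‖gradient γ x₁‖ - ell p x₁ ≤ 0 := hsol.2
  apply le_antisymm
  · apply le_sInf
    rintro c ⟨β, hβ, hne, rfl⟩
    have hy := hY z β hβ
    have hle := w_le_cost hTcl hw hsub hwT hβ hy hne
    rw [runCost_eq hβ hy.2.1 (exit_mem hTcl hy.2.1 hne).1, EReal.coe_ennreal_ofReal,
      EReal.coe_le_coe_iff]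
    exact hle.trans (le_max_left _ _)
  · have hcmp : VV p T Y z ≤ w z :=
      comparison hp hw (VV_cont hp.1 hTne hY) hsup hbb hwT (fun x hx => VV_zero hY hx)
        (fun x y => by
          rw [sub_le_iff_le_add']
          exact VV_step hp.1 hTne hY fun q hq => ell_ratio hp q y hq) z
    apply EReal.le_of_forall_lt_iff_le.1
    intro r hr
    rw [EReal.coe_lt_coe_iff] at hr
    obtain ⟨s, hs, hsr⟩ := exists_lt_of_csInf_lt (reach_nonempty hp.1 hTne hY z)
      (hcmp.trans_lt hr)
    exact (valueFn_le hTcl hY hs).trans (EReal.coe_le_coe_iff.2 hsr.le)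
end
end

section
/- Assume the relaxed-control exit-time setup with hypotheses (STCT), (H5'), and (H6), where (H5') requires positivity of running costs only for initial points in R ∖ T, R := {x ∈ ℝ^N : inf{t_x(β) : β ∈ 𝒜} < ∞} being the set of points controllable to T in finite time. Let Ω ⊆ R be an open set containing T. If w : Ω → ℝ is continuous, is a viscosity solution of the HJBE sup_{m ∈ A^r} { −f^r(x,m)·Dw(x) − ℓ^r(x,m) } = 0 on Ω ∖ T, is bounded from below on Ω, satisfies w ≡ 0 on T, and satisfies lim_{x → x₀} w(x) = +∞ for every x₀ ∈ ∂Ω, then w ≡ v on Ω. -/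
open MeasureTheory Set Filter Topology Metric
open scoped RealInnerProductSpace ENNReal

noncomputable section

/-- Euclidean space abbreviation. -/
abbrev EE (N : ℕ) := EuclideanSpace ℝ (Fin N)

/-- The standing assumptions on the dynamics and the running cost. -/
structure Dyn {N : ℕ} {A : Type*} [MetricSpace A] (f : EE N → A → EE N) (ℓ : EE N → A → ℝ)
    (L : ℝ) : Prop where
  hf : Continuous fun q : EE N × A => f q.1 q.2
  hL : 0 < L
  hfLip : ∀ x y a, ‖f x a - f y a‖ ≤ L * ‖x - y‖
  hℓ : Continuous fun q : EE N × A => ℓ q.1 q.2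
  hℓnn : ∀ x a, 0 ≤ ℓ x a

lemma relaxed_measurable {A : Type*} [MetricSpace A] [CompactSpace A] [MeasurableSpace A]
    [BorelSpace A] {β : ℝ → Measure A} (hβ : IsRelaxedControl β) : Measurable β := by
  have := hβ.1
  refine Measurable.measure_of_isPiSystem_of_isProbabilityMeasure
    (S := {s : Set A | IsClosed s}) ?_ isPiSystem_isClosed ?_
  · rw [BorelSpace.measurable_eq (α := A), borel_eq_generateFrom_isClosed]
  · intro F hF
    have hF' : IsClosed F := hF
    refine ENNReal.measurable_of_tendsto (f := fun n t => ∫⁻ x, hF'.apprSeq n x ∂(β t)) ?_ ?_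
    · intro n
      let g : C(A, ℝ) := ⟨fun a => ((hF'.apprSeq n a : NNReal) : ℝ), by fun_prop⟩
      have h1 := (hβ.2 g).ennreal_ofReal
      convert h1 using 2 with t
      rw [ofReal_integral_eq_lintegral_ofReal]
      · refine lintegral_congr fun a => ?_
        simp [g]
      · exact g.continuous.integrable_of_hasCompactSupport (HasCompactSupport.of_compactSpace _)
      · exact Eventually.of_forall fun a => by simp [g]
    · rw [tendsto_pi_nhds]
      intro t
      exact HasOuterApproxClosed.tendsto_lintegral_apprSeq hF' (β t)

section basics
variable {N : ℕ} {A : Type*} [MetricSpace A] [CompactSpace A] [MeasurableSpace A] [BorelSpace A]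
  {F : Type*} [NormedAddCommGroup F] [NormedSpace ℝ F]

lemma integrable_cont {g : A → F} (hg : Continuous g) (m : Measure A) [IsProbabilityMeasure m] :
    Integrable g m :=
  hg.integrable_of_hasCompactSupport (HasCompactSupport.of_compactSpace _)

lemma smeas_int {g : EE N → A → F} (hg : Continuous fun q : EE N × A => g q.1 q.2)
    {β : ℝ → Measure A} (hβ : IsRelaxedControl β) {y : ℝ → EE N} (hy : Continuous y) :
    StronglyMeasurable fun s => ∫ a, g (y s) a ∂(β s) := by
  let κ : ProbabilityTheory.Kernel ℝ A := ⟨β, relaxed_measurable hβ⟩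
  have : ProbabilityTheory.IsMarkovKernel κ := ⟨hβ.1⟩
  have hc : Continuous fun p : ℝ × A => g (y p.1) p.2 :=
    hg.comp ((hy.comp continuous_fst).prodMk continuous_snd)
  have hs : StronglyMeasurable fun p : ℝ × A => g (y p.1) p.2 := hc.stronglyMeasurable
  exact hs.integral_kernel_prod_right' (κ := κ)

lemma exists_bound {g : EE N → A → F} (hg : Continuous fun q : EE N × A => g q.1 q.2) (R : ℝ) :
    ∃ C, 0 ≤ C ∧ ∀ x a, ‖x‖ ≤ R → ‖g x a‖ ≤ C := by
  have hK : IsCompact ((closedBall (0 : EE N) R) ×ˢ (univ : Set A)) :=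
    (isCompact_closedBall _ _).prod isCompact_univ
  obtain ⟨C, hC⟩ := hK.exists_bound_of_continuousOn hg.continuousOn
  refine ⟨max C 0, le_max_right _ _, fun x a hx => le_max_of_le_left (hC (x, a) ⟨?_, trivial⟩)⟩
  simpa using hx

lemma norm_int_le {g : A → F} {m : Measure A} [IsProbabilityMeasure m] {C : ℝ}
    (h : ∀ a, ‖g a‖ ≤ C) : ‖∫ a, g a ∂m‖ ≤ C := by
  have := norm_integral_le_of_norm_le_const (μ := m) (Eventually.of_forall h)
  simpa using this

lemma intInt {g : EE N → A → F} (hg : Continuous fun q : EE N × A => g q.1 q.2)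
    {β : ℝ → Measure A} (hβ : IsRelaxedControl β) {y : ℝ → EE N} (hy : Continuous y) (a b : ℝ) :
    IntervalIntegrable (fun s => ∫ a, g (y s) a ∂(β s)) volume a b := by
  have := hβ.1
  obtain ⟨R, hR⟩ := (isCompact_uIcc (a := a) (b := b)).exists_bound_of_continuousOn hy.continuousOn
  obtain ⟨C, hC0, hC⟩ := exists_bound hg R
  rw [intervalIntegrable_iff]
  refine Measure.integrableOn_of_bounded (M := C) (by simp)
    (smeas_int hg hβ hy).aestronglyMeasurable ?_
  refine (ae_restrict_iff' measurableSet_uIoc).2 (Eventually.of_forall fun s hs => ?_)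
  exact norm_int_le fun a => hC _ _ (hR s (uIoc_subset_uIcc hs))

lemma gron {u : ℝ → ℝ} (hu : Continuous u) {a L t₀ : ℝ} (hL : 0 < L)
    (h : ∀ t ∈ Icc 0 t₀, u t ≤ a + L * ∫ s in (0:ℝ)..t, u s) :
    ∀ t ∈ Icc 0 t₀, u t ≤ a * Real.exp (L * t) := by
  intro t ht
  have hd : ∀ x, HasDerivAt (fun t => ∫ s in (0:ℝ)..t, u s) (u x) x := fun x =>
    intervalIntegral.integral_hasDerivAt_right (hu.intervalIntegrable _ _)
      hu.stronglyMeasurable.stronglyMeasurableAtFilter hu.continuousAt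
  have key := le_gronwallBound_of_liminf_deriv_right_le (f := fun t => ∫ s in (0:ℝ)..t, u s)
    (f' := u) (δ := 0) (K := L) (ε := a) (a := 0) (b := t₀)
    (fun x _ => (hd x).continuousAt.continuousWithinAt)
    (fun x _ r hr => (hd x).hasDerivWithinAt.liminf_right_slope_le hr)
    (by simp) (fun x hx => by linarith [h x ⟨hx.1, hx.2.le⟩]) t ht
  rw [gronwallBound_of_K_ne_0 hL.ne'] at key
  have h2 := h t ht
  have h3 := mul_le_mul_of_nonneg_left key hL.le
  simp only [sub_zero, zero_mul, zero_add] at h3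
  have h4 : L * (a / L * (Real.exp (L * t) - 1)) = a * Real.exp (L * t) - a := by
    field_simp
  linarith

variable {f : EE N → A → EE N} {ℓ : EE N → A → ℝ} {L : ℝ}

lemma Dyn.cont_f (h : Dyn f ℓ L) (x : EE N) : Continuous (f x) :=
  h.hf.comp (Continuous.prodMk_right x)

lemma Dyn.cont_l (h : Dyn f ℓ L) (x : EE N) : Continuous (ℓ x) :=
  h.hℓ.comp (Continuous.prodMk_right x)

lemma Dyn.int_lip (h : Dyn f ℓ L) (x y : EE N) (m : Measure A) [IsProbabilityMeasure m] :
    ‖∫ a, f x a ∂m - ∫ a, f y a ∂m‖ ≤ L * ‖x - y‖ := by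
  rw [← integral_sub (integrable_cont (h.cont_f x) m) (integrable_cont (h.cont_f y) m)]
  exact norm_int_le fun a => h.hfLip x y a

/-- Trajectories with controls agreeing on `[0,t₀)` agree on `[0,t₀]`. -/
lemma Dyn.uniq (h : Dyn f ℓ L) {β β' : ℝ → Measure A} (hβ : IsRelaxedControl β)
    (hβ' : IsRelaxedControl β')
    {x : EE N} {y y' : ℝ → EE N} {t₀ : ℝ} (hyc : Continuous y) (hyc' : Continuous y')
    (hy : ∀ t ∈ Icc 0 t₀, y t = x + ∫ s in (0:ℝ)..t, ∫ a, f (y s) a ∂(β s))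
    (hy' : ∀ t ∈ Icc 0 t₀, y' t = x + ∫ s in (0:ℝ)..t, ∫ a, f (y' s) a ∂(β' s))
    (hag : ∀ t ∈ Ico 0 t₀, β t = β' t) : ∀ t ∈ Icc 0 t₀, y t = y' t := by
  have := hβ.1
  intro t ht
  have key := gron (u := fun t => ‖y t - y' t‖) (by fun_prop) (a := 0) (t₀ := t₀) h.hL ?_ t ht
  · rw [zero_mul] at key
    exact sub_eq_zero.1 (norm_le_zero_iff.1 key)
  · intro t ht
    rw [hy t ht, hy' t ht, add_sub_add_left_eq_sub, zero_add]
    have e1 : (∫ s in (0:ℝ)..t, ∫ a, f (y' s) a ∂(β' s)) =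
        ∫ s in (0:ℝ)..t, ∫ a, f (y' s) a ∂(β s) := by
      refine intervalIntegral.integral_congr_ae ?_
      have : ∀ᵐ s : ℝ, s ≠ t := by simp [ae_iff]
      filter_upwards [this] with s hs1 hs
      rw [uIoc_of_le ht.1] at hs
      rw [hag s ⟨hs.1.le, lt_of_lt_of_le (lt_of_le_of_ne hs.2 hs1) ht.2⟩]
    rw [e1, ← intervalIntegral.integral_sub (intInt h.hf hβ hyc _ _) (intInt h.hf hβ hyc' _ _),
      ← intervalIntegral.integral_const_mul]
    refine intervalIntegral.norm_integral_le_of_norm_le ht.1 ?_ ?_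
    · exact Eventually.of_forall fun s _ => h.int_lip _ _ _
    · exact Continuous.intervalIntegrable (by fun_prop) _ _

/-- A priori growth bound. -/
lemma Dyn.growth (h : Dyn f ℓ L) (R H : ℝ) (hH : 0 ≤ H) : ∃ R' C, 0 ≤ C ∧ R ≤ R' ∧
    ∀ x, ‖x‖ ≤ R → ∀ β y, IsRelaxedControl β → IsTrajectory f β x y →
      ∀ t ∈ Icc 0 H, ‖y t‖ ≤ R' ∧ ∀ s ∈ Icc 0 t, ‖y t - y s‖ ≤ C * (t - s) := by
  obtain ⟨F0, hF0, hF⟩ := exists_bound h.hf 0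
  have hfb : ∀ x a, ‖f x a‖ ≤ F0 + L * ‖x‖ := by
    intro x a
    have h1 := hF 0 a (by simp)
    have h2 := h.hfLip x 0 a
    have h3 := norm_le_norm_add_norm_sub' (f x a) (f 0 a)
    rw [sub_zero] at h2
    linarith
  obtain ⟨C, hC0, hC⟩ := exists_bound h.hf ((max R 0 + F0 * H) * Real.exp (L * H))
  have hexp : 1 ≤ Real.exp (L * H) := Real.one_le_exp (mul_nonneg h.hL.le hH)
  have hb : 0 ≤ max R 0 + F0 * H := by positivity
  refine ⟨(max R 0 + F0 * H) * Real.exp (L * H), C, hC0, ?_, ?_⟩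
  · have := mul_nonneg hF0 hH
    nlinarith [le_max_left R 0]
  intro x hx β y hβ hy
  have := hβ.1
  have bd : ∀ t ∈ Icc 0 H, ‖y t‖ ≤ (max R 0 + F0 * H) * Real.exp (L * H) := by
    intro t ht
    have key := gron (u := fun t => ‖y t‖) (hy.2.1.norm) (a := max R 0 + F0 * H) (t₀ := H) h.hL
      ?_ t ht
    · refine key.trans (mul_le_mul_of_nonneg_left (Real.exp_le_exp.2 ?_) hb)
      exact mul_le_mul_of_nonneg_left ht.2 h.hL.le
    · intro t ht
      rw [hy.2.2 t ht.1]
      refine (norm_add_le _ _).trans ?_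
      have : ‖∫ s in (0:ℝ)..t, ∫ a, f (y s) a ∂(β s)‖ ≤ ∫ s in (0:ℝ)..t, (F0 + L * ‖y s‖) := by
        refine intervalIntegral.norm_integral_le_of_norm_le ht.1 ?_ ?_
        · exact Eventually.of_forall fun s _ => norm_int_le fun a => hfb _ _
        · exact Continuous.intervalIntegrable (by have := hy.2.1; fun_prop) _ _
      rw [intervalIntegral.integral_add (by simp)
        (Continuous.intervalIntegrable (by have := hy.2.1; fun_prop) _ _),
        intervalIntegral.integral_const_mul] at this
      have h2 : (∫ s in (0:ℝ)..t, F0) ≤ F0 * H := by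
        simp only [intervalIntegral.integral_const, sub_zero, smul_eq_mul]
        nlinarith [ht.2]
      linarith [le_max_left R 0]
  intro t ht
  refine ⟨bd t ht, fun s hs => ?_⟩
  have e : y t - y s = ∫ s in s..t, ∫ a, f (y s) a ∂(β s) := by
    rw [hy.2.2 t ht.1, hy.2.2 s hs.1, add_sub_add_left_eq_sub,
      intervalIntegral.integral_interval_sub_left (intInt h.hf hβ hy.2.1 _ _)
        (intInt h.hf hβ hy.2.1 _ _)]
  rw [e]
  have := intervalIntegral.norm_integral_le_of_norm_le_const (C := C) (a := s) (b := t)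
    (f := fun s => ∫ a, f (y s) a ∂(β s)) ?_
  · rwa [abs_of_nonneg (by linarith [hs.2])] at this
  · intro r hr
    rw [uIoc_of_le hs.2] at hr
    exact norm_int_le fun a => hC _ _ (bd r ⟨hs.1.trans hr.1.le, hr.2.trans ht.2⟩)

end basics


section reach
variable {N : ℕ} {A : Type*} [MetricSpace A] [CompactSpace A] [MeasurableSpace A] [BorelSpace A]
  {f : EE N → A → EE N} {ℓ : EE N → A → ℝ} {L : ℝ}

/-- Real-valued running cost. -/
def rc {N : ℕ} {A : Type*} [MeasurableSpace A]
    (ℓ : EE N → A → ℝ) (β : ℝ → Measure A) (y : ℝ → EE N) (t : ℝ) : ℝ :=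
  ∫ s in (0:ℝ)..t, ∫ a, ℓ (y s) a ∂(β s)

lemma Dyn.inner_nonneg (h : Dyn f ℓ L) (x : EE N) (m : Measure A) : 0 ≤ ∫ a, ℓ x a ∂m :=
  integral_nonneg fun a => h.hℓnn x a

lemma Dyn.runCost_eq (h : Dyn f ℓ L) {β : ℝ → Measure A} (hβ : IsRelaxedControl β)
    {y : ℝ → EE N} (hy : Continuous y) {t : ℝ} (ht : 0 ≤ t) :
    runCost ℓ β y t = ENNReal.ofReal (rc ℓ β y t) := by
  unfold runCost rc
  rw [intervalIntegral.integral_of_le ht, ofReal_integral_eq_lintegral_ofReal]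
  · exact (intervalIntegrable_iff_integrableOn_Ioc_of_le ht).1 (intInt h.hℓ hβ hy _ _)
  · exact Eventually.of_forall fun s => h.inner_nonneg _ _

lemma Dyn.rc_add (h : Dyn f ℓ L) {β : ℝ → Measure A} (hβ : IsRelaxedControl β)
    {y : ℝ → EE N} (hy : Continuous y) (t τ : ℝ) :
    rc ℓ β y (t + τ) = rc ℓ β y t + rc ℓ (fun s => β (t + s)) (fun s => y (t + s)) τ := by
  unfold rc
  have := intervalIntegral.integral_comp_add_left (a := 0) (b := τ)
    (fun s => ∫ a, ℓ (y s) a ∂(β s)) t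
  rw [this, add_zero, intervalIntegral.integral_add_adjacent_intervals] <;>
  exact intInt h.hℓ hβ hy _ _

lemma Dyn.rc_nonneg (h : Dyn f ℓ L) (β : ℝ → Measure A)
    (y : ℝ → EE N) {t : ℝ} (ht : 0 ≤ t) : 0 ≤ rc ℓ β y t :=
  intervalIntegral.integral_nonneg ht fun s _ => h.inner_nonneg _ _

lemma Dyn.rc_mono (h : Dyn f ℓ L) {β : ℝ → Measure A} (hβ : IsRelaxedControl β)
    {y : ℝ → EE N} (hy : Continuous y) {t t' : ℝ} (ht : t ≤ t') :
    rc ℓ β y t ≤ rc ℓ β y t' := by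
  have := h.rc_add hβ hy t (t' - t)
  rw [add_sub_cancel] at this
  rw [this]
  linarith [h.rc_nonneg (fun s => β (t + s)) (fun s => y (t + s)) (sub_nonneg.2 ht)]

lemma relaxed_shift {β : ℝ → Measure A} (hβ : IsRelaxedControl β) (t : ℝ) :
    IsRelaxedControl fun s => β (t + s) :=
  ⟨fun s => hβ.1 _, fun g => (hβ.2 g).comp (measurable_const_add t)⟩

lemma Dyn.traj_shift (h : Dyn f ℓ L) {β : ℝ → Measure A} (hβ : IsRelaxedControl β)
    {x : EE N} {y : ℝ → EE N} (hy : IsTrajectory f β x y) {t : ℝ} (ht : 0 ≤ t) :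
    IsTrajectory f (fun s => β (t + s)) (y t) (fun s => y (t + s)) := by
  refine ⟨by simp, by have := hy.2.1; fun_prop, fun τ hτ => ?_⟩
  have := intervalIntegral.integral_comp_add_left (a := 0) (b := τ)
    (fun s => ∫ a, f (y s) a ∂(β s)) t
  rw [this, add_zero]
  beta_reduce
  rw [hy.2.2 (t + τ) (by linarith), hy.2.2 t ht, add_assoc,
    intervalIntegral.integral_add_adjacent_intervals] <;>
  exact intInt h.hf hβ hy.2.1 _ _

lemma Dyn.traj_eq (h : Dyn f ℓ L) {β β' : ℝ → Measure A} (hβ : IsRelaxedControl β)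
    (hβ' : IsRelaxedControl β') {x : EE N} {y y' : ℝ → EE N} (hy : IsTrajectory f β x y)
    (hy' : IsTrajectory f β' x y') {t₀ : ℝ} (hag : ∀ t ∈ Ico 0 t₀, β t = β' t) :
    ∀ t ∈ Icc 0 t₀, y t = y' t ∧ rc ℓ β y t = rc ℓ β' y' t := by
  have key := h.uniq hβ hβ' hy.2.1 hy'.2.1 (fun t ht => hy.2.2 t ht.1)
    (fun t ht => hy'.2.2 t ht.1) hag
  intro t ht
  refine ⟨key t ht, ?_⟩
  unfold rc
  refine intervalIntegral.integral_congr_ae ?_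
  have : ∀ᵐ s : ℝ, s ≠ t := by simp [ae_iff]
  filter_upwards [this] with s hs1 hs
  rw [uIoc_of_le ht.1] at hs
  rw [hag s ⟨hs.1.le, lt_of_lt_of_le (lt_of_le_of_ne hs.2 hs1) ht.2⟩,
    key s ⟨hs.1.le, hs.2.trans ht.2⟩]

variable {Y : EE N → (ℝ → Measure A) → ℝ → EE N}

/-- If from time `t` on, `β` agrees with `β'` for duration `t₀`, then so do states and costs. -/
lemma Dyn.follow (h : Dyn f ℓ L) (hY : ∀ x β, IsRelaxedControl β → IsTrajectory f β x (Y x β))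
    {β β' : ℝ → Measure A} (hβ : IsRelaxedControl β) (hβ' : IsRelaxedControl β') {x x' : EE N}
    {t t₀ : ℝ} (ht : 0 ≤ t) (hx : Y x β t = x') (hag : ∀ s ∈ Ico 0 t₀, β (t + s) = β' s) :
    ∀ s ∈ Icc 0 t₀, Y x β (t + s) = Y x' β' s ∧
      rc ℓ β (Y x β) (t + s) = rc ℓ β (Y x β) t + rc ℓ β' (Y x' β') s := by
  have h1 := h.traj_shift hβ (hY x β hβ) ht
  rw [hx] at h1
  have h2 := h.traj_eq (relaxed_shift hβ t) hβ' h1 (hY x' β' hβ') hag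
  intro s hs
  refine ⟨(h2 s hs).1, ?_⟩
  rw [h.rc_add hβ (hY x β hβ).2.1, (h2 s hs).2]

/-- `y` is reachable from `x` at time `t` with cost at most `c`. -/
def Reach {N : ℕ} {A : Type*} [MetricSpace A] [MeasurableSpace A] (ℓ : EE N → A → ℝ)
    (Y : EE N → (ℝ → Measure A) → ℝ → EE N) (x : EE N) (t c : ℝ) (y : EE N) : Prop :=
  0 ≤ t ∧ ∃ β, IsRelaxedControl β ∧ Y x β t = y ∧ rc ℓ β (Y x β) t ≤ c

/-- `x` can be steered to `T` with cost at most `c`. -/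
def Near {N : ℕ} {A : Type*} [MetricSpace A] [MeasurableSpace A] (T : Set (EE N))
    (ℓ : EE N → A → ℝ)
    (Y : EE N → (ℝ → Measure A) → ℝ → EE N) (x : EE N) (c : ℝ) : Prop :=
  ∃ t y, y ∈ T ∧ Reach ℓ Y x t c y

lemma relaxed_concat {β β' : ℝ → Measure A} (hβ : IsRelaxedControl β)
    (hβ' : IsRelaxedControl β') (t : ℝ) :
    IsRelaxedControl fun s => if s < t then β s else β' (s - t) := by
  refine ⟨fun s => ?_, fun g => ?_⟩
  · by_cases hs : s < t
    · simpa [hs] using hβ.1 s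
    · simpa [hs] using hβ'.1 _
  · have : (fun s => ∫ a, g a ∂(if s < t then β s else β' (s - t))) =
        fun s => if s < t then ∫ a, g a ∂(β s) else ∫ a, g a ∂(β' (s - t)) := by
      funext s
      split_ifs <;> rfl
    rw [this]
    exact Measurable.ite measurableSet_Iio (hβ.2 g) ((hβ'.2 g).comp (measurable_sub_const t))

lemma Dyn.reach_trans (h : Dyn f ℓ L)
    (hY : ∀ x β, IsRelaxedControl β → IsTrajectory f β x (Y x β))
    {x y z : EE N} {t t' c c' : ℝ} (h1 : Reach ℓ Y x t c y) (h2 : Reach ℓ Y y t' c' z) :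
    Reach ℓ Y x (t + t') (c + c') z := by
  obtain ⟨ht, β, hβ, hy, hc⟩ := h1
  obtain ⟨ht', β', hβ', hz, hc'⟩ := h2
  have hB := relaxed_concat hβ hβ' t
  have e1 := h.traj_eq hB hβ (hY x _ hB) (hY x _ hβ) (t₀ := t)
    (fun s hs => by simp [hs.2]) t ⟨ht, le_rfl⟩
  have e2 := h.follow hY hB hβ' ht (x := x) (x' := y) (t₀ := t') (by rw [e1.1, hy])
    (fun s hs => by simp [hs.1]) t' ⟨ht', le_rfl⟩
  refine ⟨by linarith, _, hB, by rw [e2.1, hz], ?_⟩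
  rw [e2.2, e1.2]
  linarith

lemma Dyn.near_of_reach (h : Dyn f ℓ L)
    (hY : ∀ x β, IsRelaxedControl β → IsTrajectory f β x (Y x β)) {T : Set (EE N)}
    {x y : EE N} {t c c' : ℝ} (h1 : Reach ℓ Y x t c y) (h2 : Near T ℓ Y y c') :
    Near T ℓ Y x (c + c') := by
  obtain ⟨t', z, hz, hr⟩ := h2
  exact ⟨_, z, hz, h.reach_trans hY h1 hr⟩

lemma Near.mono {T : Set (EE N)} {x : EE N} {c c' : ℝ} (h1 : Near T ℓ Y x c) (hc : c ≤ c') :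
    Near T ℓ Y x c' := by
  obtain ⟨t, y, hy, ht, β, hβ, e, hr⟩ := h1
  exact ⟨t, y, hy, ht, β, hβ, e, hr.trans hc⟩

lemma reach_zero_s10 [Nonempty A] (hY : ∀ x β, IsRelaxedControl β → IsTrajectory f β x (Y x β))
    (x : EE N) : Reach ℓ Y x 0 0 x := by
  have hβ : IsRelaxedControl (fun _ : ℝ => Measure.dirac (Classical.arbitrary A)) :=
    ⟨fun _ => inferInstance, fun g => measurable_const⟩
  exact ⟨le_rfl, _, hβ, (hY x _ hβ).1, by simp [rc]⟩

lemma Dyn.value_le (h : Dyn f ℓ L)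
    (hY : ∀ x β, IsRelaxedControl β → IsTrajectory f β x (Y x β)) {T : Set (EE N)}
    {x : EE N} {c : ℝ} (hn : Near T ℓ Y x c) : valueFn T ℓ Y x ≤ (c : EReal) := by
  obtain ⟨t, y, hy, ht, β, hβ, e, hr⟩ := hn
  have hne : t ∈ exitTimes T (Y x β) := ⟨ht, by rw [e]; exact hy⟩
  have hbd : BddBelow (exitTimes T (Y x β)) := ⟨0, fun s hs => hs.1⟩
  have hv : valueFn T ℓ Y x ≤ ((runCost ℓ β (Y x β) (sInf (exitTimes T (Y x β)))) : EReal) :=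
    sInf_le ⟨β, hβ, ⟨t, hne⟩, rfl⟩
  refine hv.trans ?_
  have h0 : 0 ≤ sInf (exitTimes T (Y x β)) := Real.sInf_nonneg fun s hs => hs.1
  have hle : sInf (exitTimes T (Y x β)) ≤ t := csInf_le hbd hne
  rw [h.runCost_eq hβ (hY x β hβ).2.1 h0, EReal.coe_ennreal_ofReal,
    max_eq_left (h.rc_nonneg _ _ h0)]
  exact_mod_cast (h.rc_mono hβ (hY x β hβ).2.1 hle).trans hr

lemma relaxed_glue {b : ℕ → ℝ → Measure A} (hb : ∀ k, IsRelaxedControl (b k)) :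
    IsRelaxedControl fun s => b ⌊s⌋₊ (s - (⌊s⌋₊ : ℝ)) := by
  refine ⟨fun s => (hb _).1 _, fun g => ?_⟩
  have h1 : Measurable fun p : ℕ × ℝ => ∫ a, g a ∂(b p.1 p.2) :=
    measurable_from_prod_countable_right fun k => (hb k).2 g
  have h2 : Measurable fun s : ℝ => ((⌊s⌋₊, s - (⌊s⌋₊ : ℝ)) : ℕ × ℝ) :=
    Nat.measurable_floor.prodMk (measurable_id.sub (measurable_from_top.comp Nat.measurable_floor))
  exact h1.comp h2

/-- Infinite concatenation of unit-time controls. -/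
lemma Dyn.glue (h : Dyn f ℓ L) (hY : ∀ x β, IsRelaxedControl β → IsTrajectory f β x (Y x β))
    {b : ℕ → ℝ → Measure A} (hb : ∀ k, IsRelaxedControl (b k)) {X : ℕ → EE N}
    (hX : ∀ k, Y (X k) (b k) 1 = X (k + 1)) :
    ∃ β, IsRelaxedControl β ∧ ∀ k : ℕ, Y (X 0) β k = X k ∧
      rc ℓ β (Y (X 0) β) k = ∑ j ∈ Finset.range k, rc ℓ (b j) (Y (X j) (b j)) 1 := by
  have hB := relaxed_glue hb
  refine ⟨_, hB, fun k => ?_⟩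
  induction k with
  | zero => simp [(hY (X 0) _ hB).1, rc]
  | succ k ih =>
    have e := h.follow hY hB (hb k) (x := X 0) (x' := X k) (t := k) (t₀ := 1) (by positivity)
      ih.1 ?_ 1 ⟨zero_le_one, le_rfl⟩
    · push_cast
      rw [e.1, e.2, ih.2, hX, Finset.sum_range_succ]
      exact ⟨rfl, rfl⟩
    · intro s hs
      have : ⌊(k : ℝ) + s⌋₊ = k := by
        rw [Nat.floor_eq_iff (by have := hs.1; positivity)]
        exact ⟨by linarith [hs.1], by linarith [hs.2]⟩
      simp [this]

end reach


section compactness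
variable {N : ℕ} {A : Type*} [MetricSpace A] [CompactSpace A] [MeasurableSpace A] [BorelSpace A]
  {f : EE N → A → EE N} {ℓ : EE N → A → ℝ} {L : ℝ}

/-- Continuous cutoff equal to `1` up to `t` and `0` after `t + η`. -/
def cut (t η s : ℝ) : ℝ := max 0 (min 1 (1 - (s - t) / η))

lemma cut_cont (t η : ℝ) : Continuous (cut t η) := by unfold cut; fun_prop

lemma cut_mem (t η s : ℝ) : |cut t η s| ≤ 1 := by
  unfold cut
  rw [abs_of_nonneg (le_max_left _ _)]
  exact max_le zero_le_one (min_le_left _ _)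

lemma cut_one {t η s : ℝ} (hη : 0 < η) (h : s ≤ t) : cut t η s = 1 := by
  unfold cut
  have : (s - t) / η ≤ 0 := div_nonpos_of_nonpos_of_nonneg (by linarith) hη.le
  rw [min_eq_left (by linarith), max_eq_right zero_le_one]

lemma cut_zero {t η s : ℝ} (hη : 0 < η) (h : t + η ≤ s) : cut t η s = 0 := by
  unfold cut
  have : 1 ≤ (s - t) / η := by rw [le_div_iff₀ hη]; linarith
  rw [max_eq_left]
  exact (min_le_right _ _).trans (by linarith)

lemma cut_err {G : ℝ → ℝ} (hG : ∀ a b, IntervalIntegrable G volume a b) {C : ℝ} (hC0 : 0 ≤ C)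
    (hC : ∀ s ∈ Icc (0:ℝ) 1, |G s| ≤ C) {t η : ℝ} (ht : t ∈ Icc (0:ℝ) 1) (hη : 0 < η) :
    |(∫ s in (0:ℝ)..1, cut t η s * G s) - ∫ s in (0:ℝ)..t, G s| ≤ C * η := by
  have hI : ∀ a b, IntervalIntegrable (fun s => cut t η s * G s) volume a b := fun a b =>
    (hG a b).continuousOn_mul (cut_cont t η).continuousOn
  rw [← intervalIntegral.integral_add_adjacent_intervals (hI 0 t) (hI t 1)]
  have e1 : (∫ s in (0:ℝ)..t, cut t η s * G s) = ∫ s in (0:ℝ)..t, G s := by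
    refine intervalIntegral.integral_congr fun s hs => ?_
    rw [uIcc_of_le ht.1] at hs
    simp [cut_one hη hs.2]
  have h1 : t ≤ min 1 (t + η) := le_min ht.2 (by linarith)
  rw [e1, add_sub_cancel_left,
    ← intervalIntegral.integral_add_adjacent_intervals (hI t (min 1 (t + η))) (hI _ 1)]
  have e2 : (∫ s in (min 1 (t + η))..1, cut t η s * G s) = 0 := by
    rcases le_total 1 (t + η) with h | h
    · rw [min_eq_left h, intervalIntegral.integral_same]
    · rw [min_eq_right h]
      rw [← intervalIntegral.integral_zero (μ := volume) (a := t + η) (b := 1) (E := ℝ)]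
      refine intervalIntegral.integral_congr fun s hs => ?_
      rw [uIcc_of_le h] at hs
      simp [cut_zero hη hs.1]
  rw [e2, add_zero]
  have := intervalIntegral.norm_integral_le_of_norm_le_const (C := C) (a := t)
    (b := min 1 (t + η)) (f := fun s => cut t η s * G s) ?_
  · rw [abs_of_nonneg (by linarith)] at this
    refine this.trans (mul_le_mul_of_nonneg_left ?_ hC0)
    linarith [min_le_right 1 (t + η)]
  · intro s hs
    rw [uIoc_of_le h1] at hs
    rw [norm_mul]
    have h2 := hC s ⟨ht.1.trans hs.1.le, hs.2.trans (min_le_left _ _)⟩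
    have h3 := cut_mem t η s
    rw [Real.norm_eq_abs, Real.norm_eq_abs]
    calc _ ≤ 1 * C := mul_le_mul h3 h2 (abs_nonneg _) zero_le_one
      _ = C := one_mul C

/-- Sequential compactness of relaxed controls on `[0,1]`. -/
lemma relaxed_compact [Nonempty A] {b : ℕ → ℝ → Measure A} (hb : ∀ n, IsRelaxedControl (b n)) :
    ∃ β : ℝ → Measure A, IsRelaxedControl β ∧ ∃ φ : ℕ → ℕ, StrictMono φ ∧
      ∀ (g : EE N → A → ℝ), (Continuous fun q : EE N × A => g q.1 q.2) →
      ∀ y : ℝ → EE N, Continuous y → ∀ t ∈ Icc (0:ℝ) 1,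
        Tendsto (fun n => ∫ s in (0:ℝ)..t, ∫ a, g (y s) a ∂(b (φ n) s)) atTop
          (𝓝 (∫ s in (0:ℝ)..t, ∫ a, g (y s) a ∂(β s))) := by
  let ν : Measure ℝ := volume.restrict (Icc (0:ℝ) 1)
  have hν : IsProbabilityMeasure ν := ⟨by simp [ν]⟩
  let κ : ℕ → ProbabilityTheory.Kernel ℝ A := fun n => ⟨b n, relaxed_measurable (hb n)⟩
  have hκ : ∀ n, ProbabilityTheory.IsMarkovKernel (κ n) := fun n => ⟨(hb n).1⟩
  let μ : ℕ → ProbabilityMeasure (ℝ × A) := fun n => ⟨ν.compProd (κ n), inferInstance⟩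
  let K : Set (ℝ × A) := Icc (0:ℝ) 1 ×ˢ univ
  have hK : IsCompact K := isCompact_Icc.prod isCompact_univ
  have hcomp := isCompact_setOfPred_probabilityMeasure_mass_eq_compl_isCompact_le
    (E := ℝ × A) (u := fun _ => 0) (K := fun _ => K) tendsto_const_nhds (fun _ => hK)
    (Or.inl inferInstance)
  have hmem : ∀ n, μ n ∈ {μ : ProbabilityMeasure (ℝ × A) | ∀ _ : ℕ, μ Kᶜ ≤ 0} := by
    intro n _
    have : (ν.compProd (κ n)) Kᶜ = 0 := by
      have e : Kᶜ = (Icc (0:ℝ) 1)ᶜ ×ˢ (univ : Set A) := by ext ⟨p, q⟩; simp [K]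
      rw [e, Measure.compProd_apply_prod measurableSet_Icc.compl MeasurableSet.univ]
      simp [ν]
    simp only [nonpos_iff_eq_zero]
    rw [ProbabilityMeasure.null_iff_toMeasure_null]
    exact this
  obtain ⟨μ₀, -, φ, hφ, hlim⟩ := hcomp.isSeqCompact hmem
  have hfst : (μ₀ : Measure (ℝ × A)).fst = ν := by
    have h1 := ProbabilityMeasure.tendsto_map_of_tendsto_of_continuous _ _ hlim
      (continuous_fst (X := ℝ) (Y := A))
    have h2 : ∀ n, (μ n).map (continuous_fst (X := ℝ) (Y := A)).measurable.aemeasurable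
        = ⟨ν, hν⟩ := by
      intro n
      apply Subtype.ext
      change (ν.compProd (κ n)).map Prod.fst = ν
      exact Measure.fst_compProd ν (κ n)
    have h3 : Tendsto (fun n => (μ (φ n)).map
        (continuous_fst (X := ℝ) (Y := A)).measurable.aemeasurable) atTop
        (𝓝 (⟨ν, hν⟩ : ProbabilityMeasure ℝ)) := by
      simp only [h2]; exact tendsto_const_nhds
    have h4 := tendsto_nhds_unique h1 h3
    exact congrArg Subtype.val h4
  let κ₀ := (μ₀ : Measure (ℝ × A)).condKernel
  have hdis : ν.compProd κ₀ = (μ₀ : Measure (ℝ × A)) := by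
    rw [← hfst]; exact (μ₀ : Measure (ℝ × A)).disintegrate _
  have hβ : IsRelaxedControl (fun s => κ₀ s) := by
    refine ⟨fun s => inferInstance, fun g => ?_⟩
    exact (g.continuous.stronglyMeasurable.integral_kernel (κ := κ₀)).measurable
  refine ⟨fun s => κ₀ s, hβ, φ, hφ, ?_⟩
  intro g hg y hy t ht
  obtain ⟨R, hR⟩ := (isCompact_Icc (a := (0:ℝ)) (b := 1)).exists_bound_of_continuousOn
    hy.continuousOn
  obtain ⟨C, hC0, hC⟩ := exists_bound hg R
  let pr : ℝ → ℝ := fun s => max 0 (min 1 s)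
  have hpr : Continuous pr := by fun_prop
  have hpr1 : ∀ s, pr s ∈ Icc (0:ℝ) 1 := fun s =>
    ⟨le_max_left _ _, max_le zero_le_one (min_le_left _ _)⟩
  have hpr2 : ∀ s ∈ Icc (0:ℝ) 1, pr s = s := fun s hs => by
    simp [pr, min_eq_right hs.2, max_eq_right hs.1]
  -- test against the cutoff
  have hJ : ∀ (κ' : ProbabilityTheory.Kernel ℝ A) [ProbabilityTheory.IsMarkovKernel κ'], ∀ η > 0,
      ∫ p, cut t η p.1 * g (y (pr p.1)) p.2 ∂(ν.compProd κ') =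
        ∫ s in (0:ℝ)..1, cut t η s * ∫ a, g (y s) a ∂(κ' s) := by
    intro κ' _ η hη
    rw [Measure.integral_compProd]
    · rw [intervalIntegral.integral_of_le zero_le_one, ← integral_Icc_eq_integral_Ioc]
      refine setIntegral_congr_fun measurableSet_Icc fun s hs => ?_
      simp only [hpr2 s hs]
      rw [integral_const_mul]
    · refine Integrable.of_bound (C := C) ?_ (Eventually.of_forall fun p => ?_)
      · refine Continuous.aestronglyMeasurable ?_
        exact ((cut_cont t η).comp continuous_fst).mul
          (hg.comp ((hy.comp (hpr.comp continuous_fst)).prodMk continuous_snd))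
      · rw [norm_mul]
        calc _ ≤ 1 * C := mul_le_mul (cut_mem _ _ _) (hC _ _ (hR _ (hpr1 _))) (norm_nonneg _)
              zero_le_one
          _ = C := one_mul C
  have herr : ∀ β : ℝ → Measure A, IsRelaxedControl β → ∀ η > 0,
      |(∫ s in (0:ℝ)..1, cut t η s * ∫ a, g (y s) a ∂(β s)) -
        ∫ s in (0:ℝ)..t, ∫ a, g (y s) a ∂(β s)| ≤ C * η := by
    intro β hβ η hη
    have := hβ.1
    exact cut_err (fun a b => intInt hg hβ hy a b) hC0
      (fun s hs => norm_int_le fun a => hC _ _ (hR s hs)) ht hη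
  have hlimJ : ∀ η > 0, Tendsto
      (fun n => ∫ s in (0:ℝ)..1, cut t η s * ∫ a, g (y s) a ∂(b (φ n) s)) atTop
      (𝓝 (∫ s in (0:ℝ)..1, cut t η s * ∫ a, g (y s) a ∂(κ₀ s))) := by
    intro η hη
    let G : BoundedContinuousFunction (ℝ × A) ℝ := BoundedContinuousFunction.ofNormedAddCommGroup
      (fun p => cut t η p.1 * g (y (pr p.1)) p.2)
      (((cut_cont t η).comp continuous_fst).mul
          (hg.comp ((hy.comp (hpr.comp continuous_fst)).prodMk continuous_snd))) C
      (fun p => by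
        rw [norm_mul]
        calc _ ≤ 1 * C := mul_le_mul (cut_mem _ _ _) (hC _ _ (hR _ (hpr1 _))) (norm_nonneg _)
              zero_le_one
          _ = C := one_mul C)
    have h1 := ProbabilityMeasure.tendsto_iff_forall_integral_tendsto.1 hlim G
    rw [← hJ κ₀ η hη, hdis]
    refine h1.congr fun n => ?_
    exact hJ (κ (φ n)) η hη
  rw [Metric.tendsto_atTop]
  intro ε hε
  obtain ⟨η, hη, hηε⟩ : ∃ η > 0, C * η < ε / 3 :=
    ⟨ε / 3 / (C + 1), by positivity, by
      rw [mul_div_assoc', div_lt_iff₀ (by positivity)]; nlinarith⟩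
  obtain ⟨n₀, hn₀⟩ := Metric.tendsto_atTop.1 (hlimJ η hη) (ε / 3) (by positivity)
  refine ⟨n₀, fun n hn => ?_⟩
  have h1 := hn₀ n hn
  have h2 := herr _ (hb (φ n)) η hη
  have h3 := herr _ hβ η hη
  rw [Real.dist_eq] at h1 ⊢
  rw [abs_lt] at h1 ⊢
  rw [abs_le] at h2 h3
  constructor <;> linarith [h1.1, h1.2, h2.1, h2.2, h3.1, h3.2]

lemma tendsto_EE {u : ℕ → EE N} {v : EE N} (h : ∀ i, Tendsto (fun n => u n i) atTop (𝓝 (v i))) :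
    Tendsto u atTop (𝓝 v) := by
  have h1 : Tendsto (fun n => (fun i => u n i)) atTop (𝓝 (fun i => v i)) :=
    tendsto_pi_nhds.2 h
  exact ((PiLp.continuous_toLp 2 _).tendsto _).comp h1

lemma EE_int_apply {b : ℝ → Measure A} (hb : IsRelaxedControl b) {y : ℝ → EE N}
    (h : Dyn f ℓ L) (hy : Continuous y) (t : ℝ) (i : Fin N) :
    (∫ s in (0:ℝ)..t, ∫ a, f (y s) a ∂(b s)) i = ∫ s in (0:ℝ)..t, ∫ a, f (y s) a i ∂(b s) := by
  have := hb.1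
  have h1 := (PiLp.proj (𝕜 := ℝ) 2 (fun _ : Fin N => ℝ) i).intervalIntegral_comp_comm
    (intInt h.hf hb hy 0 t)
  refine Eq.trans ?_ (h1.symm.trans ?_)
  · rfl
  refine intervalIntegral.integral_congr fun s _ => ?_
  exact ((PiLp.proj (𝕜 := ℝ) 2 (fun _ : Fin N => ℝ) i).integral_comp_comm
    (integrable_cont (h.cont_f (y s)) (b s))).symm


/-- Uniform continuity of the cost near a compact set, uniformly in the control. -/
lemma unif_cost (hℓ : Continuous fun q : EE N × A => ℓ q.1 q.2) {K : Set (EE N)}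
    (hK : IsCompact K) {κ : ℝ} (hκ : 0 < κ) :
    ∃ ρ > 0, ∀ s ∈ K, ∀ x, ‖x - s‖ < ρ → ∀ a, |ℓ x a - ℓ s a| ≤ κ := by
  have hc := (hK.prod (isCompact_univ (X := A))).uniformContinuousAt_of_continuousAt
    (fun q : EE N × A => ℓ q.1 q.2) (fun q _ => hℓ.continuousAt) (Metric.dist_mem_uniformity hκ)
  obtain ⟨ρ, hρ, h⟩ := Metric.mem_uniformity_dist.1 hc
  refine ⟨ρ, hρ, fun s hs x hx a => ?_⟩
  have := @h (s, a) (x, a) (by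
    rw [Prod.dist_eq]
    simp only [dist_self]
    rw [max_lt_iff]
    exact ⟨by rwa [dist_comm, dist_eq_norm], hρ⟩) ⟨hs, trivial⟩
  simp only [mem_ofPred_eq] at this
  rw [dist_comm, Real.dist_eq] at this
  exact this.le

variable {Y : EE N → (ℝ → Measure A) → ℝ → EE N}

lemma Dyn.compactness [Nonempty A] (h : Dyn f ℓ L)
    (hY : ∀ x β, IsRelaxedControl β → IsTrajectory f β x (Y x β))
    {z : ℕ → EE N} {z₀ : EE N} (hz : Tendsto z atTop (𝓝 z₀)) {b : ℕ → ℝ → Measure A}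
    (hb : ∀ n, IsRelaxedControl (b n))
    (hc : Tendsto (fun n => rc ℓ (b n) (Y (z n) (b n)) 1) atTop (𝓝 0)) :
    ∃ β, IsRelaxedControl β ∧ rc ℓ β (Y z₀ β) 1 = 0 := by
  obtain ⟨β, hβ, φ, hφ, hlim⟩ := relaxed_compact (N := N) hb
  refine ⟨β, hβ, ?_⟩
  have hφt := hφ.tendsto_atTop
  obtain ⟨R, hR⟩ : ∃ R, ∀ n, ‖z n‖ ≤ R := by
    obtain ⟨R, hR⟩ := hz.norm.bddAbove_range
    exact ⟨R, fun n => hR ⟨n, rfl⟩⟩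
  have hR0 : ‖z₀‖ ≤ R := le_of_tendsto hz.norm (Eventually.of_forall hR)
  obtain ⟨R', C, hC0, hRR', hgr⟩ := h.growth R 1 zero_le_one
  obtain ⟨Cf, hCf0, hCf⟩ := exists_bound h.hf R'
  obtain ⟨Cl, hCl0, hCl⟩ := exists_bound h.hℓ R'
  have hpb := fun n => (hb n).1
  have hpβ := hβ.1
  let y₀ := Y z₀ β
  let y : ℕ → ℝ → EE N := fun n => Y (z (φ n)) (b (φ n))
  have hy₀ : IsTrajectory f β z₀ y₀ := hY _ _ hβ
  have hy : ∀ n, IsTrajectory f (b (φ n)) (z (φ n)) (y n) := fun n => hY _ _ (hb _)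
  have hy₀c := hy₀.2.1
  have hyc := fun n => (hy n).2.1
  have hy₀b : ∀ t ∈ Icc (0:ℝ) 1, ‖y₀ t‖ ≤ R' := fun t ht => (hgr z₀ hR0 β y₀ hβ hy₀ t ht).1
  have hyb : ∀ n, ∀ t ∈ Icc (0:ℝ) 1, ‖y n t‖ ≤ R' := fun n t ht =>
    (hgr _ (hR _) _ (y n) (hb _) (hy n) t ht).1
  let e : ℕ → ℝ → ℝ := fun n t => ‖(∫ s in (0:ℝ)..t, ∫ a, f (y₀ s) a ∂(b (φ n) s)) -
    ∫ s in (0:ℝ)..t, ∫ a, f (y₀ s) a ∂(β s)‖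
  have hec : ∀ n, Continuous (e n) := by
    intro n
    refine Continuous.norm (Continuous.sub ?_ ?_)
    · exact intervalIntegral.continuous_primitive (fun a b => intInt h.hf (hb _) hy₀c a b) 0
    · exact intervalIntegral.continuous_primitive (fun a b => intInt h.hf hβ hy₀c a b) 0
  have hel : ∀ t ∈ Icc (0:ℝ) 1, Tendsto (fun n => e n t) atTop (𝓝 0) := by
    intro t ht
    have : Tendsto (fun n => ∫ s in (0:ℝ)..t, ∫ a, f (y₀ s) a ∂(b (φ n) s)) atTop
        (𝓝 (∫ s in (0:ℝ)..t, ∫ a, f (y₀ s) a ∂(β s))) := by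
      refine tendsto_EE fun i => ?_
      simp only [EE_int_apply (hb _) h hy₀c, EE_int_apply hβ h hy₀c]
      refine hlim (fun x a => f x a i) ?_ y₀ hy₀c t ht
      have := h.hf
      fun_prop
    exact tendsto_iff_norm_sub_tendsto_zero.1 this
  have hfi : ∀ β' : ℝ → Measure A, IsRelaxedControl β' → ∀ t ∈ Icc (0:ℝ) 1,
      ‖∫ s in (0:ℝ)..t, ∫ a, f (y₀ s) a ∂(β' s)‖ ≤ Cf := by
    intro β' hβ' t ht
    have := hβ'.1
    have h1 := intervalIntegral.norm_integral_le_of_norm_le_const (C := Cf) (a := 0) (b := t)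
      (f := fun s => ∫ a, f (y₀ s) a ∂(β' s)) (fun s hs => by
        rw [uIoc_of_le ht.1] at hs
        exact norm_int_le fun a => hCf _ _ (hy₀b s ⟨hs.1.le, hs.2.trans ht.2⟩))
    rw [sub_zero, abs_of_nonneg ht.1] at h1
    nlinarith [ht.2]
  have heb : ∀ n, ∀ t ∈ Icc (0:ℝ) 1, e n t ≤ 2 * Cf := by
    intro n t ht
    refine (norm_sub_le _ _).trans ?_
    linarith [hfi _ (hb (φ n)) t ht, hfi _ hβ t ht]
  have hen : ∀ n t, 0 ≤ e n t := fun n t => norm_nonneg _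
  let Ei : ℕ → ℝ := fun n => ∫ t in (0:ℝ)..1, e n t
  have hEi : Tendsto Ei atTop (𝓝 0) := by
    have := intervalIntegral.tendsto_integral_filter_of_dominated_convergence
      (μ := volume) (a := 0) (b := 1) (l := atTop) (F := e) (f := fun _ => (0:ℝ))
      (fun _ => 2 * Cf) (Eventually.of_forall fun n => (hec n).aestronglyMeasurable)
      (Eventually.of_forall fun n => Eventually.of_forall fun t ht => by
        rw [uIoc_of_le zero_le_one] at ht
        rw [Real.norm_eq_abs, abs_of_nonneg (hen n t)]
        exact heb n t ⟨ht.1.le, ht.2⟩)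
      (by simp)
      (Eventually.of_forall fun t ht => by
        rw [uIoc_of_le zero_le_one] at ht
        exact hel t ⟨ht.1.le, ht.2⟩)
    simpa using this
  let α : ℕ → ℝ := fun n => ‖z (φ n) - z₀‖
  have hα : Tendsto α atTop (𝓝 0) :=
    tendsto_iff_norm_sub_tendsto_zero.1 (hz.comp hφt)
  let d : ℕ → ℝ → ℝ := fun n t => ‖y n t - y₀ t‖
  have hdc : ∀ n, Continuous (d n) := fun n => ((hyc n).sub hy₀c).norm
  have hd1 : ∀ n, ∀ t ∈ Icc (0:ℝ) 1, d n t ≤ α n + e n t + L * ∫ s in (0:ℝ)..t, d n s := by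
    intro n t ht
    have e1 : y n t - y₀ t = (z (φ n) - z₀) +
        ((∫ s in (0:ℝ)..t, ∫ a, f (y₀ s) a ∂(b (φ n) s)) -
          ∫ s in (0:ℝ)..t, ∫ a, f (y₀ s) a ∂(β s)) +
        ∫ s in (0:ℝ)..t, ((∫ a, f (y n s) a ∂(b (φ n) s)) - ∫ a, f (y₀ s) a ∂(b (φ n) s)) := by
      rw [intervalIntegral.integral_sub (intInt h.hf (hb _) (hyc n) _ _)
        (intInt h.hf (hb _) hy₀c _ _), (hy n).2.2 t ht.1, hy₀.2.2 t ht.1]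
      abel
    have e2 : ‖∫ s in (0:ℝ)..t, ((∫ a, f (y n s) a ∂(b (φ n) s)) -
        ∫ a, f (y₀ s) a ∂(b (φ n) s))‖ ≤ ∫ s in (0:ℝ)..t, L * d n s :=
      intervalIntegral.norm_integral_le_of_norm_le ht.1
        (Eventually.of_forall fun s _ => h.int_lip _ _ _)
        (((hdc n).const_mul L).intervalIntegrable _ _)
    rw [intervalIntegral.integral_const_mul] at e2
    change ‖y n t - y₀ t‖ ≤ _
    rw [e1]
    refine (norm_add₃_le).trans ?_
    exact add_le_add le_rfl e2
  have hU : ∀ n, ∀ t ∈ Icc (0:ℝ) 1, (∫ s in (0:ℝ)..t, d n s) ≤ (α n + Ei n) * Real.exp L := by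
    intro n t ht
    have hUc : Continuous fun t => ∫ s in (0:ℝ)..t, d n s :=
      intervalIntegral.continuous_primitive (fun a b => (hdc n).intervalIntegrable a b) 0
    have hα0 : 0 ≤ α n := norm_nonneg _
    have hE0 : 0 ≤ Ei n := intervalIntegral.integral_nonneg zero_le_one fun t _ => hen n t
    have key := gron hUc (a := α n + Ei n) (t₀ := 1) h.hL ?_ t ht
    · refine key.trans (mul_le_mul_of_nonneg_left (Real.exp_le_exp.2 ?_) (by positivity))
      nlinarith [ht.2, h.hL]
    · intro t ht
      have i1 : (∫ s in (0:ℝ)..t, d n s) ≤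
          ∫ s in (0:ℝ)..t, (α n + e n s + L * ∫ r in (0:ℝ)..s, d n r) := by
        refine intervalIntegral.integral_mono_on ht.1 ((hdc n).intervalIntegrable _ _) ?_ ?_
        · have := hec n
          exact Continuous.intervalIntegrable (by fun_prop) _ _
        · exact fun s hs => hd1 n s ⟨hs.1, hs.2.trans ht.2⟩
      rw [intervalIntegral.integral_add, intervalIntegral.integral_add,
        intervalIntegral.integral_const_mul] at i1
      · have i2 : (∫ s in (0:ℝ)..t, e n s) ≤ Ei n :=
          intervalIntegral.integral_mono_interval le_rfl ht.1 ht.2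
            (Eventually.of_forall fun s => hen n s) ((hec n).intervalIntegrable _ _)
        have i3 : (∫ s in (0:ℝ)..t, α n) ≤ α n := by
          simp only [intervalIntegral.integral_const, sub_zero, smul_eq_mul]
          nlinarith [ht.2]
        linarith
      · simp
      · exact (hec n).intervalIntegrable _ _
      · have := hec n
        exact Continuous.intervalIntegrable (by fun_prop) _ _
      · exact Continuous.intervalIntegrable (by fun_prop) _ _
  have hdl : ∀ t ∈ Icc (0:ℝ) 1, Tendsto (fun n => d n t) atTop (𝓝 0) := by
    intro t ht
    have hup : Tendsto (fun n => α n + e n t + L * ((α n + Ei n) * Real.exp L)) atTop (𝓝 0) := by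
      have := (hα.add (hel t ht)).add (((hα.add hEi).mul_const (Real.exp L)).const_mul L)
      simpa using this
    refine squeeze_zero (fun n => norm_nonneg _) (fun n => ?_) hup
    have h1 := hd1 n t ht
    have h2 := mul_le_mul_of_nonneg_left (hU n t ht) h.hL.le
    linarith
  -- costs
  have hD : Tendsto (fun n => ∫ s in (0:ℝ)..1, ((∫ a, ℓ (y n s) a ∂(b (φ n) s)) -
      ∫ a, ℓ (y₀ s) a ∂(b (φ n) s))) atTop (𝓝 0) := by
    have := intervalIntegral.tendsto_integral_filter_of_dominated_convergence
      (μ := volume) (a := 0) (b := 1) (l := atTop)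
      (F := fun n s => ((∫ a, ℓ (y n s) a ∂(b (φ n) s)) - ∫ a, ℓ (y₀ s) a ∂(b (φ n) s)))
      (f := fun _ => (0:ℝ)) (fun _ => Cl + Cl)
      (Eventually.of_forall fun n => ((smeas_int h.hℓ (hb _) (hyc n)).sub
        (smeas_int h.hℓ (hb _) hy₀c)).aestronglyMeasurable)
      (Eventually.of_forall fun n => Eventually.of_forall fun t ht => by
        rw [uIoc_of_le zero_le_one] at ht
        refine (norm_sub_le _ _).trans (add_le_add ?_ ?_)
        · exact norm_int_le fun a => hCl _ _ (hyb n t ⟨ht.1.le, ht.2⟩)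
        · exact norm_int_le fun a => hCl _ _ (hy₀b t ⟨ht.1.le, ht.2⟩))
      (by simp)
      (Eventually.of_forall fun t ht => by
        rw [uIoc_of_le zero_le_one] at ht
        rw [Metric.tendsto_atTop]
        intro ε hε
        obtain ⟨ρ, hρ, hu⟩ := unif_cost h.hℓ (isCompact_singleton (x := y₀ t)) (half_pos hε)
        obtain ⟨n₀, hn₀⟩ := Metric.tendsto_atTop.1 (hdl t ⟨ht.1.le, ht.2⟩) ρ hρ
        refine ⟨n₀, fun n hn => ?_⟩
        have h1 := hn₀ n hn
        rw [Real.dist_eq, sub_zero, abs_of_nonneg (norm_nonneg _)] at h1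
        rw [dist_zero_right, ← integral_sub (integrable_cont (h.cont_l _) _)
          (integrable_cont (h.cont_l _) _)]
        refine (norm_int_le (C := ε / 2) fun a => ?_).trans_lt (by linarith)
        exact hu _ rfl _ h1 a)
    simpa using this
  have hc' := hc.comp hφt
  have hlast := hlim ℓ h.hℓ y₀ hy₀c 1 ⟨zero_le_one, le_rfl⟩
  have hsum := hD.add hlast
  rw [zero_add] at hsum
  refine tendsto_nhds_unique (hsum.congr fun n => ?_) hc'
  rw [intervalIntegral.integral_sub (intInt h.hℓ (hb _) (hyc n) _ _)
    (intInt h.hℓ (hb _) hy₀c _ _), sub_add_cancel]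
  rfl

end compactness


section step
variable {N : ℕ} {A : Type*} [MetricSpace A] [CompactSpace A] [MeasurableSpace A] [BorelSpace A]
  {f : EE N → A → EE N} {ℓ : EE N → A → ℝ} {L : ℝ}

/-- One-step estimate for the quadratic penalisation along a trajectory. -/
lemma Dyn.step (h : Dyn f ℓ L) {β : ℝ → Measure A} (hβ : IsRelaxedControl β) {x s : EE N}
    {y : ℝ → EE N} (hy : IsTrajectory f β x y) {c τ C δ₁ ρ : ℝ} (hτ : 0 ≤ τ) (hC0 : 0 ≤ C)
    (hC : ∀ r ∈ Icc 0 τ, ‖y r - x‖ ≤ C * τ)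
    (hcost : ∀ r ∈ Icc 0 τ, ∀ a, |ℓ (y r) a - ℓ s a| ≤ δ₁)
    (hρ : ‖x - s‖ ≤ ρ) (hk : |c| * ‖x - s‖ ^ 2 ≤ 2 * δ₁)
    (hh : (L * |c| * C * ρ + |c| * C ^ 2 / 2) * τ ≤ δ₁) :
    |c / 2 * ‖y τ - s‖ ^ 2 + rc ℓ β y τ - c / 2 * ‖x - s‖ ^ 2 -
      ∫ r in (0:ℝ)..τ, ∫ a, (c * inner ℝ (f s a) (x - s) + ℓ s a) ∂(β r)|
      ≤ τ * (δ₁ * (2 + 2 * L)) := by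
  have hp := hβ.1
  have hL := h.hL
  let g : EE N → A → ℝ := fun z a => c * inner ℝ (f z a) (x - s) + ℓ z a
  have hg : Continuous fun q : EE N × A => g q.1 q.2 := by
    have h1 := h.hf
    have h2 := h.hℓ
    exact (continuous_const.mul (h1.inner continuous_const)).add h2
  have hyc := hy.2.1
  have e1 : (∫ r in (0:ℝ)..τ, ∫ a, g (y r) a ∂(β r)) =
      c * inner ℝ (y τ - x) (x - s) + rc ℓ β y τ := by
    have i1 : ∀ r, ∫ a, g (y r) a ∂(β r) =
        c * inner ℝ (x - s) (∫ a, f (y r) a ∂(β r)) + ∫ a, ℓ (y r) a ∂(β r) := by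
      intro r
      have hi := integrable_cont (h.cont_f (y r)) (β r)
      rw [← integral_inner hi, ← integral_const_mul, ← integral_add]
      · simp only [g, real_inner_comm]
      · exact (hi.const_inner _).const_mul c
      · exact integrable_cont (h.cont_l (y r)) (β r)
    have hfi := intInt h.hf hβ hyc 0 τ
    have i2 : inner ℝ (y τ - x) (x - s) =
        ∫ r in (0:ℝ)..τ, inner ℝ (x - s) (∫ a, f (y r) a ∂(β r)) := by
      have h3 := (innerSL ℝ (x - s)).intervalIntegral_comp_comm hfi
      simp only [innerSL_apply_apply] at h3
      rw [h3, hy.2.2 τ hτ, add_sub_cancel_left, real_inner_comm]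
    have hii : IntervalIntegrable (fun r => inner ℝ (x - s) (∫ a, f (y r) a ∂(β r)))
        volume 0 τ := by
      rw [intervalIntegrable_iff] at hfi ⊢
      exact Integrable.const_inner (𝕜 := ℝ) (x - s) hfi
    rw [i2]
    simp only [i1]
    rw [intervalIntegral.integral_add (hii.const_mul c) (intInt h.hℓ hβ hyc _ _),
      intervalIntegral.integral_const_mul]
    rfl
  have e2 : ‖y τ - s‖ ^ 2 = ‖x - s‖ ^ 2 + 2 * inner ℝ (y τ - x) (x - s) + ‖y τ - x‖ ^ 2 := by
    have : y τ - s = (y τ - x) + (x - s) := by abel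
    rw [this, norm_add_sq_real]
    ring
  have e3 : |(∫ r in (0:ℝ)..τ, ∫ a, g (y r) a ∂(β r)) - ∫ r in (0:ℝ)..τ, ∫ a, g s a ∂(β r)|
      ≤ (|c| * (L * (ρ + C * τ)) * ‖x - s‖ - |c| * L * (ρ - ‖x - s‖) * ‖x - s‖ + δ₁) * τ := by
    rw [← intervalIntegral.integral_sub (intInt hg hβ hyc _ _)
      (intInt hg hβ (continuous_const (y := s)) _ _)]
    have := intervalIntegral.norm_integral_le_of_norm_le_const
      (C := |c| * (L * (ρ + C * τ)) * ‖x - s‖ - |c| * L * (ρ - ‖x - s‖) * ‖x - s‖ + δ₁)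
      (a := 0) (b := τ)
      (f := fun r => (∫ a, g (y r) a ∂(β r)) - ∫ a, g s a ∂(β r)) ?_
    · rwa [sub_zero, abs_of_nonneg hτ] at this
    · intro r hr
      rw [uIoc_of_le hτ] at hr
      have hr' : r ∈ Icc 0 τ := ⟨hr.1.le, hr.2⟩
      have hgc : ∀ z, Continuous (g z) := fun z => hg.comp (Continuous.prodMk_right z)
      rw [← integral_sub (integrable_cont (hgc _) _) (integrable_cont (hgc _) _)]
      refine norm_int_le fun a => ?_
      have k1 : g (y r) a - g s a =
          c * inner ℝ (f (y r) a - f s a) (x - s) + (ℓ (y r) a - ℓ s a) := by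
        simp only [g, inner_sub_left]; ring
      rw [k1]
      refine (norm_add_le _ _).trans (add_le_add ?_ (hcost r hr' a))
      rw [norm_mul, Real.norm_eq_abs]
      have k2 := norm_inner_le_norm (𝕜 := ℝ) (f (y r) a - f s a) (x - s)
      have k3 := h.hfLip (y r) s a
      have k4 : ‖y r - s‖ ≤ C * τ + ‖x - s‖ := by
        have : y r - s = (y r - x) + (x - s) := by abel
        rw [this]
        exact (norm_add_le _ _).trans (add_le_add (hC r hr') le_rfl)
      calc |c| * ‖inner ℝ (f (y r) a - f s a) (x - s)‖
          ≤ |c| * ((L * (C * τ + ‖x - s‖)) * ‖x - s‖) := by gcongr; exact k2.trans (by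
              gcongr; exact k3.trans (by gcongr))
        _ = _ := by ring
  have e4 : ‖y τ - x‖ ^ 2 ≤ (C * τ) ^ 2 := by
    have := hC τ ⟨hτ, le_rfl⟩
    gcongr
  have e5 : c / 2 * ‖y τ - s‖ ^ 2 + rc ℓ β y τ - c / 2 * ‖x - s‖ ^ 2 -
      (∫ r in (0:ℝ)..τ, ∫ a, g s a ∂(β r)) = ((∫ r in (0:ℝ)..τ, ∫ a, g (y r) a ∂(β r)) -
        ∫ r in (0:ℝ)..τ, ∫ a, g s a ∂(β r)) + c / 2 * ‖y τ - x‖ ^ 2 := by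
    rw [e1, e2]; ring
  change |c / 2 * ‖y τ - s‖ ^ 2 + rc ℓ β y τ - c / 2 * ‖x - s‖ ^ 2 -
      (∫ r in (0:ℝ)..τ, ∫ a, g s a ∂(β r))| ≤ _
  rw [e5]
  refine (abs_add_le _ _).trans ?_
  have e6 : |c / 2 * ‖y τ - x‖ ^ 2| ≤ |c| / 2 * (C * τ) ^ 2 := by
    rw [abs_mul, abs_div, abs_of_nonneg (sq_nonneg ‖y τ - x‖), abs_of_pos (two_pos (α := ℝ))]
    gcongr
  have e7 : (|c| * (L * (ρ + C * τ)) * ‖x - s‖ - |c| * L * (ρ - ‖x - s‖) * ‖x - s‖ + δ₁) * τ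
      + |c| / 2 * (C * τ) ^ 2 ≤ τ * (L * (|c| * ‖x - s‖ ^ 2) + δ₁ +
        (L * |c| * C * ρ + |c| * C ^ 2 / 2) * τ) := by
    have : τ * τ * (|c| * L * C) * ‖x - s‖ ≤ τ * τ * (|c| * L * C) * ρ := by
      gcongr
    nlinarith
  have e8 : τ * (L * (|c| * ‖x - s‖ ^ 2) + δ₁ + (L * |c| * C * ρ + |c| * C ^ 2 / 2) * τ) ≤
      τ * (δ₁ * (2 + 2 * L)) := by
    refine mul_le_mul_of_nonneg_left ?_ hτ
    have := mul_le_mul_of_nonneg_left hk hL.le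
    linarith
  linarith

lemma Dyn.hjb_sub (h : Dyn f ℓ L) {s p : EE N} (hH : HJB f ℓ s p ≤ 0) (a : A) :
    0 ≤ inner ℝ (f s a) p + ℓ s a := by
  obtain ⟨C, hC0, hC⟩ := exists_bound h.hf ‖s‖
  have hbd : BddAbove (range fun m : ProbabilityMeasure A =>
      (-(inner (𝕜 := ℝ) (∫ a, f s a ∂(m : Measure A)) p : ℝ) - ∫ a, ℓ s a ∂(m : Measure A))) := by
    refine ⟨C * ‖p‖, ?_⟩
    rintro _ ⟨m, rfl⟩
    have h1 : ‖∫ a, f s a ∂(m : Measure A)‖ ≤ C := norm_int_le fun a => hC _ _ le_rfl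
    have h2 := abs_real_inner_le_norm (∫ a, f s a ∂(m : Measure A)) p
    have h3 := h.inner_nonneg s (m : Measure A)
    have h4 := mul_le_mul_of_nonneg_right h1 (norm_nonneg p)
    have h5 := neg_abs_le (inner ℝ (∫ a, f s a ∂(m : Measure A)) p)
    simp only
    linarith
  have := (le_ciSup hbd ⟨Measure.dirac a, inferInstance⟩).trans hH
  simp only [ProbabilityMeasure.coe_mk, integral_dirac] at this
  linarith

lemma Dyn.hjb_super [Nonempty A] (h : Dyn f ℓ L) {s p : EE N} (hH : 0 ≤ HJB f ℓ s p) {η : ℝ}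
    (hη : 0 < η) : ∃ a, inner ℝ (f s a) p + ℓ s a ≤ η := by
  by_contra hcon
  push Not at hcon
  have : HJB f ℓ s p ≤ -η := by
    haveI : Nonempty (ProbabilityMeasure A) :=
      ⟨⟨Measure.dirac (Classical.arbitrary A), inferInstance⟩⟩
    refine ciSup_le fun m => ?_
    have hi := integrable_cont (h.cont_f s) (m : Measure A)
    have hl := integrable_cont (h.cont_l s) (m : Measure A)
    have e : inner ℝ (∫ a, f s a ∂(m : Measure A)) p = ∫ a, inner ℝ p (f s a) ∂(m : Measure A) := by
      rw [integral_inner hi, real_inner_comm]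
    have h1 : ∫ _, η ∂(m : Measure A) ≤ ∫ a, (inner ℝ p (f s a) + ℓ s a) ∂(m : Measure A) := by
      refine integral_mono (integrable_const _) ((hi.const_inner p).add hl) fun a => ?_
      have := hcon a
      rw [real_inner_comm] at this
      exact this.le
    rw [integral_add (hi.const_inner p) hl] at h1
    simp at h1
    rw [e]
    linarith
  linarith

lemma quad_contDiff (c : ℝ) (x : EE N) (G : Set (EE N)) :
    ContDiffOn ℝ 1 (fun z => c / 2 * ‖z - x‖ ^ 2) G := by
  refine ContDiff.contDiffOn ?_
  exact contDiff_const.mul ((contDiff_id.sub contDiff_const).norm_sq ℝ)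

lemma quad_grad (c : ℝ) (x s : EE N) :
    gradient (fun z => c / 2 * ‖z - x‖ ^ 2) s = c • (s - x) := by
  apply HasGradientAt.gradient
  rw [hasGradientAt_iff_hasFDerivAt]
  have h1 : HasFDerivAt (fun z : EE N => z - x) (ContinuousLinearMap.id ℝ (EE N)) s :=
    (hasFDerivAt_id s).sub_const x
  have h2 := (h1.norm_sq).const_mul (c / 2)
  refine h2.congr_fderiv ?_
  refine ContinuousLinearMap.ext fun v => ?_
  simp
  ring

lemma unif_w {Ω K : Set (EE N)} (hΩ : IsOpen Ω) (hK : IsCompact K) (hKΩ : K ⊆ Ω) {w : EE N → ℝ}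
    (hw : ContinuousOn w Ω) {κ : ℝ} (hκ : 0 < κ) :
    ∃ ρ > 0, ∀ s ∈ K, ∀ x, ‖x - s‖ < ρ → x ∈ Ω ∧ |w x - w s| ≤ κ := by
  have hc := hK.uniformContinuousAt_of_continuousAt w
    (fun q hq => hw.continuousAt (hΩ.mem_nhds (hKΩ hq))) (Metric.dist_mem_uniformity hκ)
  obtain ⟨ρ, hρ, h⟩ := Metric.mem_uniformity_dist.1 hc
  obtain ⟨r, hr, hr'⟩ := hK.exists_thickening_subset_open hΩ hKΩ
  refine ⟨min ρ r, lt_min hρ hr, fun s hs x hx => ⟨hr' ?_, ?_⟩⟩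
  · rw [mem_thickening_iff]
    exact ⟨s, hs, by rw [dist_eq_norm]; exact hx.trans_le (min_le_right _ _)⟩
  · have := @h s x (by rw [dist_comm, dist_eq_norm]; exact hx.trans_le (min_le_left _ _)) hs
    simp only [mem_ofPred_eq] at this
    rw [dist_comm, Real.dist_eq] at this
    exact this.le

end step


section subopt
variable {N : ℕ} {A : Type*} [MetricSpace A] [CompactSpace A] [MeasurableSpace A] [BorelSpace A]
  {f : EE N → A → EE N} {ℓ : EE N → A → ℝ} {L : ℝ}

/-- Penalised maximisation. -/
lemma Dyn.max_facts (h : Dyn f ℓ L) {G : Set (EE N)} {w : EE N → ℝ}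
    (hw : ContinuousOn w G)
    (hsub : ∀ γ : EE N → ℝ, ContDiffOn ℝ 1 γ G → ∀ x₁ ∈ G,
      IsLocalMaxOn (fun x => w x - γ x) G x₁ → HJB f ℓ x₁ (gradient γ x₁) ≤ 0)
    {Cc : Set (EE N)} (hCc : IsCompact Cc) (hCG : Cc ⊆ G) {M δ ρ k : ℝ}
    (hM : ∀ z ∈ Cc, |w z| ≤ M) (hρ : 0 < ρ) (hk : 0 < k) (hkρ : 4 * M < k * ρ ^ 2)
    {x : EE N} (hx : ball x ρ ⊆ Cc) (hwx : ∀ z, ‖z - x‖ < ρ → |w z - w x| ≤ δ) :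
    ∃ s ∈ Cc, (∀ z ∈ Cc, w z - k / 2 * ‖z - x‖ ^ 2 ≤ w s - k / 2 * ‖s - x‖ ^ 2) ∧
      ‖x - s‖ < ρ ∧ k * ‖x - s‖ ^ 2 ≤ 2 * δ ∧ w s ≤ w x + δ ∧
      ∀ a, 0 ≤ (-k) * inner ℝ (f s a) (x - s) + ℓ s a := by
  have hxC : x ∈ Cc := hx (mem_ball_self hρ)
  obtain ⟨s, hs, hmax⟩ := hCc.exists_isMaxOn ⟨x, hxC⟩
    (f := fun z => w z - k / 2 * ‖z - x‖ ^ 2) ((hw.mono hCG).sub (by fun_prop))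
  have hmax' : ∀ z ∈ Cc, w z - k / 2 * ‖z - x‖ ^ 2 ≤ w s - k / 2 * ‖s - x‖ ^ 2 :=
    fun z hz => hmax hz
  have h1 := hmax' x hxC
  simp only [sub_self, norm_zero] at h1
  have h2 := abs_le.1 (hM x hxC)
  have h3 := abs_le.1 (hM s hs)
  have h4 : ‖s - x‖ < ρ := by
    by_contra hc
    push Not at hc
    have : ρ ^ 2 ≤ ‖s - x‖ ^ 2 := by gcongr
    nlinarith
  have h5 := abs_le.1 (hwx s h4)
  refine ⟨s, hs, hmax', by rwa [norm_sub_rev], by rw [norm_sub_rev]; linarith, by linarith, ?_⟩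
  have hloc : IsLocalMaxOn (fun z => w z - k / 2 * ‖z - x‖ ^ 2) G s := by
    have : Cc ∈ 𝓝 s := mem_of_superset (isOpen_ball.mem_nhds (by
      rw [mem_ball, dist_eq_norm]; exact h4)) hx
    exact mem_nhdsWithin_of_mem_nhds (mem_of_superset this hmax)
  have h6 := hsub _ (quad_contDiff k x G) s (hCG hs) hloc
  rw [quad_grad] at h6
  intro a
  have h7 := h.hjb_sub h6 a
  rw [inner_smul_right] at h7
  rw [← neg_sub s x, inner_neg_right]
  linarith

lemma Dyn.subopt (h : Dyn f ℓ L) {G : Set (EE N)} (hG : IsOpen G) {w : EE N → ℝ}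
    (hw : ContinuousOn w G)
    (hsub : ∀ γ : EE N → ℝ, ContDiffOn ℝ 1 γ G → ∀ x₁ ∈ G,
      IsLocalMaxOn (fun x => w x - γ x) G x₁ → HJB f ℓ x₁ (gradient γ x₁) ≤ 0)
    {β : ℝ → Measure A} (hβ : IsRelaxedControl β) {x : EE N} {y : ℝ → EE N}
    (hy : IsTrajectory f β x y) {t : ℝ} (ht : 0 ≤ t) (hyG : ∀ r ∈ Icc 0 t, y r ∈ G) :
    w x ≤ w (y t) + rc ℓ β y t := by
  have hyc := hy.2.1
  have hL := h.hL
  have hK : IsCompact (y '' Icc 0 t) := isCompact_Icc.image hyc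
  have hKG : y '' Icc 0 t ⊆ G := by
    rintro _ ⟨r, hr, rfl⟩
    exact hyG r hr
  obtain ⟨r, hr, hrG⟩ := hK.exists_cthickening_subset_open hG hKG
  set Cc := cthickening r (y '' Icc 0 t) with hCcdef
  have hCc : IsCompact Cc := hK.cthickening
  have hball : ∀ j ∈ Icc 0 t, ∀ z, ‖z - y j‖ < r → z ∈ Cc := by
    intro j hj z hz
    exact mem_cthickening_of_dist_le z (y j) r _ ⟨j, hj, rfl⟩ (by rw [dist_eq_norm]; exact hz.le)
  obtain ⟨M, hM⟩ := hCc.exists_bound_of_continuousOn (hw.mono hrG)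
  obtain ⟨_, C, hC0, -, hgr⟩ := h.growth ‖x‖ t ht
  have hgr' := fun t' ht' => (hgr x le_rfl β y hβ hy t' ht').2
  set E := 1 + t * (2 + 2 * L) with hE
  have hEpos : 0 < E := by positivity
  refine le_of_forall_pos_le_add fun ε hε => ?_
  set δ := ε / E with hδdef
  have hδ : 0 < δ := by positivity
  have hδE : δ * E = ε := by rw [hδdef]; field_simp
  obtain ⟨ρ1, hρ1, hu1⟩ := unif_cost h.hℓ hCc hδ
  obtain ⟨ρ2, hρ2, hu2⟩ := unif_w hG hK hKG hw hδ
  set ρ := min (min ρ1 ρ2) r / 2 with hρdef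
  have hmin : 0 < min (min ρ1 ρ2) r := lt_min (lt_min hρ1 hρ2) hr
  have hρ : 0 < ρ := by positivity
  have l1 : 2 * ρ ≤ ρ1 := by
    have := (min_le_left (min ρ1 ρ2) r).trans (min_le_left ρ1 ρ2); linarith
  have l2 : 2 * ρ ≤ ρ2 := by
    have := (min_le_left (min ρ1 ρ2) r).trans (min_le_right ρ1 ρ2); linarith
  have l3 : 2 * ρ ≤ r := by
    have := (min_le_right (min ρ1 ρ2) r); linarith
  have hM0 : 0 ≤ M := (norm_nonneg _).trans
    (hM (y 0) (hball 0 ⟨le_rfl, ht⟩ _ (by simpa using hr)))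
  set k := (4 * M + 1) / ρ ^ 2 with hkdef
  have hk : 0 < k := by positivity
  have hkρ : 4 * M < k * ρ ^ 2 := by
    have : k * ρ ^ 2 = 4 * M + 1 := by rw [hkdef]; field_simp
    linarith
  have facts := fun j (hj : j ∈ Icc 0 t) => h.max_facts hw hsub hCc hrG (x := y j) (δ := δ) hM hρ hk
    hkρ (fun z hz => hball j hj z (by rw [mem_ball, dist_eq_norm] at hz; linarith))
    (fun z hz => (hu2 (y j) ⟨j, hj, rfl⟩ z (by linarith)).2)
  set B := (L * |(-k)| * C * ρ + |(-k)| * C ^ 2 / 2) with hB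
  obtain ⟨n, hn⟩ := exists_nat_gt (max 1 (max (t * B / δ) (t * C / ρ)))
  have hn1 : (1:ℝ) < n := (le_max_left _ _).trans_lt hn
  have hn2 : t * B / δ < n := ((le_max_left _ _).trans (le_max_right _ _)).trans_lt hn
  have hn3 : t * C / ρ < n := ((le_max_right _ _).trans (le_max_right _ _)).trans_lt hn
  have hn0 : (0:ℝ) < n := by linarith
  set τ := t / n with hτdef
  have hτ : 0 ≤ τ := by positivity
  have hnτ : n * τ = t := by rw [hτdef]; field_simp
  have hBτ : B * τ ≤ δ := by
    rw [div_lt_iff₀ hδ] at hn2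
    rw [hτdef, mul_div_assoc', div_le_iff₀ hn0]
    linarith
  have hCτ : C * τ < ρ := by
    rw [div_lt_iff₀ hρ] at hn3
    rw [hτdef, mul_div_assoc', div_lt_iff₀ hn0]
    linarith
  have key : ∀ j : ℕ, j ≤ n → ∃ s ∈ Cc, w x ≤ w s - k / 2 * ‖s - y (j * τ)‖ ^ 2 +
      rc ℓ β y (j * τ) + j * τ * (δ * (2 + 2 * L)) := by
    intro j
    induction j with
    | zero =>
      intro _
      refine ⟨x, ?_, ?_⟩
      · rw [← hy.1]
        exact hball 0 ⟨le_rfl, ht⟩ _ (by simpa using hr)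
      · simp [hy.1, rc]
    | succ j ih =>
      intro hj
      obtain ⟨s0, hs0, hle⟩ := ih (by omega)
      have hj' : (j + 1 : ℝ) ≤ n := by exact_mod_cast hj
      have hjt : j * τ + τ ≤ t := by nlinarith
      have hj0 : 0 ≤ j * τ := by positivity
      have hjm : j * τ ∈ Icc 0 t := ⟨hj0, by linarith⟩
      obtain ⟨s, hs, hmax, hρs, hks, hws, ha⟩ := facts _ hjm
      refine ⟨s, hs, ?_⟩
      have hst := h.step (relaxed_shift hβ (j * τ)) (h.traj_shift hβ hy hj0) (s := s) (c := -k)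
        (τ := τ) (C := C) (δ₁ := δ) (ρ := ρ) hτ hC0 ?_ ?_ hρs.le ?_ hBτ
      · have hintg : 0 ≤ ∫ r in (0:ℝ)..τ, ∫ a, ((-k) * inner ℝ (f s a) (y (j * τ) - s) + ℓ s a)
            ∂(β (j * τ + r)) :=
          intervalIntegral.integral_nonneg hτ fun r _ => integral_nonneg fun a => ha a
        have hst' := (abs_le.1 hst).1
        have e1 : ((j + 1 : ℕ) : ℝ) * τ = j * τ + τ := by push_cast; ring
        rw [e1, h.rc_add hβ hyc, norm_sub_rev s]
        have h2 := hmax s0 hs0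
        rw [norm_sub_rev s] at h2
        have e2 : (j * τ + τ) * (δ * (2 + 2 * L)) =
          j * τ * (δ * (2 + 2 * L)) + τ * (δ * (2 + 2 * L)) := by ring
        rw [e2]
        have e3 : -k / 2 = -(k / 2) := by ring
        rw [e3] at hst'
        linarith
      · intro r hr
        have := hgr' (j * τ + r) ⟨by linarith [hr.1], by linarith [hr.2]⟩ (j * τ)
          ⟨hj0, by linarith [hr.1]⟩
        refine this.trans ?_
        have := hr.2
        gcongr
        linarith
      · intro r hr a
        refine hu1 s hs _ ?_ a
        have := hgr' (j * τ + r) ⟨by linarith [hr.1], by linarith [hr.2]⟩ (j * τ)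
          ⟨hj0, by linarith [hr.1]⟩
        have h3 : C * (j * τ + r - j * τ) ≤ C * τ := by
          have := hr.2
          gcongr
          linarith
        have h4 := norm_sub_le_norm_sub_add_norm_sub (y (j * τ + r)) (y (j * τ)) s
        linarith
      · rw [abs_neg, abs_of_pos hk]
        exact hks
  obtain ⟨s0, hs0, hle⟩ := key n le_rfl
  rw [hnτ] at hle
  obtain ⟨s, hs, hmax, hρs, hks, hws, ha⟩ := facts t ⟨ht, le_rfl⟩
  have h1 := hmax s0 hs0
  have h2 : 0 ≤ k / 2 * ‖s - y t‖ ^ 2 := by positivity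
  have h3 : ε = δ + t * (δ * (2 + 2 * L)) := by rw [← hδE, hE]; ring
  linarith

end subopt

section wle
variable {N : ℕ} {A : Type*} [MetricSpace A] [CompactSpace A] [MeasurableSpace A] [BorelSpace A]
  {f : EE N → A → EE N} {ℓ : EE N → A → ℝ} {L : ℝ}

lemma Dyn.w_le (h : Dyn f ℓ L) {T Ω : Set (EE N)} (hTcl : IsClosed T) (hΩ : IsOpen Ω)
    (hTΩ : T ⊆ Ω) {w : EE N → ℝ} (hw : ContinuousOn w Ω)
    (hsub : ∀ γ : EE N → ℝ, ContDiffOn ℝ 1 γ (Ω \ T) → ∀ x₁ ∈ Ω \ T,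
      IsLocalMaxOn (fun x => w x - γ x) (Ω \ T) x₁ → HJB f ℓ x₁ (gradient γ x₁) ≤ 0)
    (hwT : ∀ x ∈ T, w x = 0)
    (hblow : ∀ x₀ ∈ frontier Ω, Tendsto w (𝓝[Ω] x₀) atTop)
    {β : ℝ → Measure A} (hβ : IsRelaxedControl β) {x : EE N} (hx : x ∈ Ω) {y : ℝ → EE N}
    (hy : IsTrajectory f β x y) {τ : ℝ} (hτ : 0 ≤ τ) (hyT : y τ ∈ T)
    (hyn : ∀ r ∈ Ico 0 τ, y r ∉ T) : w x ≤ rc ℓ β y τ := by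
  have hyc := hy.2.1
  have claim : ∀ t₀ ∈ Icc 0 τ, (∀ r ∈ Icc t₀ τ, y r ∈ Ω) → w (y t₀) ≤ rc ℓ β y τ := by
    intro t₀ ht₀ hr
    rcases eq_or_lt_of_le ht₀.2 with e | hlt
    · rw [e, hwT _ hyT]
      exact h.rc_nonneg β y hτ
    have h1 : ∀ t' ∈ Ico t₀ τ, w (y t₀) ≤ w (y t') + rc ℓ β y τ := by
      intro t' ht'
      have hs := h.subopt (hΩ.sdiff hTcl) (hw.mono diff_subset) hsub (relaxed_shift hβ t₀)
        (h.traj_shift hβ hy ht₀.1) (t := t' - t₀) (by linarith [ht'.1]) (fun r hr' =>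
          ⟨hr _ ⟨by linarith [hr'.1], by linarith [hr'.2, ht'.2]⟩,
            hyn _ ⟨by linarith [hr'.1, ht₀.1], by linarith [hr'.2, ht'.2]⟩⟩)
      have e := h.rc_add hβ hyc t₀ (t' - t₀)
      rw [add_sub_cancel] at e
      rw [add_sub_cancel] at hs
      have h2 := h.rc_mono hβ hyc ht'.2.le
      have h3 := h.rc_nonneg β y ht₀.1
      linarith
    have hcont : Tendsto (fun t' => w (y t') + rc ℓ β y τ) (𝓝[<] τ) (𝓝 (w (y τ) + rc ℓ β y τ)) := by
      have : ContinuousAt w (y τ) := hw.continuousAt (hΩ.mem_nhds (hTΩ hyT))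
      have h4 : Tendsto (fun t' => w (y t')) (𝓝 τ) (𝓝 (w (y τ))) :=
        Tendsto.comp this hyc.continuousAt
      exact (h4.mono_left nhdsWithin_le_nhds).add tendsto_const_nhds
    rw [hwT _ hyT, zero_add] at hcont
    refine ge_of_tendsto hcont ?_
    filter_upwards [Ico_mem_nhdsLT hlt] with t' ht' using h1 t' ht'
  by_cases hB : ∃ r ∈ Icc 0 τ, y r ∉ Ω
  · exfalso
    have hc : IsCompact (Icc 0 τ ∩ y ⁻¹' Ωᶜ) :=
      isCompact_Icc.inter_right (hΩ.isClosed_compl.preimage hyc)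
    obtain ⟨r, hr, hr'⟩ := hB
    obtain ⟨σ, hσ, hσmax⟩ := hc.exists_isGreatest ⟨r, hr, hr'⟩
    have hστ : σ < τ := lt_of_le_of_ne hσ.1.2 (by
      rintro rfl
      exact hσ.2 (hTΩ hyT))
    have hin : ∀ r ∈ Ioc σ τ, y r ∈ Ω := by
      intro r hr
      by_contra hc
      exact absurd (hσmax ⟨⟨hσ.1.1.trans hr.1.le, hr.2⟩, hc⟩) (not_le.2 hr.1)
    have ht : Tendsto y (𝓝[>] σ) (𝓝[Ω] (y σ)) := by
      refine tendsto_nhdsWithin_iff.2 ⟨hyc.continuousAt.mono_left nhdsWithin_le_nhds, ?_⟩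
      filter_upwards [Ioc_mem_nhdsGT hστ] with r hr using hin r hr
    have hfr : y σ ∈ frontier Ω := by
      rw [hΩ.frontier_eq]
      refine ⟨?_, hσ.2⟩
      rw [mem_closure_iff_nhdsWithin_neBot]
      exact ht.neBot
    have h1 := ((hblow _ hfr).comp ht).eventually_gt_atTop (rc ℓ β y τ)
    obtain ⟨r, h2, h3⟩ := (h1.and (Ioc_mem_nhdsGT hστ)).exists
    have := claim r ⟨hσ.1.1.trans h3.1.le, h3.2⟩ fun q hq =>
      hin q ⟨h3.1.trans_le hq.1, hq.2⟩
    simp only [Function.comp] at h2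
    linarith
  · push Not at hB
    have := claim 0 ⟨le_rfl, hτ⟩ hB
    rwa [hy.1] at this

lemma Dyn.w_le_value {Y : EE N → (ℝ → Measure A) → ℝ → EE N} (h : Dyn f ℓ L)
    (hY : ∀ x β, IsRelaxedControl β → IsTrajectory f β x (Y x β))
    {T Ω : Set (EE N)} (hTcl : IsClosed T) (hΩ : IsOpen Ω)
    (hTΩ : T ⊆ Ω) {w : EE N → ℝ} (hw : ContinuousOn w Ω)
    (hsub : ∀ γ : EE N → ℝ, ContDiffOn ℝ 1 γ (Ω \ T) → ∀ x₁ ∈ Ω \ T,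
      IsLocalMaxOn (fun x => w x - γ x) (Ω \ T) x₁ → HJB f ℓ x₁ (gradient γ x₁) ≤ 0)
    (hwT : ∀ x ∈ T, w x = 0)
    (hblow : ∀ x₀ ∈ frontier Ω, Tendsto w (𝓝[Ω] x₀) atTop) {x : EE N} (hx : x ∈ Ω) :
    (w x : EReal) ≤ valueFn T ℓ Y x := by
  refine le_sInf ?_
  rintro _ ⟨β, hβ, hne, rfl⟩
  have hy := hY x β hβ
  have hcl : IsClosed (exitTimes T (Y x β)) :=
    isClosed_Ici.inter (hTcl.preimage hy.2.1)
  have hbd : BddBelow (exitTimes T (Y x β)) := ⟨0, fun s hs => hs.1⟩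
  have hm := hcl.csInf_mem hne hbd
  have := h.w_le hTcl hΩ hTΩ hw hsub hwT hblow hβ hx hy hm.1 hm.2 (fun r hr hrT =>
    absurd (csInf_le hbd (show r ∈ exitTimes T (Y x β) from ⟨hr.1, hrT⟩)) (not_le.2 hr.2))
  rw [h.runCost_eq hβ hy.2.1 hm.1, EReal.coe_ennreal_ofReal, max_eq_left (h.rc_nonneg _ _ hm.1)]
  exact_mod_cast this

end wle

section superopt
variable {N : ℕ} {A : Type*} [MetricSpace A] [CompactSpace A] [MeasurableSpace A] [BorelSpace A]
  {f : EE N → A → EE N} {ℓ : EE N → A → ℝ} {L : ℝ} {Y : EE N → (ℝ → Measure A) → ℝ → EE N}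

lemma Dyn.stc (h : Dyn f ℓ L) (hY : ∀ x β, IsRelaxedControl β → IsTrajectory f β x (Y x β))
    {T : Set (EE N)} (hSTC : ∀ ε > (0:ℝ), T ⊆ interior {x | ∃ t, 0 ≤ t ∧ t < ε ∧
        ∃ β, IsRelaxedControl β ∧ Y x β t ∈ T}) {δ : ℝ} (hδ : 0 < δ) :
    T ⊆ interior {x | Near T ℓ Y x δ} := by
  intro z hz
  obtain ⟨R', _, -, -, hgr⟩ := h.growth (‖z‖ + 1) 1 zero_le_one
  obtain ⟨C, hC0, hC⟩ := exists_bound h.hℓ R'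
  have hε : 0 < min 1 (δ / (C + 1)) := by positivity
  refine mem_interior.2 ⟨interior {x | ∃ t, 0 ≤ t ∧ t < min 1 (δ / (C + 1)) ∧
        ∃ β, IsRelaxedControl β ∧ Y x β t ∈ T} ∩ ball z 1, ?_, isOpen_interior.inter isOpen_ball,
        hSTC _ hε hz, mem_ball_self one_pos⟩
  rintro x ⟨hx1, hx2⟩
  obtain ⟨t, ht0, ht1, β, hβ, hT⟩ := interior_subset hx1
  have hp := hβ.1
  rw [mem_ball, dist_eq_norm] at hx2
  have hxn : ‖x‖ ≤ ‖z‖ + 1 := by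
    have := norm_le_norm_add_norm_sub' x z
    linarith
  refine ⟨t, _, hT, ht0, β, hβ, rfl, ?_⟩
  have hb : ∀ s ∈ uIoc 0 t, ‖∫ a, ℓ (Y x β s) a ∂(β s)‖ ≤ C := by
    intro s hs
    rw [uIoc_of_le ht0] at hs
    have := (hgr x hxn β _ hβ (hY x β hβ) s ⟨hs.1.le,
      hs.2.trans (ht1.le.trans (min_le_left _ _))⟩).1
    exact norm_int_le fun a => hC _ a this
  have h1 := intervalIntegral.norm_integral_le_of_norm_le_const hb
  rw [sub_zero, abs_of_nonneg ht0] at h1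
  have h2 : t ≤ δ / (C + 1) := ht1.le.trans (min_le_right _ _)
  rw [le_div_iff₀ (by positivity)] at h2
  have h3 := le_abs_self (rc ℓ β (Y x β) t)
  rw [← Real.norm_eq_abs] at h3
  refine h3.trans (h1.trans ?_)
  linarith

lemma closed_sub {Ω : Set (EE N)} (hΩ : IsOpen Ω) {w : EE N → ℝ} (hw : ContinuousOn w Ω)
    (hblow : ∀ x₀ ∈ frontier Ω, Tendsto w (𝓝[Ω] x₀) atTop) (M : ℝ) :
    IsClosed {z | z ∈ Ω ∧ w z ≤ M} := by
  refine isClosed_of_closure_subset fun z hz => ?_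
  have hne := mem_closure_iff_nhdsWithin_neBot.1 hz
  have hsub : {z | z ∈ Ω ∧ w z ≤ M} ⊆ Ω := fun z hz => hz.1
  by_cases hzΩ : z ∈ Ω
  · refine ⟨hzΩ, ?_⟩
    have h1 : Tendsto w (𝓝[{z | z ∈ Ω ∧ w z ≤ M}] z) (𝓝 (w z)) := (hw z hzΩ).mono hsub
    refine le_of_tendsto h1 ?_
    filter_upwards [self_mem_nhdsWithin] with q hq using hq.2
  · exfalso
    have hfr : z ∈ frontier Ω := by
      rw [hΩ.frontier_eq]
      exact ⟨closure_mono hsub hz, hzΩ⟩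
    have h1 := ((hblow z hfr).mono_left (nhdsWithin_mono z hsub)).eventually_gt_atTop M
    obtain ⟨q, hq1, hq2⟩ := (h1.and self_mem_nhdsWithin).exists
    exact absurd hq2.2 (not_le.2 hq1)

lemma Dyn.min_facts [Nonempty A] (h : Dyn f ℓ L) {T Ω : Set (EE N)} (hTcl : IsClosed T)
    (hΩ : IsOpen Ω) {w : EE N → ℝ} (hw : ContinuousOn w Ω)
    (hsup : ∀ γ : EE N → ℝ, ContDiffOn ℝ 1 γ (Ω \ T) → ∀ x₁ ∈ Ω \ T,
      IsLocalMinOn (fun x => w x - γ x) (Ω \ T) x₁ → 0 ≤ HJB f ℓ x₁ (gradient γ x₁))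
    {m M R U δ ρ k : ℝ} (hm : ∀ z ∈ Ω, m ≤ w z)
    (hK : IsCompact ({z | z ∈ Ω ∧ w z ≤ M} ∩ closedBall 0 R)) (hδ : 0 < δ) (hρ : 0 < ρ)
    (hk : 0 < k) (hUm : U - m < k / 2 * ρ ^ 2) (hUM : U + δ ≤ M)
    (hu : ∀ s ∈ ({z | z ∈ Ω ∧ w z ≤ M} ∩ closedBall 0 R), ∀ z, ‖z - s‖ < ρ →
      z ∈ Ω ∧ |w z - w s| ≤ δ)
    {q s₀ : EE N} (hq : ‖q‖ + ρ < R) (hs₀ : s₀ ∈ ({z | z ∈ Ω ∧ w z ≤ M} ∩ closedBall 0 R))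
    (hsU : w s₀ + k / 2 * ‖s₀ - q‖ ^ 2 ≤ U) :
    ∃ s ∈ ({z | z ∈ Ω ∧ w z ≤ M} ∩ closedBall 0 R),
      w s + k / 2 * ‖s - q‖ ^ 2 ≤ w s₀ + k / 2 * ‖s₀ - q‖ ^ 2 ∧
      ‖q - s‖ < ρ ∧ k * ‖q - s‖ ^ 2 ≤ 2 * δ ∧ q ∈ Ω ∧ w q ≤ w s + δ ∧
      (s ∉ T → ∃ a, k * inner ℝ (f s a) (q - s) + ℓ s a ≤ δ) := by
  obtain ⟨s, hs, hmin⟩ := hK.exists_isMinOn ⟨s₀, hs₀⟩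
    (f := fun z => w z + k / 2 * ‖z - q‖ ^ 2) ((hw.mono fun z hz => hz.1.1).add (by fun_prop))
  have hmin' : ∀ z ∈ ({z | z ∈ Ω ∧ w z ≤ M} ∩ closedBall 0 R),
      w s + k / 2 * ‖s - q‖ ^ 2 ≤ w z + k / 2 * ‖z - q‖ ^ 2 := fun z hz => hmin hz
  have h1 := hmin' s₀ hs₀
  have h2 := hm s hs.1.1
  have h4 : ‖s - q‖ < ρ := by
    by_contra hc
    push Not at hc
    have : ρ ^ 2 ≤ ‖s - q‖ ^ 2 := by gcongr
    nlinarith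
  have h0 : 0 ≤ k / 2 * ‖s - q‖ ^ 2 := by positivity
  have h4' : ‖q - s‖ < ρ := by rwa [norm_sub_rev]
  obtain ⟨hqΩ, h5⟩ := hu s hs q h4'
  have h5 := abs_le.1 h5
  have hqK : q ∈ ({z | z ∈ Ω ∧ w z ≤ M} ∩ closedBall 0 R) := by
    refine ⟨⟨hqΩ, by linarith⟩, ?_⟩
    rw [mem_closedBall_zero_iff]; linarith
  have h6 := hmin' q hqK
  simp only [sub_self, norm_zero] at h6
  refine ⟨s, hs, h1, h4', by rw [norm_sub_rev]; linarith, hqΩ, by linarith, fun hsT => ?_⟩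
  have hloc : IsLocalMinOn (fun z => w z - (-k) / 2 * ‖z - q‖ ^ 2) (Ω \ T) s := by
    have n1 : ∀ᶠ z in 𝓝 s, w z < M :=
      (hw.continuousAt (hΩ.mem_nhds hs.1.1)).eventually_lt continuousAt_const (by linarith)
    have n2 : ∀ᶠ z in 𝓝 s, ‖z‖ < R :=
      (continuous_norm.continuousAt).eventually_lt continuousAt_const (by
        have := norm_le_norm_add_norm_sub' s q
        linarith)
    have n3 : ∀ᶠ z in 𝓝 s, z ∈ Ω := hΩ.mem_nhds hs.1.1
    refine mem_nhdsWithin_of_mem_nhds ?_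
    filter_upwards [n1, n2, n3] with z z1 z2 z3
    have := hmin' z ⟨⟨z3, z1.le⟩, by rw [mem_closedBall_zero_iff]; exact z2.le⟩
    have e : -k / 2 = -(k / 2) := by ring
    simp only [mem_ofPred_eq, e]
    linarith
  have h7 := hsup _ (quad_contDiff (-k) q _) s ⟨hs.1.1, hsT⟩ hloc
  rw [quad_grad] at h7
  obtain ⟨a, ha⟩ := h.hjb_super h7 hδ
  refine ⟨a, ?_⟩
  rw [inner_smul_right] at ha
  rw [← neg_sub s q, inner_neg_right]
  linarith

set_option maxHeartbeats 1000000 in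
lemma Dyn.super_unit [Nonempty A] (h : Dyn f ℓ L)
    (hY : ∀ x β, IsRelaxedControl β → IsTrajectory f β x (Y x β))
    {T Ω : Set (EE N)} (hTcl : IsClosed T)
    (hSTC : ∀ ε > (0:ℝ), T ⊆ interior {x | ∃ t, 0 ≤ t ∧ t < ε ∧
        ∃ β, IsRelaxedControl β ∧ Y x β t ∈ T})
    (hΩ : IsOpen Ω) {w : EE N → ℝ} (hw : ContinuousOn w Ω)
    (hsup : ∀ γ : EE N → ℝ, ContDiffOn ℝ 1 γ (Ω \ T) → ∀ x₁ ∈ Ω \ T,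
      IsLocalMinOn (fun x => w x - γ x) (Ω \ T) x₁ → 0 ≤ HJB f ℓ x₁ (gradient γ x₁))
    {m : ℝ} (hm : ∀ z ∈ Ω, m ≤ w z) (hwT : ∀ x ∈ T, w x = 0)
    (hblow : ∀ x₀ ∈ frontier Ω, Tendsto w (𝓝[Ω] x₀) atTop) {x₀ : EE N} (hx₀ : x₀ ∈ Ω)
    {δ : ℝ} (hδ : 0 < δ) :
    Near T ℓ Y x₀ (w x₀ + δ) ∨ ∃ y ∈ Ω, ∃ c, Reach ℓ Y x₀ 1 c y ∧ w y + c ≤ w x₀ + δ := by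
  have hL := h.hL
  obtain ⟨R', _, -, hR', hgr⟩ := h.growth ‖x₀‖ 1 zero_le_one
  obtain ⟨_, C, hC0, -, hgr2⟩ := h.growth R' 1 zero_le_one
  set K := {z | z ∈ Ω ∧ w z ≤ w x₀ + δ + 1} ∩ closedBall (0 : EE N) (R' + 1) with hKdef
  have hK : IsCompact K :=
    (isCompact_closedBall _ _).inter_left (closed_sub hΩ hw hblow _)
  have hKΩ : K ⊆ Ω := fun z hz => hz.1.1
  set δ1 := min 1 (δ / (4 + 2 * L)) with hδ1def
  have hδ1 : 0 < δ1 := by positivity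
  have hδ1a : δ1 ≤ 1 := min_le_left _ _
  have hδ1b : δ1 * (4 + 2 * L) ≤ δ := by
    have : δ1 ≤ δ / (4 + 2 * L) := min_le_right _ _
    rwa [le_div_iff₀ (by positivity)] at this
  obtain ⟨ρ1, hρ1, hu1⟩ := unif_cost h.hℓ hK hδ1
  obtain ⟨ρ2, hρ2, hu2⟩ := unif_w hΩ hK hKΩ hw hδ1
  have hTK : IsCompact (T ∩ closedBall 0 (R' + 1)) := (isCompact_closedBall _ _).inter_left hTcl
  obtain ⟨ρ3, hρ3, hu3⟩ := hTK.exists_thickening_subset_open isOpen_interior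
    (inter_subset_left.trans (h.stc hY hSTC hδ1))
  set ρ := min (min ρ1 ρ2) (min ρ3 1) / 2 with hρdef
  have hmin : 0 < min (min ρ1 ρ2) (min ρ3 1) := lt_min (lt_min hρ1 hρ2) (lt_min hρ3 one_pos)
  have hρ : 0 < ρ := by positivity
  have l1 : 2 * ρ ≤ ρ1 := by
    have := (min_le_left (min ρ1 ρ2) (min ρ3 1)).trans (min_le_left ρ1 ρ2); linarith
  have l2 : 2 * ρ ≤ ρ2 := by
    have := (min_le_left (min ρ1 ρ2) (min ρ3 1)).trans (min_le_right ρ1 ρ2); linarith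
  have l3 : 2 * ρ ≤ ρ3 := by
    have := (min_le_right (min ρ1 ρ2) (min ρ3 1)).trans (min_le_left _ _); linarith
  have l4 : 2 * ρ ≤ 1 := by
    have := (min_le_right (min ρ1 ρ2) (min ρ3 1)).trans (min_le_right _ _); linarith
  set D := w x₀ + δ - m with hD
  have hD0 : 0 < D := by have := hm x₀ hx₀; linarith
  set k := 2 * (D + 1) / ρ ^ 2 with hkdef
  have hk : 0 < k := by positivity
  have hkρ : k / 2 * ρ ^ 2 = D + 1 := by rw [hkdef]; field_simp
  have facts : ∀ q s₀ : EE N, ‖q‖ ≤ R' → s₀ ∈ K → w s₀ + k / 2 * ‖s₀ - q‖ ^ 2 ≤ w x₀ + δ → _ :=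
    fun q s₀ hq hs₀ hsU => h.min_facts hTcl hΩ hw hsup (U := w x₀ + δ) (ρ := ρ) (k := k) hm hK
      hδ1 hρ hk (by linarith) (by linarith) (fun s hs z hz => hu2 s hs z (by linarith))
      (by linarith) hs₀ hsU
  set B := (L * |k| * C * ρ + |k| * C ^ 2 / 2) with hB
  obtain ⟨n, hn⟩ := exists_nat_gt (max 1 (max (B / δ1) (C / ρ)))
  have hn1 : (1:ℝ) < n := (le_max_left _ _).trans_lt hn
  have hn2 : B / δ1 < n := ((le_max_left _ _).trans (le_max_right _ _)).trans_lt hn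
  have hn3 : C / ρ < n := ((le_max_right _ _).trans (le_max_right _ _)).trans_lt hn
  have hn0 : (0:ℝ) < n := by linarith
  set τ := 1 / (n : ℝ) with hτdef
  have hτ : 0 ≤ τ := by positivity
  have hnτ : n * τ = 1 := by rw [hτdef]; field_simp
  have hτ1 : τ ≤ 1 := by rw [hτdef, div_le_one hn0]; exact hn1.le
  have hBτ : B * τ ≤ δ1 := by
    rw [div_lt_iff₀ hδ1] at hn2
    rw [hτdef, mul_div_assoc', div_le_iff₀ hn0]
    linarith
  have hCτ : C * τ < ρ := by
    rw [div_lt_iff₀ hρ] at hn3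
    rw [hτdef, mul_div_assoc', div_lt_iff₀ hn0]
    linarith
  have hreach : ∀ t c q, t ≤ 1 → Reach ℓ Y x₀ t c q → ‖q‖ ≤ R' ∧ 0 ≤ c := by
    rintro t c q ht ⟨ht0, β, hβ, rfl, hc⟩
    exact ⟨(hgr x₀ le_rfl β _ hβ (hY _ _ hβ) t ⟨ht0, ht⟩).1, (h.rc_nonneg _ _ ht0).trans hc⟩
  set E := δ1 * (3 + 2 * L) with hEdef
  have hE0 : 0 < E := by positivity
  have hEδ : E + δ1 ≤ δ := by rw [hEdef]; linarith
  have key : ∀ j : ℕ, j ≤ n → Near T ℓ Y x₀ (w x₀ + δ) ∨ ∃ q c s, Reach ℓ Y x₀ (j * τ) c q ∧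
      s ∈ K ∧ w s + k / 2 * ‖s - q‖ ^ 2 + c ≤ w x₀ + j * τ * E := by
    intro j
    induction j with
    | zero =>
      intro _
      refine Or.inr ⟨x₀, 0, x₀, ?_, ⟨⟨hx₀, by linarith⟩, ?_⟩, by simp⟩
      · simpa using reach_zero_s10 (f := f) (ℓ := ℓ) hY x₀
      · rw [mem_closedBall_zero_iff]; linarith
    | succ j ih =>
      intro hj
      rcases ih (by omega) with hN | ⟨q, c, s₀, hqr, hs₀, hle⟩
      · exact Or.inl hN
      have hj' : (j + 1 : ℝ) ≤ n := by exact_mod_cast hj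
      have hjt : j * τ + τ ≤ 1 := by
        have h1 : (j + 1 : ℝ) * τ ≤ n * τ := mul_le_mul_of_nonneg_right hj' hτ
        linarith only [h1, hnτ]
      obtain ⟨hqR, hc0⟩ := hreach _ _ _ (by linarith) hqr
      have hjE : j * τ * E ≤ E := by
        have : j * τ ≤ 1 := by linarith only [hjt, hτ]
        exact mul_le_of_le_one_left hE0.le this
      obtain ⟨s, hs, hss, hqs, hks, hqΩ, hwq, hsT⟩ := facts q s₀ hqR hs₀ (by linarith)
      by_cases hsT' : s ∈ T
      · left
        have hNq : Near T ℓ Y q δ1 := by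
          have h1 : q ∈ thickening ρ3 (T ∩ closedBall 0 (R' + 1)) := by
            rw [mem_thickening_iff]
            exact ⟨s, ⟨hsT', hs.2⟩, by rw [dist_eq_norm]; linarith⟩
          have h2 : q ∈ {x | Near T ℓ Y x δ1} := interior_subset (hu3 h1)
          exact h2
        refine (h.near_of_reach hY hqr hNq).mono ?_
        have h1 := hwT s hsT'
        have h0 : 0 ≤ k / 2 * ‖s - q‖ ^ 2 := by positivity
        linarith
      · right
        obtain ⟨a, ha⟩ := hsT hsT'
        have hβ : IsRelaxedControl (fun _ : ℝ => Measure.dirac a) :=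
          ⟨fun _ => inferInstance, fun g => measurable_const⟩
        have hy := hY q _ hβ
        have hspeed : ∀ r ∈ Icc 0 τ, ‖Y q (fun _ => Measure.dirac a) r - q‖ ≤ C * τ := by
          intro r hr
          have := (hgr2 q hqR _ _ hβ hy r ⟨hr.1, hr.2.trans hτ1⟩).2 0 ⟨le_rfl, hr.1⟩
          rw [hy.1] at this
          refine this.trans ?_
          have := hr.2
          gcongr
          linarith
        have hst := h.step hβ hy (s := s) (c := k) (τ := τ) (C := C) (δ₁ := δ1) (ρ := ρ) hτ hC0
          hspeed (fun r hr a' => hu1 s hs _ (by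
            have h3 := hspeed r hr
            have h4 := norm_sub_le_norm_sub_add_norm_sub (Y q (fun _ => Measure.dirac a) r) q s
            linarith) a') hqs.le (by rw [abs_of_pos hk]; exact hks) hBτ
        have hst' := (abs_le.1 hst).2
        simp only [integral_dirac, intervalIntegral.integral_const, sub_zero, smul_eq_mul] at hst'
        have h5 : τ * (k * inner ℝ (f s a) (q - s) + ℓ s a) ≤ τ * δ1 := by gcongr
        have e1 : ((j + 1 : ℕ) : ℝ) * τ = j * τ + τ := by push_cast; ring
        refine ⟨_, _, s, by
          rw [e1]
          exact h.reach_trans hY hqr ⟨hτ, _, hβ, rfl, le_rfl⟩, hs, ?_⟩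
        rw [e1]
        rw [norm_sub_rev s] at hss ⊢
        have e2 : (j * τ + τ) * E = j * τ * E + τ * (δ1 * (2 + 2 * L)) + τ * δ1 := by
          rw [hEdef]; ring
        rw [e2]
        linarith
  rcases key n le_rfl with hN | ⟨q, c, s₀, hqr, hs₀, hle⟩
  · exact Or.inl hN
  rw [hnτ] at hqr hle
  obtain ⟨hqR, hc0⟩ := hreach _ _ _ le_rfl hqr
  obtain ⟨s, hs, hss, hqs, hks, hqΩ, hwq, hsT⟩ := facts q s₀ hqR hs₀ (by linarith)
  refine Or.inr ⟨q, hqΩ, c, hqr, ?_⟩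
  have h0 : 0 ≤ k / 2 * ‖s - q‖ ^ 2 := by positivity
  linarith

end superopt

section nearall
variable {N : ℕ} {A : Type*} [MetricSpace A] [CompactSpace A] [MeasurableSpace A] [BorelSpace A]
  {f : EE N → A → EE N} {ℓ : EE N → A → ℝ} {L : ℝ} {Y : EE N → (ℝ → Measure A) → ℝ → EE N}

lemma Dyn.lint_le (h : Dyn f ℓ L) {β : ℝ → Measure A} (hβ : IsRelaxedControl β)
    {y : ℝ → EE N} (hyc : Continuous y) {D : ℝ} (hD : ∀ n : ℕ, rc ℓ β y n ≤ D) :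
    (∫⁻ s in Ioi (0:ℝ), ENNReal.ofReal (∫ a, ℓ (y s) a ∂(β s))) ≤ ENNReal.ofReal D := by
  have e : Ioi (0:ℝ) = ⋃ n : ℕ, Ioc (0:ℝ) n := by
    ext s
    simp only [mem_Ioi, mem_iUnion, mem_Ioc]
    exact ⟨fun hs => ⟨⌈s⌉₊, hs, Nat.le_ceil s⟩, fun ⟨n, hs, _⟩ => hs⟩
  rw [e, setLIntegral_iUnion_of_directed]
  · refine iSup_le fun n => ?_
    have := h.runCost_eq hβ hyc (t := n) (by positivity)
    unfold runCost at this
    rw [this]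
    exact ENNReal.ofReal_le_ofReal (hD n)
  · refine Monotone.directed_le fun i j hij => ?_
    exact Ioc_subset_Ioc_right (by exact_mod_cast hij)

lemma Dyn.near_all [Nonempty A] (h : Dyn f ℓ L)
    (hY : ∀ x β, IsRelaxedControl β → IsTrajectory f β x (Y x β))
    {T Ω : Set (EE N)} (hTcl : IsClosed T)
    (hSTC : ∀ ε > (0:ℝ), T ⊆ interior {x | ∃ t, 0 ≤ t ∧ t < ε ∧
        ∃ β, IsRelaxedControl β ∧ Y x β t ∈ T})
    (hH5' : ∀ x ∈ {x | ∃ β, IsRelaxedControl β ∧ (exitTimes T (Y x β)).Nonempty} \ T,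
        ∀ β, IsRelaxedControl β → ∀ t > (0:ℝ), 0 < runCost ℓ β (Y x β) t)
    (hH6 : ∀ x β, IsRelaxedControl β →
        (∀ M : ℝ, ∀ t : ℝ, ∃ s, t ≤ s ∧ M < ‖Y x β s‖) →
        (∫⁻ s in Ioi (0:ℝ), ENNReal.ofReal (∫ a, ℓ (Y x β s) a ∂(β s))) = ⊤)
    (hΩ : IsOpen Ω)
    (hΩR : Ω ⊆ {x | ∃ β, IsRelaxedControl β ∧ (exitTimes T (Y x β)).Nonempty})
    {w : EE N → ℝ} (hw : ContinuousOn w Ω)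
    (hsup : ∀ γ : EE N → ℝ, ContDiffOn ℝ 1 γ (Ω \ T) → ∀ x₁ ∈ Ω \ T,
      IsLocalMinOn (fun x => w x - γ x) (Ω \ T) x₁ → 0 ≤ HJB f ℓ x₁ (gradient γ x₁))
    {m : ℝ} (hm : ∀ z ∈ Ω, m ≤ w z) (hwT : ∀ x ∈ T, w x = 0)
    (hblow : ∀ x₀ ∈ frontier Ω, Tendsto w (𝓝[Ω] x₀) atTop) {x : EE N} (hx : x ∈ Ω)
    {δ : ℝ} (hδ : 0 < δ) : Near T ℓ Y x (w x + δ) := by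
  by_contra hno
  set S : ℕ → ℝ := fun n => δ / 2 * (1 - (1 / 2) ^ n) with hS
  set d : ℕ → ℝ := fun n => δ / 4 * (1 / 2) ^ n with hd
  have hd0 : ∀ n, 0 < d n := fun n => by positivity
  have hSd : ∀ n, S (n + 1) = S n + d n := fun n => by simp only [hS, hd, pow_succ]; ring
  have hSle : ∀ n, S n ≤ δ / 2 := fun n => by
    have : (0:ℝ) < (1 / 2) ^ n := by positivity
    simp only [hS]; nlinarith
  let P : ℕ → EE N → Prop := fun n p =>
    p ∈ Ω ∧ ∃ c, Reach ℓ Y x n c p ∧ w p + c ≤ w x + S n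
  have hstep : ∀ n p, P n p → ∃ (b : ℝ → Measure A) (p' : EE N), IsRelaxedControl b ∧
      Y p b 1 = p' ∧ w p' + rc ℓ b (Y p b) 1 ≤ w p + d n ∧ P (n + 1) p' := by
    rintro n p ⟨hp, c, hr, hc⟩
    rcases h.super_unit hY hTcl hSTC hΩ hw hsup hm hwT hblow hp (hd0 n) with hN | ⟨p', hp', c', hr', hc'⟩
    · refine absurd ((h.near_of_reach hY hr hN).mono ?_) hno
      have h1 := hSle (n + 1)
      rw [hSd] at h1
      linarith
    · obtain ⟨_, b, hb, hbe, hbc⟩ := id hr'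
      refine ⟨b, p', hb, hbe, by linarith, hp', c + c', ?_, ?_⟩
      · have := h.reach_trans hY hr hr'
        exact_mod_cast this
      · rw [hSd]; linarith
  choose! b p' hb hbe hbc hP using hstep
  let X : ℕ → EE N := fun n => Nat.rec x (fun n p => p' n p) n
  have hX0 : X 0 = x := rfl
  have hXs : ∀ n, X (n + 1) = p' n (X n) := fun n => rfl
  have hPX : ∀ n, P n (X n) := by
    intro n
    induction n with
    | zero =>
      refine ⟨hx, 0, ?_, by simp [hS, hX0]⟩
      simpa [hX0] using reach_zero_s10 (f := f) (ℓ := ℓ) hY x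
    | succ n ih =>
      rw [hXs]
      exact hP n _ ih
  have hB : ∀ n, IsRelaxedControl (b n (X n)) := fun n => hb n _ (hPX n)
  obtain ⟨β, hβ, hg⟩ := h.glue hY hB (X := X) (fun n => by rw [hXs]; exact hbe n _ (hPX n))
  rw [hX0] at hg
  set r : ℕ → ℝ := fun j => rc ℓ (b j (X j)) (Y (X j) (b j (X j))) 1 with hr
  have hr0 : ∀ j, 0 ≤ r j := fun j => h.rc_nonneg _ _ zero_le_one
  have hsum : ∀ n, w (X n) + ∑ j ∈ Finset.range n, r j ≤ w x + S n := by
    intro n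
    induction n with
    | zero => simp [hS, hX0]
    | succ n ih =>
      rw [Finset.sum_range_succ, hSd, hXs]
      have := hbc n _ (hPX n)
      have e : rc ℓ (b n (X n)) (Y (X n) (b n (X n))) 1 = r n := rfl
      rw [e] at this
      linarith
  have hsumle : ∀ n, ∑ j ∈ Finset.range n, r j ≤ w x + δ - m := by
    intro n
    have h1 := hsum n
    have h2 := hSle n
    have h3 := hm _ (hPX n).1
    linarith
  have hrt : Tendsto r atTop (𝓝 0) :=
    (summable_of_sum_range_le hr0 hsumle).tendsto_atTop_zero
  have hwX : ∀ n, w (X n) ≤ w x + δ := by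
    intro n
    have h1 := hsum n
    have h2 := hSle n
    have h3 : 0 ≤ ∑ j ∈ Finset.range n, r j := Finset.sum_nonneg fun j _ => hr0 j
    linarith
  have hfin := h.lint_le hβ (hY x β hβ).2.1 (D := w x + δ - m) (fun n => by
    rw [(hg n).2]; exact hsumle n)
  have hbdd : ∃ M t : ℝ, ∀ s, t ≤ s → ‖Y x β s‖ ≤ M := by
    by_contra hcon
    push Not at hcon
    rw [hH6 x β hβ hcon] at hfin
    exact absurd hfin (by simp)
  obtain ⟨M, t, hMt⟩ := hbdd
  have hK : IsCompact ({z | z ∈ Ω ∧ w z ≤ w x + δ} ∩ closedBall (0 : EE N) M) :=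
    (isCompact_closedBall _ _).inter_left (closed_sub hΩ hw hblow _)
  obtain ⟨z, hz, φ, hφ, hlim⟩ := hK.tendsto_subseq (x := fun n => X (⌈t⌉₊ + n)) (fun n => by
    refine ⟨⟨(hPX _).1, hwX _⟩, ?_⟩
    rw [mem_closedBall_zero_iff, ← (hg _).1]
    refine hMt _ ((Nat.le_ceil t).trans ?_)
    exact_mod_cast Nat.le_add_right _ _)
  set ψ : ℕ → ℕ := fun n => ⌈t⌉₊ + φ n with hψ
  have hψt : Tendsto ψ atTop atTop := tendsto_atTop_mono (fun n => Nat.le_add_left _ _) hφ.tendsto_atTop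
  have hlim' : Tendsto (fun n => X (ψ n)) atTop (𝓝 z) := hlim
  by_cases hzT : z ∈ T
  · have h1 : ∀ᶠ n in atTop, X (ψ n) ∈ interior {x | Near T ℓ Y x (δ / 4)} :=
      hlim' (isOpen_interior.mem_nhds (h.stc hY hSTC (by positivity) hzT))
    have h2 : Tendsto (fun n => w (X (ψ n))) atTop (𝓝 (w z)) :=
      Tendsto.comp (hw.continuousAt (hΩ.mem_nhds hz.1.1)) hlim'
    rw [hwT z hzT] at h2
    have h3 : ∀ᶠ n in atTop, -(δ / 4) < w (X (ψ n)) :=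
      h2.eventually_const_lt (by linarith)
    obtain ⟨n, h4, h5⟩ := (h1.and h3).exists
    obtain ⟨_, c, hrc, hc⟩ := hPX (ψ n)
    have h6 : X (ψ n) ∈ {x | Near T ℓ Y x (δ / 4)} := interior_subset h4
    have h6' : Near T ℓ Y (X (ψ n)) (δ / 4) := h6
    refine hno ((h.near_of_reach hY hrc h6').mono ?_)
    have := hSle (ψ n)
    linarith
  · obtain ⟨β', hβ', h0⟩ := h.compactness hY hlim' (fun n => hB (ψ n)) (hrt.comp hψt)
    have := hH5' z ⟨hΩR hz.1.1, hzT⟩ β' hβ' 1 one_pos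
    rw [h.runCost_eq hβ' (hY z β' hβ').2.1 zero_le_one, h0] at this
    simp at this

end nearall

/-- the local uniqueness theorem.  Let `R` be the set of points
controllable to `T` in finite time and let `Ω ⊆ R` be open and contain `T`.  Under
`(STCT)`, `(H₅')` and `(H₆)`, any continuous viscosity solution `w` of the HJBE on
`Ω ∖ T` that is bounded from below on `Ω`, vanishes on `T`, and blows up at `∂Ω`
coincides with the value function `v` on `Ω`. -/
theorem local_uniqueness {N : ℕ} {A : Type*} [MetricSpace A] [CompactSpace A] [Nonempty A]
    [MeasurableSpace A] [BorelSpace A]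
    (T : Set (EuclideanSpace ℝ (Fin N))) (hTcl : IsClosed T) (hTne : T.Nonempty)
    (f : EuclideanSpace ℝ (Fin N) → A → EuclideanSpace ℝ (Fin N))
    (hf : Continuous fun q : EuclideanSpace ℝ (Fin N) × A => f q.1 q.2)
    (L : ℝ) (hL : 0 < L)
    (hfLip : ∀ x y a, ‖f x a - f y a‖ ≤ L * ‖x - y‖)
    (ℓ : EuclideanSpace ℝ (Fin N) → A → ℝ)
    (hℓ : Continuous fun q : EuclideanSpace ℝ (Fin N) × A => ℓ q.1 q.2)
    (hℓnn : ∀ x a, 0 ≤ ℓ x a)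
    (Y : EuclideanSpace ℝ (Fin N) → (ℝ → Measure A) → ℝ → EuclideanSpace ℝ (Fin N))
    (hY : ∀ x β, IsRelaxedControl β → IsTrajectory f β x (Y x β))
    (hSTC : ∀ ε > (0:ℝ), T ⊆ interior {x | ∃ t, 0 ≤ t ∧ t < ε ∧
        ∃ β, IsRelaxedControl β ∧ Y x β t ∈ T})
    -- (H₅'): positivity of running costs for initial points in `R ∖ T`
    (hH5' : ∀ x ∈ {x | ∃ β, IsRelaxedControl β ∧ (exitTimes T (Y x β)).Nonempty} \ T,
        ∀ β, IsRelaxedControl β → ∀ t > (0:ℝ), 0 < runCost ℓ β (Y x β) t)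
    (hH6 : ∀ x β, IsRelaxedControl β →
        (∀ M : ℝ, ∀ t : ℝ, ∃ s, t ≤ s ∧ M < ‖Y x β s‖) →
        (∫⁻ s in Ioi (0:ℝ), ENNReal.ofReal (∫ a, ℓ (Y x β s) a ∂(β s))) = ⊤)
    -- `Ω ⊆ R` is open and contains `T`
    (Ω : Set (EuclideanSpace ℝ (Fin N))) (hΩo : IsOpen Ω)
    (hΩR : Ω ⊆ {x | ∃ β, IsRelaxedControl β ∧ (exitTimes T (Y x β)).Nonempty})
    (hTΩ : T ⊆ Ω)
    (w : EuclideanSpace ℝ (Fin N) → ℝ) (hw : ContinuousOn w Ω)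
    (hsol : IsViscositySol (HJB f ℓ) (Ω \ T) w)
    (hbb : BddBelow (w '' Ω))
    (hwT : ∀ x ∈ T, w x = 0)
    (hblow : ∀ x₀ ∈ frontier Ω, Tendsto w (𝓝[Ω] x₀) atTop) :
    ∀ x ∈ Ω, (w x : EReal) = valueFn T ℓ Y x := by
  have h : Dyn f ℓ L := ⟨hf, hL, hfLip, hℓ, hℓnn⟩
  obtain ⟨m, hm⟩ := hbb
  have hm' : ∀ z ∈ Ω, m ≤ w z := fun z hz => hm ⟨z, hz, rfl⟩
  intro x hx
  refine le_antisymm (h.w_le_value hY hTcl hΩo hTΩ hw hsol.2 hwT hblow hx) ?_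
  refine EReal.le_of_forall_lt_iff_le.1 fun z hz => ?_
  have hz' : w x < z := by exact_mod_cast hz
  have hn := h.near_all hY hTcl hSTC hH5' hH6 hΩo hΩR hw hsol.1 hm' hwT hblow hx
    (sub_pos.2 hz')
  rw [add_sub_cancel] at hn
  exact h.value_le hY hn
end
end
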